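/- Total reflection: Assume V satisfies assumption (A), m > 0, and E lies in region II, i.e. max(mc² + V⁻, V⁺ − mc²) < E < V⁺ + mc². Suppose m²c⁴ − (V(x)−E)² has a unique real zero t₁(E), which is simple. Then the space of bounded solutions of (H − E)u = 0 is one-dimensional, generated by u = ω_in^− + α_out^− ω_out^−, where α_out^− = −i(1 + hφ₁(h))·exp{(2i/h)(∫_{−∞}^{t₁(E)} Q⁻(t,E) dt + √(E⁻)·t₁(E))}. Moreover u = β_d^+ ω_d^+ with β_d^+ = e^{iπ/4}(1 + hφ₂(h))·exp{(1/h)(∫_{+∞}^{t₁(E)} Q₋⁺(t,E) dt + √(−E⁺)·t₁(E) + i∫_{−∞}^{t₁(E)} Q⁻(t,E) dt + i√(E⁻)·t₁(E))}, where Q₋⁺(t,E) = √((m²c⁴ − (V(t)−E)²)/c²) − √(−E⁺), Q⁻(t,E) = √((−m²c⁴ + (V(t)−E)²)/c²) − √(E⁻), E^± = (−m²c⁴ + (V^± − E)²)/c², and φ₁, φ₂ are classical analytic symbols of non-negative order. -/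

import Mathlib

open Complex Filter Topology MeasureTheory Set

noncomputable section

/-- The sector `𝒮 = {x ∈ ℂ : |Im x| < ε|Re x| + η}`. -/
def Sector (ε η : ℝ) : Set ℂ := {x : ℂ | |x.im| < ε * |x.re| + η}

/-- Assumption (A): `V` is real on the real axis, analytic in a sector `𝒮`
around the real axis, and tends to constants `V^±` at `±∞` in `𝒮` at rate
`⟨x⟩^{-δ}`, `δ > 1`, with `V⁻ < V⁺`. -/
structure AssumptionA (V : ℂ → ℂ) (Vm Vp : ℝ) : Prop where
  lt : Vm < Vp
  real_on_real : ∀ x : ℝ, (V x).im = 0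
  sector : ∃ ε > (0 : ℝ), ∃ η > (0 : ℝ), ∃ δ > (1 : ℝ),
    AnalyticOnNhd ℂ V (Sector ε η) ∧
    (∃ C R : ℝ, ∀ x ∈ Sector ε η, R ≤ x.re →
      ‖V x - (Vp : ℂ)‖ ≤ C * (1 + ‖x‖ ^ 2) ^ (-(δ / 2))) ∧
    (∃ C R : ℝ, ∀ x ∈ Sector ε η, x.re ≤ -R →
      ‖V x - (Vm : ℂ)‖ ≤ C * (1 + ‖x‖ ^ 2) ^ (-(δ / 2)))

/-- `u = (u₁,u₂)` solves the one-dimensional Dirac equation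
`(-i h c σ₁ d/dx + m c² σ₃ + V(x) I₂) u = E u` on `ℝ`. -/
structure IsDiracSolution (hp m c : ℝ) (V : ℂ → ℂ) (E : ℝ) (u : ℝ → ℂ × ℂ) : Prop where
  diff1 : Differentiable ℝ fun x : ℝ => (u x).1
  diff2 : Differentiable ℝ fun x : ℝ => (u x).2
  eq1 : ∀ x : ℝ,
    -Complex.I * (hp : ℂ) * (c : ℂ) * deriv (fun y : ℝ => (u y).2) x
      + ((m : ℂ) * (c : ℂ) ^ 2 + V x) * (u x).1 = (E : ℂ) * (u x).1
  eq2 : ∀ x : ℝ,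
    -Complex.I * (hp : ℂ) * (c : ℂ) * deriv (fun y : ℝ => (u y).1) x
      + (-((m : ℂ) * (c : ℂ) ^ 2) + V x) * (u x).2 = (E : ℂ) * (u x).2

/-- `Φ(λ) = sgn(λ) √(λ² − m²c⁴)`. -/
def PhiF (m c lam : ℝ) : ℝ := Real.sign lam * Real.sqrt (lam ^ 2 - m ^ 2 * c ^ 4)

/-- `A(λ) = ((λ + mc²)/(λ − mc²))^{1/4}`. -/
def AmpF (m c lam : ℝ) : ℝ := ((lam + m * c ^ 2) / (lam - m * c ^ 2)) ^ ((1 : ℝ) / 4)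

/-- `u(x)` behaves exactly like `e^{θ x} v` along the filter `l`,
i.e. `u(x) e^{-θ x} → v`. -/
def JostAsymp (u : ℝ → ℂ × ℂ) (θ : ℂ) (v : ℂ × ℂ) (l : Filter ℝ) : Prop :=
  Tendsto (fun x : ℝ => (u x).1 * Complex.exp (-(θ * (x : ℂ)))) l (𝓝 v.1) ∧
  Tendsto (fun x : ℝ => (u x).2 * Complex.exp (-(θ * (x : ℂ)))) l (𝓝 v.2)

/-- `u` behaves exactly like `exp(s (i/(hc)) Φ(E−V₀) x) · (A(E−V₀), s' A(E−V₀)⁻¹)`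
along `l`.  The Jost solutions `ω_in^±` correspond to `s = s' = ∓1`, `l = at±∞`,
and `ω_out^±` to `s = s' = ±1`, `l = at±∞`. -/
def JostCond (hp m c E V0 s s' : ℝ) (l : Filter ℝ) (u : ℝ → ℂ × ℂ) : Prop :=
  JostAsymp u ((s : ℂ) * Complex.I / ((hp : ℂ) * (c : ℂ)) * ((PhiF m c (E - V0) : ℝ) : ℂ))
    (((AmpF m c (E - V0) : ℝ) : ℂ), (s' : ℂ) * (((AmpF m c (E - V0) : ℝ) : ℂ))⁻¹) l

/-- `B^± = ((mc² + E − V^±)/(mc² − E + V^±))^{1/4}`. -/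
def Bsym (m c E W : ℝ) : ℝ := ((m * c ^ 2 + E - W) / (m * c ^ 2 - E + W)) ^ ((1 : ℝ) / 4)

/-- The decaying Jost solution `ω_d^±` (for `s = ±1`, `l = at±∞`):
`ω_d^± ~ exp(∓ (1/(hc)) √(m²c⁴ − (V^± − E)²) x) (∓ i B^±, (B^±)⁻¹)`. -/
def DecayCond (hp m c E W s : ℝ) (l : Filter ℝ) (u : ℝ → ℂ × ℂ) : Prop :=
  JostAsymp u (-(s : ℂ) * ((Real.sqrt (m ^ 2 * c ^ 4 - (W - E) ^ 2) : ℝ) : ℂ) / ((hp : ℂ) * (c : ℂ)))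
    (-(s : ℂ) * Complex.I * ((Bsym m c E W : ℝ) : ℂ), (((Bsym m c E W : ℝ) : ℂ))⁻¹) l

/-- The defining relation `(ω_in^−, ω_in^+) = (ω_out^+, ω_out^−) · 𝕊` of the
scattering matrix. -/
def ScatRel (ωinm ωinp ωoutp ωoutm : ℝ → ℂ × ℂ) (S : Matrix (Fin 2) (Fin 2) ℂ) : Prop :=
  (∀ x : ℝ, ωinm x = S 0 0 • ωoutp x + S 1 0 • ωoutm x) ∧
  (∀ x : ℝ, ωinp x = S 0 1 • ωoutp x + S 1 1 • ωoutm x)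

/-- A classical analytic symbol (of non-negative order `mo`) in the semiclassical
parameter `h`: there are coefficients `a j` with `‖a j‖ ≤ C^{j+1} j^j` such that
`f(h) − ∑_{0 ≤ j ≤ h⁻¹/(e C₁)} a j h^{mo+j}` is `O(e^{-ρ/h})` for every `C₁ > C`. -/
def IsCAS (f : ℝ → ℂ) : Prop :=
  ∃ (mo : ℕ) (a : ℕ → ℂ) (C : ℝ), 0 < C ∧
    (∀ j : ℕ, ‖a j‖ ≤ C ^ (j + 1) * (j : ℝ) ^ j) ∧
    ∀ C₁ : ℝ, C < C₁ → ∃ ρ > (0 : ℝ), ∃ M : ℝ,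
      ∀ h : ℝ, 0 < h → h < 1 →
        ‖f h - ∑ j ∈ Finset.range (⌊1 / (h * Real.exp 1 * C₁)⌋₊ + 1), a j * (h : ℂ) ^ (mo + j)‖
          ≤ M * Real.exp (-ρ / h)

/-- `E^± = (−m²c⁴ + (V^± − E)²)/c²`. -/
def Esym (m c E W : ℝ) : ℝ := (-(m ^ 2 * c ^ 4) + (W - E) ^ 2) / c ^ 2

/-- `Q^±(t,E) = √((−m²c⁴ + (V(t) − E)²)/c²) − √(E^±)` (here `W = V^±`). -/
def Qsym (m c E W : ℝ) (V : ℂ → ℂ) (t : ℝ) : ℝ :=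
  Real.sqrt ((-(m ^ 2 * c ^ 4) + ((V t).re - E) ^ 2) / c ^ 2) - Real.sqrt (Esym m c E W)

/-- `Q₋^±(t,E) = √((m²c⁴ − (V(t) − E)²)/c²) − √(−E^±)` (here `W = V^±`). -/
def Qminus (m c E W : ℝ) (V : ℂ → ℂ) (t : ℝ) : ℝ :=
  Real.sqrt ((m ^ 2 * c ^ 4 - ((V t).re - E) ^ 2) / c ^ 2) - Real.sqrt (-(Esym m c E W))

/-- The classical action `S(E)` between the turning points. -/
def SAct (m c E : ℝ) (V : ℂ → ℂ) (t₁ t₂ : ℝ) : ℝ :=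
  ∫ t in t₁..t₂, Real.sqrt ((m ^ 2 * c ^ 4 - ((V t).re - E) ^ 2) / c ^ 2)

/-- The phase `T(E)`. -/
def TPhase (m c E Vm Vp : ℝ) (V : ℂ → ℂ) (t₁ t₂ : ℝ) : ℝ :=
  (∫ t in Set.Iic t₁, Qsym m c E Vm V t) - (∫ t in Set.Ici t₂, Qsym m c E Vp V t)
    + t₁ * Real.sqrt (Esym m c E Vm) + t₂ * Real.sqrt (Esym m c E Vp)

/-- The Wronskian of two vectors in `ℂ²`. -/
def Wron (u v : ℂ × ℂ) : ℂ := u.1 * v.2 - u.2 * v.1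

end

/-- `f` has the Gevrey-1 asymptotic expansion `∑ aₙ hⁿ` on `(0, h₀)`: the `n`-th Taylor remainder
divided by `hⁿ` is bounded by `C ^ (n + 1) * n!`. -/
def HasGevreyExpansion (h₀ : ℝ) (f : ℝ → ℂ) (a : ℕ → ℂ) : Prop :=
  ∃ (R : ℕ → ℝ → ℂ) (C : ℝ), 1 ≤ C ∧ ∀ h : ℝ, 0 < h → h < h₀ → R 0 h = f h ∧
    ∀ n : ℕ, R n h = a n + h * R (n + 1) h ∧ ‖R n h‖ ≤ C ^ (n + 1) * n.factorial

namespace HasGevreyExpansion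

variable {h₀ : ℝ} {f g : ℝ → ℂ} {a b : ℕ → ℂ}

theorem mono (hf : HasGevreyExpansion h₀ f a) {h₁ : ℝ} (h : h₁ ≤ h₀) :
    HasGevreyExpansion h₁ f a := by
  obtain ⟨R, C, hC, H⟩ := hf
  exact ⟨R, C, hC, fun h hh hh1 => H h hh (hh1.trans_le ‹_›)⟩

theorem congr (hf : HasGevreyExpansion h₀ f a) (hfg : ∀ h, 0 < h → h < h₀ → f h = g h) :
    HasGevreyExpansion h₀ g a := by
  obtain ⟨R, C, hC, H⟩ := hf
  exact ⟨R, C, hC, fun h hh hh1 => ⟨(H h hh hh1).1.trans (hfg h hh hh1), (H h hh hh1).2⟩⟩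

theorem of_bound {C : ℝ} (hC : 1 ≤ C)
    (H : ∀ h : ℝ, 0 < h → h < h₀ → ∀ n : ℕ,
      ‖f h - ∑ j ∈ Finset.range n, a j * (h : ℂ) ^ j‖ ≤ C ^ (n + 1) * n.factorial * h ^ n) :
    HasGevreyExpansion h₀ f a := by
  refine ⟨fun n h => (f h - ∑ j ∈ Finset.range n, a j * (h : ℂ) ^ j) / (h : ℂ) ^ n, C, hC, ?_⟩
  intro h hh hh0
  have hne : (h : ℂ) ≠ 0 := by exact_mod_cast hh.ne'
  refine ⟨by simp, fun n => ⟨?_, ?_⟩⟩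
  · beta_reduce
    rw [Finset.sum_range_succ]
    field_simp
    ring
  · have hb := H h hh hh0 n
    rw [norm_div, norm_pow, Complex.norm_of_nonneg hh.le, div_le_iff₀ (by positivity)]
    exact hb

theorem eq_sum {R : ℕ → ℝ → ℂ} {h : ℝ} (h0 : R 0 h = f h)
    (hR : ∀ n, R n h = a n + h * R (n + 1) h) (n : ℕ) :
    f h = ∑ j ∈ Finset.range n, a j * (h : ℂ) ^ j + h ^ n * R n h := by
  induction n with
  | zero => simp [h0]
  | succ n ih =>
    rw [ih, Finset.sum_range_succ, hR n]
    ring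

theorem tail (hf : HasGevreyExpansion h₀ f a) :
    HasGevreyExpansion h₀ (fun h => (f h - a 0) / h) (fun n => a (n + 1)) := by
  obtain ⟨R, C, hC, H⟩ := hf
  refine ⟨fun n => R (n + 1), 2 * C ^ 2, by nlinarith, fun h hh hh0 => ?_⟩
  obtain ⟨h1, h2⟩ := H h hh hh0
  have hne : (h : ℂ) ≠ 0 := by exact_mod_cast hh.ne'
  refine ⟨?_, fun n => ⟨(h2 _).1, ?_⟩⟩
  · have := (h2 0).1
    beta_reduce
    rw [← h1, this]
    field_simp
    ring
  · refine (h2 _).2.trans ?_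
    have e1 : ((n + 1 : ℕ) : ℝ) ≤ 2 ^ (n + 1) := by exact_mod_cast (Nat.lt_two_pow_self).le
    have e2 : C ^ (n + 1 + 1) ≤ (C ^ 2) ^ (n + 1) := by
      rw [← pow_mul]; exact pow_le_pow_right₀ hC (by omega)
    rw [Nat.factorial_succ, mul_pow]
    push_cast at *
    have : (0 : ℝ) ≤ n.factorial := by positivity
    have : (0 : ℝ) ≤ C ^ (n + 1 + 1) := by positivity
    calc C ^ (n + 1 + 1) * (((n : ℝ) + 1) * n.factorial)
        ≤ (C ^ 2) ^ (n + 1) * (2 ^ (n + 1) * n.factorial) := by gcongr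
      _ = _ := by ring

theorem sub (hf : HasGevreyExpansion h₀ f a) (hg : HasGevreyExpansion h₀ g b) :
    HasGevreyExpansion h₀ (fun h => f h - g h) (fun n => a n - b n) := by
  obtain ⟨R, C, hC, H⟩ := hf
  obtain ⟨S, D, hD, H'⟩ := hg
  refine ⟨fun n h => R n h - S n h, C + D, by linarith, fun h hh hh0 => ?_⟩
  obtain ⟨h1, h2⟩ := H h hh hh0
  obtain ⟨h1', h2'⟩ := H' h hh hh0
  refine ⟨by simp [h1, h1'], fun n => ⟨?_, ?_⟩⟩
  · beta_reduce
    rw [(h2 n).1, (h2' n).1]; ring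
  · refine (norm_sub_le _ _).trans ((add_le_add (h2 n).2 (h2' n).2).trans ?_)
    rw [← add_mul]
    gcongr
    exact pow_add_pow_le (by linarith) (by linarith) (by omega)

theorem star (hf : HasGevreyExpansion h₀ f a) :
    HasGevreyExpansion h₀ (fun h => (starRingEnd ℂ) (f h)) (fun n => (starRingEnd ℂ) (a n)) := by
  obtain ⟨R, C, hC, H⟩ := hf
  refine ⟨fun n h => (starRingEnd ℂ) (R n h), C, hC, fun h hh hh0 => ?_⟩
  obtain ⟨h1, h2⟩ := H h hh hh0
  refine ⟨by simp [h1], fun n => ⟨?_, ?_⟩⟩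
  · beta_reduce
    rw [(h2 n).1]; simp
  · rw [Complex.norm_conj]; exact (h2 n).2

theorem coeff_bound {R : ℕ → ℝ → ℂ} {C h : ℝ} (hC : 1 ≤ C) (hh : 0 < h) (hh1 : h ≤ 1)
    (H : ∀ n : ℕ, R n h = a n + h * R (n + 1) h ∧ ‖R n h‖ ≤ C ^ (n + 1) * n.factorial) (n : ℕ) :
    ‖a n‖ ≤ (4 * C ^ 2) ^ (n + 1) * n.factorial := by
  have e : a n = R n h - h * R (n + 1) h := by rw [(H n).1]; ring
  have e1 : ((n + 1 : ℕ) : ℝ) ≤ 2 ^ (n + 1) := by exact_mod_cast (Nat.lt_two_pow_self).le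
  have e2 : C ^ (n + 1 + 1) ≤ (C ^ 2) ^ (n + 1) := by
    rw [← pow_mul]; exact pow_le_pow_right₀ hC (by omega)
  have e3 : C ^ (n + 1) ≤ (C ^ 2) ^ (n + 1) := by
    rw [← pow_mul]; exact pow_le_pow_right₀ hC (by omega)
  have hb := (H (n + 1)).2
  rw [Nat.factorial_succ] at hb
  push_cast at hb e1
  calc ‖a n‖ ≤ ‖R n h‖ + h * ‖R (n + 1) h‖ := by
        rw [e]; refine (norm_sub_le _ _).trans ?_
        rw [norm_mul, Complex.norm_of_nonneg hh.le]
    _ ≤ C ^ (n + 1) * n.factorial + 1 * (C ^ (n + 1 + 1) * (((n : ℝ) + 1) * n.factorial)) := by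
        gcongr; exact (H n).2
    _ ≤ (C ^ 2) ^ (n + 1) * n.factorial
          + 1 * ((C ^ 2) ^ (n + 1) * (2 ^ (n + 1) * n.factorial)) := by gcongr
    _ = (1 + 2 ^ (n + 1)) * (C ^ 2) ^ (n + 1) * n.factorial := by ring
    _ ≤ 4 ^ (n + 1) * (C ^ 2) ^ (n + 1) * n.factorial := by
        gcongr
        have : (4 : ℝ) ^ (n + 1) = 2 ^ (n + 1) * 2 ^ (n + 1) := by
          rw [← mul_pow]; norm_num
        have : (2 : ℝ) ≤ 2 ^ (n + 1) := le_self_pow₀ (by norm_num) (by omega)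
        nlinarith
    _ = _ := by rw [mul_pow]

theorem exists_coeff_bound (h0 : 0 < h₀) (hf : HasGevreyExpansion h₀ f a) :
    ∃ D : ℝ, 1 ≤ D ∧ ∀ n, ‖a n‖ ≤ D ^ (n + 1) * n.factorial := by
  obtain ⟨R, C, hC, H⟩ := hf
  have hp : 0 < min h₀ 1 / 2 := by positivity
  have hl : min h₀ 1 / 2 < h₀ := by have := min_le_left h₀ 1; linarith
  have hl' : min h₀ 1 / 2 ≤ 1 := by have := min_le_right h₀ 1; linarith
  exact ⟨4 * C ^ 2, by nlinarith, coeff_bound hC hp hl' (H _ hp hl).2⟩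

theorem factorial_mul_le {n k : ℕ} (hk : k ≤ n) :
    (k.factorial : ℝ) * (n - k).factorial ≤ n.factorial := by
  exact_mod_cast Nat.le_of_dvd (Nat.factorial_pos n) (Nat.factorial_mul_factorial_dvd_factorial hk)

theorem mul (h0 : 0 < h₀) (hf : HasGevreyExpansion h₀ f a) (hg : HasGevreyExpansion h₀ g b) :
    HasGevreyExpansion h₀ (fun h => f h * g h)
      (fun n => ∑ j ∈ Finset.range (n + 1), a j * b (n - j)) := by
  obtain ⟨A, hA, ha⟩ := exists_coeff_bound h0 hf
  obtain ⟨R, C, hC, H⟩ := hf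
  obtain ⟨S, D, hD, H'⟩ := hg
  set T := A + C + D with hT
  have hT1 : 1 ≤ T := by linarith
  refine ⟨fun n h => ∑ j ∈ Finset.range n, a j * S (n - j) h + R n h * S 0 h, 2 * T ^ 2,
    by nlinarith, fun h hh hh0 => ?_⟩
  obtain ⟨h1, h2⟩ := H h hh hh0
  obtain ⟨h1', h2'⟩ := H' h hh hh0
  refine ⟨by simp [h1, h1'], fun n => ⟨?_, ?_⟩⟩
  · beta_reduce
    rw [Finset.sum_range_succ (fun j => a j * b (n - j)),
      Finset.sum_range_succ (fun j => a j * S (n + 1 - j) h)]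
    rw [(h2 n).1, (h2' 0).1]
    have : ∀ j ∈ Finset.range n, a j * S (n - j) h
        = a j * b (n - j) + h * (a j * S (n + 1 - j) h) := by
      intro j hj
      have hj' : j < n := Finset.mem_range.1 hj
      rw [(h2' (n - j)).1, show n + 1 - j = n - j + 1 by omega]; ring
    rw [Finset.sum_congr rfl this, Finset.sum_add_distrib, ← Finset.mul_sum]
    simp only [Nat.sub_self, Nat.add_sub_cancel_left, zero_add]
    ring
  · have hTA : A ≤ T := by linarith
    have hTC : C ≤ T := by linarith
    have hTD : D ≤ T := by linarith
    have hterm : ∀ j ∈ Finset.range n, ‖a j * S (n - j) h‖ ≤ T ^ (n + 2) * n.factorial := by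
      intro j hj
      have hj' : j < n := Finset.mem_range.1 hj
      rw [norm_mul]
      calc ‖a j‖ * ‖S (n - j) h‖
          ≤ (A ^ (j + 1) * j.factorial) * (D ^ (n - j + 1) * (n - j).factorial) := by
            gcongr
            · exact ha j
            · exact (h2' _).2
        _ ≤ (T ^ (j + 1) * j.factorial) * (T ^ (n - j + 1) * (n - j).factorial) := by gcongr
        _ = T ^ (n + 2) * (j.factorial * (n - j).factorial) := by
            rw [show n + 2 = (j + 1) + (n - j + 1) by omega, pow_add]; ring
        _ ≤ _ := by gcongr; exact factorial_mul_le hj'.le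
    have hlast : ‖R n h * S 0 h‖ ≤ T ^ (n + 2) * n.factorial := by
      rw [norm_mul]
      calc ‖R n h‖ * ‖S 0 h‖ ≤ (C ^ (n + 1) * n.factorial) * (D ^ (0 + 1) * (0).factorial) := by
            gcongr
            · exact (h2 n).2
            · exact (h2' 0).2
        _ ≤ (T ^ (n + 1) * n.factorial) * (T ^ (0 + 1) * (0).factorial) := by gcongr
        _ = _ := by simp; ring
    have hs : ‖∑ j ∈ Finset.range n, a j * S (n - j) h‖ ≤ n * (T ^ (n + 2) * n.factorial) := by
      refine (norm_sum_le_of_le _ hterm).trans ?_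
      simp
    refine (norm_add_le _ _).trans ((add_le_add hs hlast).trans ?_)
    have e1 : ((n + 1 : ℕ) : ℝ) ≤ 2 ^ (n + 1) := by exact_mod_cast (Nat.lt_two_pow_self).le
    push_cast at e1
    have e2 : T ^ (n + 2) ≤ (T ^ 2) ^ (n + 1) := by
      rw [← pow_mul]; exact pow_le_pow_right₀ hT1 (by omega)
    calc n * (T ^ (n + 2) * n.factorial) + T ^ (n + 2) * n.factorial
        = (n + 1 : ℝ) * T ^ (n + 2) * n.factorial := by ring
      _ ≤ 2 ^ (n + 1) * (T ^ 2) ^ (n + 1) * n.factorial := by gcongr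
      _ = _ := by rw [mul_pow]

/-- Coefficients of the inverse of a formal power series with constant coefficient `1`. -/
noncomputable def invCoeff (a : ℕ → ℂ) : ℕ → ℂ
  | 0 => 1
  | n + 1 => -∑ j : Fin (n + 1), a (j + 1) * invCoeff a (n - j)

theorem sum_mul_invCoeff (h1 : a 0 = 1) (n : ℕ) :
    ∑ j ∈ Finset.range (n + 2), a j * invCoeff a (n + 1 - j) = 0 := by
  rw [Finset.sum_range_succ', h1]
  simp only [Nat.add_sub_add_right, tsub_zero, one_mul]
  rw [invCoeff, Finset.sum_range (fun j => a (j + 1) * invCoeff a (n - j))]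
  ring

theorem inv (h0 : 0 < h₀) (hf : HasGevreyExpansion h₀ f a) (h1 : a 0 = 1) :
    ∃ h₁, 0 < h₁ ∧ h₁ ≤ h₀ ∧ (∀ h, 0 < h → h < h₁ → f h ≠ 0) ∧
      HasGevreyExpansion h₁ (fun h => (f h)⁻¹) (invCoeff a) := by
  obtain ⟨A, hA, ha⟩ := exists_coeff_bound h0 hf
  obtain ⟨R, C, hC, H⟩ := hf
  have hC0 : 0 < C := by linarith
  set h₁ := min h₀ (1 / (2 * C ^ 2)) with hh₁
  have hl1 : h₁ ≤ h₀ := min_le_left _ _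
  have hpos : 0 < h₁ := by positivity
  have hhalf : ∀ h, 0 < h → h < h₁ → 1 / 2 ≤ ‖f h‖ := by
    intro h hh hhl
    obtain ⟨e0, e⟩ := H h hh (hhl.trans_le hl1)
    have e1 : f h = 1 + h * R 1 h := by rw [← e0, (e 0).1, h1]
    have e2 : ‖(h : ℂ) * R 1 h‖ ≤ 1 / 2 := by
      rw [norm_mul, Complex.norm_of_nonneg hh.le]
      have := (e 1).2
      have hl2 : h ≤ 1 / (2 * C ^ 2) := (hhl.trans_le (min_le_right _ _)).le
      calc h * ‖R 1 h‖ ≤ 1 / (2 * C ^ 2) * (C ^ (1 + 1) * (1).factorial) := by gcongr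
        _ = 1 / 2 := by simp; field_simp
    have e3 : ‖(1 : ℂ)‖ ≤ ‖f h‖ + ‖(h : ℂ) * R 1 h‖ := by
      have : (1 : ℂ) = f h - h * R 1 h := by rw [e1]; ring
      calc ‖(1 : ℂ)‖ = ‖f h - h * R 1 h‖ := by rw [← this]
        _ ≤ _ := norm_sub_le _ _
    rw [norm_one] at e3
    linarith
  have hne : ∀ h, 0 < h → h < h₁ → f h ≠ 0 := by
    intro h hh hhl hz
    have := hhalf h hh hhl
    rw [hz, norm_zero] at this
    norm_num at this
  refine ⟨h₁, hpos, hl1, hne, ?_⟩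
  set T := A + C with hT
  have hTA : A ≤ T := by linarith
  have hTC : C ≤ T := by linarith
  have hT1 : 1 ≤ T := by linarith
  set b := invCoeff a with hb
  set S : ℕ → ℝ → ℂ := fun n h => ((f h)⁻¹ - ∑ j ∈ Finset.range n, b j * (h : ℂ) ^ j) / (h : ℂ) ^ n
    with hS
  set D : ℝ := 8 * T ^ 2 with hD
  have hD1 : 1 ≤ D := by nlinarith
  refine ⟨S, D, hD1, fun h hh hhl => ?_⟩
  have hhc : (h : ℂ) ≠ 0 := by exact_mod_cast hh.ne'
  have hS0 : S 0 h = (f h)⁻¹ := by simp [hS]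
  have hSr : ∀ n, S n h = b n + h * S (n + 1) h := by
    intro n
    simp only [hS, Finset.sum_range_succ]
    field_simp
    ring
  obtain ⟨e0, e⟩ := H h hh (hhl.trans_le hl1)
  -- the remainders of the constant function `f * f⁻¹`
  have key : ∀ n, ∑ j ∈ Finset.range (n + 1), a j * S (n + 1 - j) h + R (n + 1) h * S 0 h = 0 := by
    intro n
    induction n with
    | zero =>
      have h3 : R 0 h * S 0 h = 1 := by rw [e0, hS0]; exact mul_inv_cancel₀ (hne h hh hhl)
      have h4 := hSr 0
      have h5 := (e 0).1
      have h6 : b 0 = 1 := by simp [hb, invCoeff]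
      simp only [zero_add, Finset.range_one, Finset.sum_singleton, tsub_zero, h1, one_mul] at *
      rw [h6] at h4
      apply mul_left_cancel₀ hhc
      linear_combination h3 - h4 - S 0 h * h5
    | succ n ih =>
      have h3 := sum_mul_invCoeff h1 n
      rw [Finset.sum_range_succ] at h3
      have hsum : ∑ j ∈ Finset.range (n + 1), a j * S (n + 1 - j) h
          = ∑ j ∈ Finset.range (n + 1), a j * b (n + 1 - j)
            + h * ∑ j ∈ Finset.range (n + 1), a j * S (n + 1 + 1 - j) h := by
        rw [Finset.mul_sum, ← Finset.sum_add_distrib]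
        refine Finset.sum_congr rfl fun j hj => ?_
        have hj' : j < n + 1 := Finset.mem_range.1 hj
        rw [hSr (n + 1 - j), show n + 1 + 1 - j = n + 1 - j + 1 by omega]; ring
      rw [hsum] at ih
      rw [Finset.sum_range_succ]
      have h4 := hSr 0
      have h5 := (e (n + 1)).1
      have h6 : b (n + 1 - (n + 1)) = b 0 := by simp
      have h7 : S (n + 1 + 1 - (n + 1)) h = S (0 + 1) h := by simp
      rw [← hb, h6] at h3
      rw [h7]
      apply mul_left_cancel₀ hhc
      linear_combination ih - h3 - S 0 h * h5 - a (n + 1) * h4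
  have hbound : ∀ n : ℕ, ‖S n h‖ ≤ D ^ (n + 1) * n.factorial := by
    intro n
    induction n using Nat.strong_induction_on with
    | _ n ih =>
    have hSz : ‖S 0 h‖ ≤ 2 := by
      rw [hS0, norm_inv]
      have := hhalf h hh hhl
      exact inv_le_of_inv_le₀ (by norm_num) (by linarith)
    cases n with
    | zero =>
      refine hSz.trans ?_
      simp; nlinarith
    | succ n =>
      have h3 := key n
      rw [Finset.sum_range_succ', h1] at h3
      have h4 : S (n + 1) h = -(∑ j ∈ Finset.range n, a (j + 1) * S (n - j) h)
          - R (n + 1) h * S 0 h := by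
        simp only [tsub_zero, one_mul, Nat.add_sub_add_right] at h3
        linear_combination h3
      rw [h4]
      have hterm : ∀ j ∈ Finset.range n, ‖a (j + 1) * S (n - j) h‖
          ≤ D ^ (n + 2) * (n + 1).factorial * (T * (T / D) * (T / D) ^ j) := by
        intro j hj
        have hj' : j < n := Finset.mem_range.1 hj
        have hD0 : D ≠ 0 := by positivity
        rw [norm_mul]
        calc ‖a (j + 1)‖ * ‖S (n - j) h‖
            ≤ (A ^ (j + 1 + 1) * (j + 1).factorial) * (D ^ (n - j + 1) * (n - j).factorial) := by
              gcongr
              · exact ha _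
              · exact ih _ (by omega)
          _ ≤ (T ^ (j + 1 + 1) * (j + 1).factorial) * (D ^ (n - j + 1) * (n - j).factorial) := by
              gcongr
          _ = (T ^ (j + 2) * D ^ (n - j + 1)) * ((j + 1).factorial * (n - j).factorial) := by ring
          _ ≤ (T ^ (j + 2) * D ^ (n - j + 1)) * (n + 1).factorial := by
              gcongr
              have := factorial_mul_le (n := n + 1) (k := j + 1) (by omega)
              rwa [show n + 1 - (j + 1) = n - j by omega] at this
          _ = _ := by
              rw [show n + 2 = (n - j + 1) + 1 + j by omega, pow_add D, pow_add D, div_pow]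
              field_simp
              ring
      have hTD : T / D ≤ 1 / 8 := by
        rw [hD, div_le_div_iff₀ (by positivity) (by norm_num)]; nlinarith
      have hTTD : T * (T / D) = 1 / 8 := by rw [hD]; field_simp
      have hgeom : ∑ j ∈ Finset.range n, (T / D) ^ j ≤ 2 := by
        have h8 : ∑ j ∈ Finset.range n, (T / D) ^ j ≤ ∑ j ∈ Finset.range n, (1 / 2 : ℝ) ^ j := by
          refine Finset.sum_le_sum fun j _ => pow_le_pow_left₀ (by positivity) (by linarith) _
        refine h8.trans (sum_geometric_two_le n)
      have hsum : ‖∑ j ∈ Finset.range n, a (j + 1) * S (n - j) h‖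
          ≤ D ^ (n + 2) * (n + 1).factorial * (1 / 4) := by
        refine (norm_sum_le_of_le _ hterm).trans ?_
        rw [← Finset.mul_sum, ← Finset.mul_sum, hTTD]
        gcongr
        linarith
      have hlast : ‖R (n + 1) h * S 0 h‖ ≤ D ^ (n + 2) * (n + 1).factorial * (1 / 4) := by
        rw [norm_mul]
        have h9 : C ^ (n + 1 + 1) ≤ T ^ (n + 2) := by gcongr
        have h10 : T ^ (n + 2) * 8 ≤ D ^ (n + 2) := by
          rw [hD, mul_pow, mul_comm]
          have : (8 : ℝ) ≤ 8 ^ (n + 2) := le_self_pow₀ (by norm_num) (by omega)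
          have h11 : T ^ (n + 2) ≤ (T ^ 2) ^ (n + 2) := by
            rw [← pow_mul]; exact pow_le_pow_right₀ hT1 (by omega)
          gcongr
        calc ‖R (n + 1) h‖ * ‖S 0 h‖ ≤ (C ^ (n + 1 + 1) * (n + 1).factorial) * 2 := by
              gcongr
              exact (e (n + 1)).2
          _ ≤ (T ^ (n + 2) * (n + 1).factorial) * 2 := by gcongr
          _ = (T ^ (n + 2) * 8) * (n + 1).factorial * (1 / 4) := by ring
          _ ≤ _ := by gcongr
      have hf0 : 0 ≤ D ^ (n + 2) * (n + 1).factorial := by positivity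
      calc _ ≤ ‖∑ j ∈ Finset.range n, a (j + 1) * S (n - j) h‖ + ‖R (n + 1) h * S 0 h‖ := by
            refine (norm_sub_le _ _).trans ?_
            rw [norm_neg]
        _ ≤ D ^ (n + 1 + 1) * (n + 1).factorial := by
            rw [show n + 1 + 1 = n + 2 by omega]; linarith
  exact ⟨hS0, fun n => ⟨hSr n, hbound n⟩⟩


theorem norm_mul_pow_le {C C₁ h : ℝ} (hC : 0 < C) (hCC : C ≤ C₁) (hh : 0 < h) {j : ℕ}
    (hj : (j : ℝ) ≤ 1 / (h * Real.exp 1 * C₁)) :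
    C ^ j * (j : ℝ) ^ j * h ^ j ≤ Real.exp (-j) := by
  have hC1 : 0 < C₁ := hC.trans_le hCC
  have h1 : C * j * h ≤ Real.exp (-1) := by
    calc C * j * h ≤ C₁ * (1 / (h * Real.exp 1 * C₁)) * h := by gcongr
      _ = Real.exp (-1) := by rw [Real.exp_neg]; field_simp
  calc C ^ j * (j : ℝ) ^ j * h ^ j = (C * j * h) ^ j := by rw [mul_pow, mul_pow]
    _ ≤ (Real.exp (-1)) ^ j := by gcongr
    _ = Real.exp (-j) := by rw [← Real.exp_nat_mul]; simp

theorem isCAS (h0 : 0 < h₀) (hf : HasGevreyExpansion h₀ f a) :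
    IsCAS (fun h => if h < h₀ then f h else 0) := by
  obtain ⟨D, hD, hda⟩ := exists_coeff_bound h0 hf
  obtain ⟨R, C, hC, H⟩ := hf
  set T := C + D with hT
  have hT1 : 1 ≤ T := by linarith
  have hT0 : 0 < T := by linarith
  have hfac : ∀ j : ℕ, (j.factorial : ℝ) ≤ (j : ℝ) ^ j := fun j => by
    exact_mod_cast Nat.factorial_le_pow j
  have haj : ∀ j, ‖a j‖ ≤ T ^ (j + 1) * (j : ℝ) ^ j := by
    intro j
    refine (hda j).trans ?_
    have : D ≤ T := by linarith
    gcongr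
    exact hfac j
  refine ⟨0, a, T, hT0, haj, fun C₁ hC₁ => ?_⟩
  have hC₁0 : 0 < C₁ := hT0.trans hC₁
  set ρ := 1 / (Real.exp 1 * C₁) with hρ
  have hρ0 : 0 < ρ := by positivity
  set M₁ := T ^ 2 * (ρ + 1) * Real.exp 1 with hM₁
  set M₂ := T * (ρ / h₀ + 1) * Real.exp (ρ / h₀) with hM₂
  have hM₁0 : 0 ≤ M₁ := by positivity
  have hM₂0 : 0 ≤ M₂ := by positivity
  refine ⟨ρ, hρ0, M₁ + M₂, fun h hh hh1 => ?_⟩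
  have hx : 1 / (h * Real.exp 1 * C₁) = ρ / h := by rw [hρ]; field_simp
  set N := ⌊1 / (h * Real.exp 1 * C₁)⌋₊ with hN
  have hx0 : 0 ≤ 1 / (h * Real.exp 1 * C₁) := by positivity
  have hNle : (N : ℝ) ≤ 1 / (h * Real.exp 1 * C₁) := Nat.floor_le hx0
  have hNlt : 1 / (h * Real.exp 1 * C₁) < N + 1 := Nat.lt_floor_add_one _
  rw [hx] at hNlt
  simp only [zero_add]
  by_cases hlt : h < h₀
  · rw [if_pos hlt]
    obtain ⟨e0, e⟩ := H h hh hlt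
    have h1 := eq_sum e0 (fun n => (e n).1) (N + 1)
    rw [h1, add_sub_cancel_left, norm_mul, norm_pow, Complex.norm_of_nonneg hh.le]
    have h2 := norm_mul_pow_le hT0 hC₁.le hh hNle
    have h3 : Real.exp (-N) ≤ Real.exp 1 * Real.exp (-ρ / h) := by
      rw [← Real.exp_add]
      apply Real.exp_le_exp.2
      rw [neg_div]; linarith
    have h4 : ((N : ℝ) + 1) * h ≤ ρ + 1 := by
      have : (N : ℝ) * h ≤ ρ := by
        rw [hx] at hNle
        calc (N : ℝ) * h ≤ ρ / h * h := by gcongr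
          _ = ρ := by field_simp
      linarith
    calc h ^ (N + 1) * ‖R (N + 1) h‖
        ≤ h ^ (N + 1) * (C ^ (N + 1 + 1) * (N + 1).factorial) := by gcongr; exact (e _).2
      _ ≤ h ^ (N + 1) * (T ^ (N + 1 + 1) * ((N + 1) * (N : ℝ) ^ N)) := by
          have : C ≤ T := by linarith
          rw [Nat.factorial_succ]
          push_cast
          gcongr
          exact hfac N
      _ = T ^ 2 * (((N : ℝ) + 1) * h) * (T ^ N * (N : ℝ) ^ N * h ^ N) := by ring
      _ ≤ T ^ 2 * (ρ + 1) * (Real.exp 1 * Real.exp (-ρ / h)) := by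
          exact mul_le_mul (by gcongr) (h2.trans h3) (by positivity) (by positivity)
      _ = M₁ * Real.exp (-ρ / h) := by rw [hM₁]; ring
      _ ≤ _ := by gcongr; linarith
  · rw [if_neg hlt, zero_sub, norm_neg]
    have hle : h₀ ≤ h := not_lt.1 hlt
    have h1 : ∀ j ∈ Finset.range (N + 1), ‖a j * (h : ℂ) ^ j‖ ≤ T := by
      intro j hj
      have hjN : j ≤ N := by have := Finset.mem_range.1 hj; omega
      have hj' : (j : ℝ) ≤ 1 / (h * Real.exp 1 * C₁) := by
        refine le_trans ?_ hNle; exact_mod_cast hjN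
      have h2 := norm_mul_pow_le hT0 hC₁.le hh hj'
      rw [norm_mul, norm_pow, Complex.norm_of_nonneg hh.le]
      calc ‖a j‖ * h ^ j ≤ T ^ (j + 1) * (j : ℝ) ^ j * h ^ j := by gcongr; exact haj j
        _ = T * (T ^ j * (j : ℝ) ^ j * h ^ j) := by ring
        _ ≤ T * 1 := by
            gcongr
            refine h2.trans ?_
            rw [Real.exp_le_one_iff]; simp
        _ = T := mul_one _
    have hq : ρ / h ≤ ρ / h₀ := by gcongr
    calc _ ≤ ∑ j ∈ Finset.range (N + 1), T := norm_sum_le_of_le _ h1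
      _ = T * (N + 1) := by simp; ring
      _ ≤ T * (ρ / h₀ + 1) := by rw [hx] at hNle; gcongr; linarith
      _ = M₂ * Real.exp (-(ρ / h₀)) := by rw [hM₂, mul_assoc, ← Real.exp_add]; simp
      _ ≤ M₂ * Real.exp (-ρ / h) := by gcongr; rw [neg_div]; linarith
      _ ≤ _ := by gcongr; linarith

end HasGevreyExpansion

/-- The half-strip `{Re s > -ρ, |Im s| < ρ}`. -/
def halfTube (ρ : ℝ) : Set ℂ := {s : ℂ | -ρ < s.re ∧ |s.im| < ρ}

theorem isOpen_halfTube (ρ : ℝ) : IsOpen (halfTube ρ) :=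
  (isOpen_lt continuous_const continuous_re).inter
    (isOpen_lt (continuous_abs.comp continuous_im) continuous_const)

theorem halfTube_mono {ρ σ : ℝ} (h : ρ ≤ σ) : halfTube ρ ⊆ halfTube σ :=
  fun s hs => ⟨by linarith [hs.1], by linarith [hs.2]⟩

theorem closedBall_subset_halfTube {ρ d : ℝ} {s : ℂ} (hs : s ∈ halfTube (ρ - d)) :
    Metric.closedBall s d ⊆ halfTube ρ := by
  intro z hz
  rw [Metric.mem_closedBall, dist_eq_norm] at hz
  have h1 := (abs_re_le_norm (z - s)).trans hz
  have h2 := (abs_im_le_norm (z - s)).trans hz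
  rw [sub_re, abs_le] at h1
  rw [sub_im, abs_le] at h2
  obtain ⟨h3, h4⟩ := hs
  rw [abs_lt] at h4
  exact ⟨by linarith, by rw [abs_lt]; constructor <;> linarith⟩

theorem add_ofReal_mem_halfTube {ρ : ℝ} {s : ℂ} (hs : s ∈ halfTube ρ) {t : ℝ} (ht : 0 ≤ t) :
    s + t ∈ halfTube ρ := by
  obtain ⟨h3, h4⟩ := hs
  exact ⟨by simp; linarith, by simpa using h4⟩

theorem ofReal_mem_halfTube {ρ : ℝ} (hρ : 0 < ρ) {s : ℝ} (hs : 0 ≤ s) : (s : ℂ) ∈ halfTube ρ :=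
  ⟨by simp; linarith, by simpa using hρ⟩

theorem hasDerivAt_neg_one_div_add {a t : ℝ} (h : 0 < a + t) :
    HasDerivAt (fun t : ℝ => -(1 / (a + t))) (1 / (a + t) ^ 2) t := by
  have h1 : HasDerivAt (fun t : ℝ => a + t) 1 t := (hasDerivAt_id t).const_add a
  have h2 : HasDerivAt (fun t : ℝ => -(a + t)⁻¹) (-(-1 / (a + t) ^ 2)) t := (h1.fun_inv h.ne').fun_neg
  rw [neg_div, neg_neg] at h2
  simpa only [one_div] using h2

theorem tendsto_neg_one_div_add (a : ℝ) :
    Tendsto (fun t : ℝ => -(1 / (a + t))) atTop (𝓝 0) := by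
  have : Tendsto (fun t : ℝ => a + t) atTop atTop := tendsto_atTop_add_const_left _ _ tendsto_id
  simpa using this.inv_tendsto_atTop.neg

theorem integrableOn_one_div_add_sq {a : ℝ} (ha : 0 < a) :
    IntegrableOn (fun t : ℝ => 1 / (a + t) ^ 2) (Ioi 0) :=
  integrableOn_Ioi_deriv_of_nonneg'
    (fun t ht => hasDerivAt_neg_one_div_add (by have := mem_Ici.1 ht; linarith))
    (fun t _ => by positivity) (tendsto_neg_one_div_add a)

theorem integral_one_div_add_sq {a : ℝ} (ha : 0 < a) :
    ∫ t in Ioi (0 : ℝ), 1 / (a + t) ^ 2 = 1 / a := by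
  rw [integral_Ioi_of_hasDerivAt_of_nonneg'
    (fun t ht => hasDerivAt_neg_one_div_add (by have := mem_Ici.1 ht; linarith))
    (fun t _ => by positivity) (tendsto_neg_one_div_add a)]
  simp

section Tail

variable {f : ℂ → ℂ} {ρ : ℝ}

theorem norm_tailIntegral_le {s : ℂ} {M : ℝ} (hs : 0 < 1 + s.re)
    (hM : ∀ t : ℝ, 0 < t → ‖f (s + t)‖ ≤ M * (1 / (1 + s.re + t) ^ 2)) :
    ‖-∫ t in Ioi (0 : ℝ), f (s + t)‖ ≤ M / (1 + s.re) := by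
  rw [norm_neg]
  refine (norm_integral_le_of_norm_le ((integrableOn_one_div_add_sq hs).const_mul M)
    ((ae_restrict_iff' measurableSet_Ioi).2 (Eventually.of_forall hM))).trans ?_
  rw [integral_const_mul, integral_one_div_add_sq hs]
  simp [div_eq_mul_inv]

theorem deriv_weight_bound (hρ : ρ ≤ 1 / 2) (hf : DifferentiableOn ℂ f (halfTube ρ)) {d e X : ℝ}
    (hX : 0 ≤ X) (hd : 0 < d) (he : e + d ≤ ρ)
    (hb : ∀ s ∈ halfTube (e + d), ‖f s‖ ≤ X * (1 / (1 + s.re) ^ 2)) (he0 : 0 < e)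
    {s : ℂ} (hs : s ∈ halfTube e) : ‖deriv f s‖ ≤ 4 * X / d * (1 / (1 + s.re) ^ 2) := by
  have hs' : s ∈ halfTube (e + d - d) := by simpa using hs
  have hsub := closedBall_subset_halfTube hs'
  have h1 : 0 < 1 + s.re := by linarith [hs.1]
  have hdc : DiffContOnCl ℂ f (Metric.ball s d) := by
    apply DifferentiableOn.diffContOnCl
    rw [closure_ball _ hd.ne']
    exact hf.mono (hsub.trans (halfTube_mono he))
  refine (norm_deriv_le_of_forall_mem_sphere_norm_le (C := 4 * X * (1 / (1 + s.re) ^ 2)) hd hdc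
    ?_).trans (le_of_eq (by ring))
  intro z hz
  have hz' := Metric.sphere_subset_closedBall hz
  refine (hb z (hsub hz')).trans ?_
  rw [Metric.mem_closedBall, dist_eq_norm] at hz'
  have h2 := (abs_re_le_norm (z - s)).trans hz'
  rw [sub_re, abs_le] at h2
  have h3 : (1 + s.re) / 2 ≤ 1 + z.re := by linarith [hs.1]
  calc X * (1 / (1 + z.re) ^ 2) ≤ X * (1 / ((1 + s.re) / 2) ^ 2) := by gcongr
    _ = _ := by field_simp; ring

theorem hasDerivAt_tailIntegral (hρ : ρ ≤ 1 / 2) (hf : DifferentiableOn ℂ f (halfTube ρ))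
    (hb : ∀ σ, 0 < σ → σ < ρ → ∃ X : ℝ, 0 ≤ X ∧ ∀ s ∈ halfTube σ, ‖f s‖ ≤ X * (1 / (1 + s.re) ^ 2))
    {s : ℂ} (hs : s ∈ halfTube ρ) :
    HasDerivAt (fun s : ℂ => -∫ t in Ioi (0 : ℝ), f (s + t)) (f s) s := by
  obtain ⟨e, he0, heρ, hse⟩ : ∃ e, 0 < e ∧ e < ρ ∧ s ∈ halfTube e := by
    obtain ⟨h1, h2⟩ := hs
    have h3 : max (-s.re) |s.im| < ρ := max_lt (by linarith) h2
    obtain ⟨e, h4, h5⟩ := exists_between h3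
    exact ⟨e, (abs_nonneg _).trans_lt ((le_max_right _ _).trans_lt h4), h5,
      by linarith [(le_max_left (-s.re) |s.im|).trans_lt h4], (le_max_right _ _).trans_lt h4⟩
  set d := (ρ - e) / 2 with hd
  have hd0 : 0 < d := by linarith
  obtain ⟨X, hX, hbX⟩ := hb (e + d) (by linarith) (by linarith)
  have hopen := isOpen_halfTube e
  have hderiv : ∀ z ∈ halfTube ρ, ∀ t : ℝ, 0 ≤ t → HasDerivAt f (deriv f (z + t)) (z + t) := by
    intro z hz t ht
    exact (hf.differentiableAt ((isOpen_halfTube ρ).mem_nhds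
      (add_ofReal_mem_halfTube hz ht))).hasDerivAt
  have hdf : ContinuousOn (deriv f) (halfTube ρ) :=
    (hf.deriv (isOpen_halfTube ρ)).continuousOn
  have hcont : ∀ g : ℂ → ℂ, ContinuousOn g (halfTube ρ) → ∀ z ∈ halfTube ρ,
      AEStronglyMeasurable (fun t : ℝ => g (z + t)) (volume.restrict (Ioi 0)) := by
    intro g hg z hz
    refine ContinuousOn.aestronglyMeasurable ?_ measurableSet_Ioi
    refine hg.comp (by fun_prop) fun t ht => add_ofReal_mem_halfTube hz (mem_Ioi.1 ht).le
  have hsρ := halfTube_mono heρ.le hse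
  have h1s : 0 < 1 + s.re := by linarith [hse.1]
  have hballs : ∀ᶠ z in 𝓝 s, z ∈ halfTube e ∧ (1 + s.re) / 2 < 1 + z.re := by
    have h1 : ContinuousAt (fun z : ℂ => 1 + z.re) s := by fun_prop
    have h2 : ∀ᶠ z in 𝓝 s, z ∈ halfTube e := hopen.mem_nhds hse
    exact h2.and (h1.eventually_const_lt (by linarith))
  have key := hasDerivAt_integral_of_dominated_loc_of_deriv_le
    (μ := volume.restrict (Ioi (0 : ℝ))) (F := fun z t => f (z + t))
    (F' := fun z t => deriv f (z + t)) (x₀ := s)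
    (bound := fun t => 4 * X / d * (1 / ((1 + s.re) / 2 + t) ^ 2)) hballs ?_ ?_ ?_ ?_ ?_ ?_
  · have hint : ∫ t in Ioi (0 : ℝ), deriv f (s + t) = 0 - f (s + (0 : ℝ)) := by
      refine integral_Ioi_of_hasDerivAt_of_tendsto' (f := fun t : ℝ => f (s + t)) ?_ key.1 ?_
      · intro t ht
        have := (hderiv s hsρ t (mem_Ici.1 ht))
        have h2 : HasDerivAt (fun t : ℂ => f (s + t)) (deriv f (s + t)) (t : ℂ) :=
          HasDerivAt.comp_const_add s _ this
        exact h2.comp_ofReal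
      · have h0 : Tendsto (fun t : ℝ => X * (1 / (1 + s.re + t) ^ 2)) atTop (𝓝 0) := by
          have h1 := tendsto_neg_one_div_add (1 + s.re)
          have h2 := (h1.mul h1).const_mul X
          simp only [mul_zero] at h2
          refine h2.congr fun t => ?_
          rw [neg_mul_neg, one_div_mul_one_div, sq]
        refine squeeze_zero_norm' ?_ h0
        filter_upwards [eventually_ge_atTop 0] with t ht
        have := hbX (s + t) (add_ofReal_mem_halfTube (halfTube_mono (by linarith) hse) ht)
        simpa [add_assoc] using this
    have := key.2.neg
    rw [hint, zero_sub, neg_neg, ofReal_zero, add_zero] at this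
    exact this
  · filter_upwards [hballs] with z hz
    exact hcont f hf.continuousOn z (halfTube_mono heρ.le hz.1)
  · refine Integrable.mono' ((integrableOn_one_div_add_sq h1s).const_mul X)
      (hcont f hf.continuousOn s hsρ) ?_
    refine (ae_restrict_iff' measurableSet_Ioi).2 (Eventually.of_forall fun t ht => ?_)
    have := hbX (s + t) (add_ofReal_mem_halfTube (halfTube_mono (by linarith) hse) (mem_Ioi.1 ht).le)
    simpa [add_assoc] using this
  · exact hcont _ hdf s hsρ
  · refine (ae_restrict_iff' measurableSet_Ioi).2 (Eventually.of_forall fun t ht z hz => ?_)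
    have ht' := (mem_Ioi.1 ht)
    refine (deriv_weight_bound hρ hf hX hd0 (by linarith) hbX he0
      (add_ofReal_mem_halfTube hz.1 ht'.le)).trans ?_
    have : (z + (t : ℂ)).re = z.re + t := by simp
    rw [this]
    have := hz.2
    gcongr ?_ * (1 / ?_ ^ 2)
    linarith
  · exact (integrableOn_one_div_add_sq (by linarith)).const_mul _
  · refine (ae_restrict_iff' measurableSet_Ioi).2 (Eventually.of_forall fun t ht z hz => ?_)
    exact HasDerivAt.comp_add_const z (t : ℂ)
      (hderiv z (halfTube_mono heρ.le hz.1) t (mem_Ioi.1 ht).le)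

end Tail

/-- The coefficients `(p_j, q_j)` of the formal solution `∑ h^j (p_j, q_j)` of
`p' = G q`, `q' = (2 K / h) q + G p` normalised by `(1, 0)` at infinity. -/
noncomputable def wkbCoeff (K G : ℂ → ℂ) : ℕ → (ℂ → ℂ) × (ℂ → ℂ)
  | 0 => (fun _ => 1, fun _ => 0)
  | n + 1 =>
    (fun s => -∫ t in Ioi (0 : ℝ), G (s + t) * ((deriv (wkbCoeff K G n).2 (s + t)
        - G (s + t) * (wkbCoeff K G n).1 (s + t)) / (2 * K (s + t))),
      fun s => (deriv (wkbCoeff K G n).2 s - G s * (wkbCoeff K G n).1 s) / (2 * K s))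

/-- Hypotheses on the coefficients of the system `p' = G q`, `q' = (2 K / h) q + G p` on a
half-strip: `K` is bounded below, `G` decays quadratically, and `Re K ≥ 0` on the half-line. -/
structure WkbData (ρ c₀ C₀ : ℝ) (K G : ℂ → ℂ) : Prop where
  rho_pos : 0 < ρ
  rho_le : ρ ≤ 1 / 2
  c_pos : 0 < c₀
  C_nonneg : 0 ≤ C₀
  diffK : DifferentiableOn ℂ K (halfTube ρ)
  diffG : DifferentiableOn ℂ G (halfTube ρ)
  le_K : ∀ s ∈ halfTube ρ, c₀ ≤ ‖K s‖
  G_le : ∀ s ∈ halfTube ρ, ‖G s‖ ≤ C₀ * (1 / (1 + s.re) ^ 2)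
  re_K : ∀ s : ℝ, 0 ≤ s → 0 ≤ (K s).re

namespace WkbData

variable {ρ c₀ C₀ : ℝ} {K G : ℂ → ℂ}

theorem weight_le (hD : WkbData ρ c₀ C₀ K G) {s : ℂ} (hs : s ∈ halfTube ρ) :
    1 / (1 + s.re) ^ 2 ≤ 4 := by
  have h1 : 1 / 2 ≤ 1 + s.re := by linarith [hs.1, hD.rho_le]
  calc 1 / (1 + s.re) ^ 2 ≤ 1 / (1 / 2 : ℝ) ^ 2 := by gcongr
    _ = 4 := by norm_num

theorem K_ne (hD : WkbData ρ c₀ C₀ K G) {s : ℂ} (hs : s ∈ halfTube ρ) : K s ≠ 0 :=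
  norm_pos_iff.1 (hD.c_pos.trans_le (hD.le_K s hs))

theorem exists_factor (hD : WkbData ρ c₀ C₀ K G) : ∃ B : ℝ, 1 ≤ B ∧ 4 + C₀ ≤ B * (2 * c₀) ∧
    8 * C₀ * (4 + C₀) ≤ B * (2 * c₀) := by
  have hc := hD.c_pos
  have hC := hD.C_nonneg
  refine ⟨1 + (4 + C₀) / (2 * c₀) + 8 * C₀ * (4 + C₀) / (2 * c₀), ?_, ?_, ?_⟩
  · have : 0 ≤ (4 + C₀) / (2 * c₀) := by positivity
    have : 0 ≤ 8 * C₀ * (4 + C₀) / (2 * c₀) := by positivity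
    linarith
  · have : 0 ≤ 8 * C₀ * (4 + C₀) := by positivity
    field_simp
    nlinarith
  · field_simp
    nlinarith

variable {B : ℝ}

/-- Bounds on the `j`-th coefficient pair on shrinking half-strips. -/
def CoeffBound (ρ B : ℝ) (K G : ℂ → ℂ) (j : ℕ) : Prop :=
  DifferentiableOn ℂ (wkbCoeff K G j).1 (halfTube ρ) ∧
  DifferentiableOn ℂ (wkbCoeff K G j).2 (halfTube ρ) ∧
  ∀ d, 0 < d → j * d < ρ → ∀ s ∈ halfTube (ρ - j * d),
    ‖(wkbCoeff K G j).2 s‖ ≤ (B / d) ^ j * (1 / (1 + s.re) ^ 2) ∧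
    ‖(wkbCoeff K G j).1 s‖ ≤ (B / d) ^ j

theorem numerator_bound (hD : WkbData ρ c₀ C₀ K G) (hB : 1 ≤ B) {j : ℕ}
    (hj : CoeffBound ρ B K G j) {d : ℝ} (hd : 0 < d) (hjd : (j + 1) * d < ρ) {s : ℂ}
    (hs : s ∈ halfTube (ρ - (j + 1) * d)) :
    ‖deriv (wkbCoeff K G j).2 s - G s * (wkbCoeff K G j).1 s‖
      ≤ (4 + C₀) / d * (B / d) ^ j * (1 / (1 + s.re) ^ 2) := by
  obtain ⟨h1, h2, h3⟩ := hj
  have hjd' : j * d < ρ := by linarith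
  have e1 : ρ - (j + 1) * d + d = ρ - j * d := by ring
  have hjd0 : 0 ≤ j * d := by positivity
  have hd1 : d ≤ 1 := by linarith [hD.rho_le]
  have b1 := deriv_weight_bound hD.rho_le h2 (d := d) (e := ρ - (j + 1) * d) (X := (B / d) ^ j)
    (by positivity) hd (by linarith) (fun z hz => (h3 d hd hjd' z (e1 ▸ hz)).1) (by linarith) hs
  have hsρ : s ∈ halfTube ρ := halfTube_mono (by linarith) hs
  have b2 := (h3 d hd hjd' s (halfTube_mono (by linarith) hs)).2
  have b3 := hD.G_le s hsρ
  have hC := hD.C_nonneg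
  calc _ ≤ ‖deriv (wkbCoeff K G j).2 s‖ + ‖G s * (wkbCoeff K G j).1 s‖ := norm_sub_le _ _
    _ ≤ 4 * (B / d) ^ j / d * (1 / (1 + s.re) ^ 2)
        + C₀ * (1 / (1 + s.re) ^ 2) * (B / d) ^ j := by
        rw [norm_mul]; gcongr
    _ ≤ 4 * (B / d) ^ j / d * (1 / (1 + s.re) ^ 2)
        + C₀ * (1 / (1 + s.re) ^ 2) * (B / d) ^ j * (1 / d) := by
        refine add_le_add le_rfl
          (le_mul_of_one_le_right (by positivity) (by rw [le_div_iff₀ hd]; linarith))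
    _ = _ := by ring

theorem norm_coeff_snd_succ_le (hD : WkbData ρ c₀ C₀ K G) (hB : 1 ≤ B) {j : ℕ}
    (hj : CoeffBound ρ B K G j) {d : ℝ} (hd : 0 < d) (hjd : (j + 1) * d < ρ) {s : ℂ}
    (hs : s ∈ halfTube (ρ - (j + 1) * d)) :
    ‖(wkbCoeff K G (j + 1)).2 s‖ ≤ (4 + C₀) / (2 * c₀) / d * (B / d) ^ j * (1 / (1 + s.re) ^ 2) := by
  have hsρ : s ∈ halfTube ρ := halfTube_mono (by nlinarith) hs
  have hc := hD.c_pos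
  have hC := hD.C_nonneg
  have e := numerator_bound hD hB hj hd hjd hs
  have hK := hD.le_K s hsρ
  rw [wkbCoeff]
  simp only [norm_div, norm_mul, RCLike.norm_ofNat]
  calc _ ≤ ((4 + C₀) / d * (B / d) ^ j * (1 / (1 + s.re) ^ 2)) / (2 * c₀) := by
        gcongr
    _ = _ := by ring

theorem coeffBound (hD : WkbData ρ c₀ C₀ K G) (hB : 1 ≤ B) (hB1 : 4 + C₀ ≤ B * (2 * c₀))
    (hB2 : 8 * C₀ * (4 + C₀) ≤ B * (2 * c₀)) (j : ℕ) : CoeffBound ρ B K G j := by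
  have hc := hD.c_pos
  have hC := hD.C_nonneg
  induction j with
  | zero =>
    refine ⟨by simp only [wkbCoeff]; fun_prop, by simp only [wkbCoeff]; fun_prop,
      fun d hd _ s _ => ⟨?_, ?_⟩⟩
    · simp only [wkbCoeff, norm_zero, pow_zero]; positivity
    · simp [wkbCoeff]
  | succ j ih =>
    have hq : DifferentiableOn ℂ (wkbCoeff K G (j + 1)).2 (halfTube ρ) := by
      rw [wkbCoeff]
      refine DifferentiableOn.div ((ih.2.1.deriv (isOpen_halfTube ρ)).sub (hD.diffG.mul ih.1))
        (hD.diffK.const_mul 2) fun s hs => mul_ne_zero two_ne_zero (hD.K_ne hs)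
    have hGq : ∀ d, 0 < d → (j + 1) * d < ρ → ∀ s ∈ halfTube (ρ - (j + 1) * d),
        ‖G s * (wkbCoeff K G (j + 1)).2 s‖ ≤
          4 * C₀ * ((4 + C₀) / (2 * c₀) / d * (B / d) ^ j) * (1 / (1 + s.re) ^ 2) := by
      intro d hd hjd s hs
      have hsρ : s ∈ halfTube ρ := halfTube_mono (by nlinarith) hs
      rw [norm_mul]
      calc _ ≤ (C₀ * 4) * ((4 + C₀) / (2 * c₀) / d * (B / d) ^ j * (1 / (1 + s.re) ^ 2)) := by
            gcongr
            · exact (hD.G_le s hsρ).trans (by gcongr; exact hD.weight_le hsρ)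
            · exact norm_coeff_snd_succ_le hD hB ih hd hjd hs
        _ = _ := by ring
    refine ⟨?_, hq, fun d hd hjd s hs => ⟨?_, ?_⟩⟩
    · intro s hs
      refine (hasDerivAt_tailIntegral (f := fun s => G s * (wkbCoeff K G (j + 1)).2 s) hD.rho_le
        (hD.diffG.mul hq) (fun σ hσ0 hσ => ?_) hs).differentiableAt.differentiableWithinAt
      have hd : 0 < (ρ - σ) / (j + 1) := div_pos (by linarith) (by positivity)
      have e : (j + 1) * ((ρ - σ) / (j + 1)) = ρ - σ := by field_simp
      refine ⟨_, ?_, fun s hs => hGq _ hd (by rw [e]; linarith) s (by rw [e]; simpa using hs)⟩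
      positivity
    · push_cast at hjd hs
      refine (norm_coeff_snd_succ_le hD hB ih hd hjd hs).trans ?_
      rw [pow_succ (B / d), mul_comm ((B / d) ^ j)]
      gcongr
      rw [div_le_iff₀ (by positivity)]
      exact hB1
    · push_cast at hjd hs
      have h1 : 1 / 2 ≤ 1 + s.re := by nlinarith [hs.1, hD.rho_le]
      have := norm_tailIntegral_le (f := fun s => G s * (wkbCoeff K G (j + 1)).2 s) (s := s)
        (M := 4 * C₀ * ((4 + C₀) / (2 * c₀) / d * (B / d) ^ j)) (by linarith) (fun t ht => by
          have := hGq d hd hjd _ (add_ofReal_mem_halfTube hs ht.le)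
          simpa [add_assoc] using this)
      refine this.trans ?_
      calc _ ≤ 4 * C₀ * ((4 + C₀) / (2 * c₀) / d * (B / d) ^ j) / (1 / 2) := by gcongr
        _ = (8 * C₀ * (4 + C₀)) / (2 * c₀) / d * (B / d) ^ j := by ring
        _ ≤ B / d * (B / d) ^ j := by
          gcongr
          rw [div_le_iff₀ (by positivity)]
          exact hB2
        _ = _ := by ring

theorem hasDerivAt_coeff_fst (hD : WkbData ρ c₀ C₀ K G) (hB : 1 ≤ B) (hB1 : 4 + C₀ ≤ B * (2 * c₀))
    (hB2 : 8 * C₀ * (4 + C₀) ≤ B * (2 * c₀)) (j : ℕ) {s : ℂ} (hs : s ∈ halfTube ρ) :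
    HasDerivAt (wkbCoeff K G j).1 (G s * (wkbCoeff K G j).2 s) s := by
  cases j with
  | zero => simpa [wkbCoeff] using hasDerivAt_const s (1 : ℂ)
  | succ j =>
    have hc := hD.c_pos
    have hC := hD.C_nonneg
    have ih := coeffBound hD hB hB1 hB2 j
    refine hasDerivAt_tailIntegral (f := fun s => G s * (wkbCoeff K G (j + 1)).2 s) hD.rho_le
        (hD.diffG.mul (coeffBound hD hB hB1 hB2 (j + 1)).2.1) (fun σ hσ0 hσ => ?_) hs
    have hd : 0 < (ρ - σ) / (j + 1) := div_pos (by linarith) (by positivity)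
    have e : (j + 1) * ((ρ - σ) / (j + 1)) = ρ - σ := by field_simp
    refine ⟨(C₀ * 4) * ((4 + C₀) / (2 * c₀) / ((ρ - σ) / (j + 1)) * (B / ((ρ - σ) / (j + 1))) ^ j),
      by positivity, fun s hs => ?_⟩
    have hsρ : s ∈ halfTube ρ := halfTube_mono hσ.le hs
    rw [norm_mul, mul_assoc]
    gcongr
    · exact (hD.G_le s hsρ).trans (by gcongr; exact hD.weight_le hsρ)
    · exact norm_coeff_snd_succ_le hD hB ih hd (by rw [e]; linarith) (by rw [e]; simpa using hs)

theorem hasDerivAt_coeff_snd (hD : WkbData ρ c₀ C₀ K G) (hB : 1 ≤ B) (hB1 : 4 + C₀ ≤ B * (2 * c₀))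
    (hB2 : 8 * C₀ * (4 + C₀) ≤ B * (2 * c₀)) (j : ℕ) {s : ℂ} (hs : s ∈ halfTube ρ) :
    HasDerivAt (wkbCoeff K G j).2
      (G s * (wkbCoeff K G j).1 s + 2 * K s * (wkbCoeff K G (j + 1)).2 s) s := by
  have h := ((coeffBound hD hB hB1 hB2 j).2.1.differentiableAt
    ((isOpen_halfTube ρ).mem_nhds hs)).hasDerivAt
  have e : G s * (wkbCoeff K G j).1 s + 2 * K s * (wkbCoeff K G (j + 1)).2 s
      = deriv (wkbCoeff K G j).2 s := by
    have := hD.K_ne hs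
    rw [wkbCoeff]
    field_simp
    ring
  rwa [e]

end WkbData

theorem neg_norm_mul_le_inner (a b : ℂ) : -(‖a‖ * ‖b‖) ≤ inner ℝ a b :=
  (abs_le.1 (abs_real_inner_le_norm a b)).1

/-- Backward energy estimate for `p' = G q`, `q' = κ q + G p - r` with `Re κ ≥ 0`, for solutions
vanishing at infinity. -/
theorem norm_le_of_vanishing_atTop {p q κ G r : ℝ → ℂ} {C₀ ε : ℝ} (hε : 0 ≤ ε) (hC : 0 ≤ C₀)
    (hp : ∀ s, 0 ≤ s → HasDerivAt p (G s * q s) s)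
    (hq : ∀ s, 0 ≤ s → HasDerivAt q (κ s * q s + G s * p s - r s) s)
    (hκ : ∀ s, 0 ≤ s → 0 ≤ (κ s).re)
    (hG : ∀ s, 0 ≤ s → ‖G s‖ ≤ C₀ * (1 / (1 + s) ^ 2))
    (hr : ∀ s, 0 ≤ s → ‖r s‖ ≤ ε * (1 / (1 + s) ^ 2))
    (hp0 : Tendsto p atTop (𝓝 0)) (hq0 : Tendsto q atTop (𝓝 0)) :
    ‖p 0‖ ≤ ε * Real.exp (2 * C₀ + 1) ∧ ‖q 0‖ ≤ ε * Real.exp (2 * C₀ + 1) := by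
  set C := 2 * C₀ + 1 with hCdef
  set F : ℝ → ℝ := fun s => (‖p s‖ ^ 2 + ‖q s‖ ^ 2 + ε ^ 2) * Real.exp (C * -(1 / (1 + s))) with hF
  have hder : ∀ s, 0 ≤ s → HasDerivAt F
      ((2 * inner ℝ (p s) (G s * q s) + 2 * inner ℝ (q s) (κ s * q s + G s * p s - r s)) *
        Real.exp (C * -(1 / (1 + s))) + (‖p s‖ ^ 2 + ‖q s‖ ^ 2 + ε ^ 2) *
        (Real.exp (C * -(1 / (1 + s))) * (C * (1 / (1 + s) ^ 2)))) s := by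
    intro s hs
    exact (((hp s hs).norm_sq.add (hq s hs).norm_sq).add_const _).mul
      ((hasDerivAt_neg_one_div_add (by linarith)).const_mul C).exp
  have hmono : MonotoneOn F (Ici 0) := by
    refine monotoneOn_of_deriv_nonneg (convex_Ici 0)
      (fun s hs => (hder s hs).continuousAt.continuousWithinAt) ?_ ?_
    · intro s hs
      rw [interior_Ici] at hs
      exact (hder s (mem_Ioi.1 hs).le).differentiableAt.differentiableWithinAt
    · intro s hs
      rw [interior_Ici] at hs
      have hs := (mem_Ioi.1 hs).le
      rw [(hder s hs).deriv]
      set W := 1 / (1 + s) ^ 2 with hW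
      have hW0 : 0 ≤ W := by positivity
      have h1 := neg_norm_mul_le_inner (p s) (G s * q s)
      have h2 := neg_norm_mul_le_inner (q s) (G s * p s)
      have h3 := (abs_le.1 (abs_real_inner_le_norm (q s) (r s))).2
      have h4 : inner ℝ (q s) (κ s * q s) = (κ s).re * ‖q s‖ ^ 2 := by
        rw [Complex.inner, ← Complex.normSq_eq_norm_sq, Complex.normSq_apply]
        simp
        ring
      have h4' : 0 ≤ (κ s).re * ‖q s‖ ^ 2 := mul_nonneg (hκ s hs) (by positivity)
      rw [norm_mul] at h1 h2
      have h5 : ‖p s‖ * (‖G s‖ * ‖q s‖) ≤ ‖p s‖ * ((C₀ * W) * ‖q s‖) := by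
        gcongr; exact hG s hs
      have h6 : ‖q s‖ * (‖G s‖ * ‖p s‖) ≤ ‖q s‖ * ((C₀ * W) * ‖p s‖) := by
        gcongr; exact hG s hs
      have h7 : ‖q s‖ * ‖r s‖ ≤ ‖q s‖ * (ε * W) := by
        gcongr; exact hr s hs
      rw [inner_sub_right, inner_add_right, h4]
      have h8 : 0 ≤ (2 * inner ℝ (p s) (G s * q s) + 2 * ((κ s).re * ‖q s‖ ^ 2
          + inner ℝ (q s) (G s * p s) - inner ℝ (q s) (r s)))
          + (‖p s‖ ^ 2 + ‖q s‖ ^ 2 + ε ^ 2) * (C * W) := by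
        have e1 : 0 ≤ C₀ * W * (‖p s‖ - ‖q s‖) ^ 2 := by positivity
        have e2 : 0 ≤ W * (ε - ‖q s‖) ^ 2 := by positivity
        have e3 : 0 ≤ W * ‖p s‖ ^ 2 := by positivity
        have e4 : 0 ≤ C₀ * W * ε ^ 2 := by positivity
        rw [hCdef]
        nlinarith
      calc 0 ≤ ((2 * inner ℝ (p s) (G s * q s) + 2 * ((κ s).re * ‖q s‖ ^ 2
          + inner ℝ (q s) (G s * p s) - inner ℝ (q s) (r s)))
          + (‖p s‖ ^ 2 + ‖q s‖ ^ 2 + ε ^ 2) * (C * W)) * Real.exp (C * -(1 / (1 + s))) := by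
            positivity
        _ = _ := by ring
  have hlim : Tendsto F atTop (𝓝 (ε ^ 2)) := by
    have h1 := ((hp0.norm.pow 2).add (hq0.norm.pow 2)).add_const (ε ^ 2)
    have h2 := (Real.continuous_exp.tendsto _).comp ((tendsto_neg_one_div_add 1).const_mul C)
    simpa [F] using h1.mul h2
  have hle : F 0 ≤ ε ^ 2 := by
    refine ge_of_tendsto hlim ?_
    filter_upwards [eventually_ge_atTop 0] with s hs
    exact hmono (mem_Ici.2 le_rfl) hs hs
  have hexp : Real.exp (C * -(1 / (1 + 0))) = (Real.exp C)⁻¹ := by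
    rw [← Real.exp_neg]; congr 1; ring
  have h1 : ‖p 0‖ ^ 2 + ‖q 0‖ ^ 2 + ε ^ 2 ≤ ε ^ 2 * Real.exp C := by
    rw [hF] at hle
    beta_reduce at hle
    rw [hexp, ← div_eq_mul_inv, div_le_iff₀ (Real.exp_pos _)] at hle
    exact hle
  have hC1 : 1 ≤ Real.exp C := Real.one_le_exp (by positivity)
  have h2 : ε ^ 2 * Real.exp C ≤ (ε * Real.exp C) ^ 2 := by
    rw [mul_pow]; gcongr; nlinarith
  constructor
  · exact abs_le_of_sq_le_sq' (by nlinarith [sq_nonneg ‖q 0‖, sq_nonneg ε]) (by positivity) |>.2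
  · exact abs_le_of_sq_le_sq' (by nlinarith [sq_nonneg ‖p 0‖, sq_nonneg ε]) (by positivity) |>.2

namespace WkbData

variable {ρ c₀ C₀ : ℝ} {K G : ℂ → ℂ} {B : ℝ}

theorem tendsto_coeff_fst (hD : WkbData ρ c₀ C₀ K G) (hB : 1 ≤ B) (hB1 : 4 + C₀ ≤ B * (2 * c₀))
    (hB2 : 8 * C₀ * (4 + C₀) ≤ B * (2 * c₀)) (j : ℕ) :
    Tendsto (fun s : ℝ => (wkbCoeff K G (j + 1)).1 s) atTop (𝓝 0) := by
  have hρ := hD.rho_pos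
  have hc := hD.c_pos
  have hC := hD.C_nonneg
  have hd : 0 < ρ / (2 * (j + 1)) := by positivity
  have e : (j + 1) * (ρ / (2 * (j + 1))) = ρ / 2 := by field_simp
  set X := (4 + C₀) / (2 * c₀) / (ρ / (2 * (j + 1))) * (B / (ρ / (2 * (j + 1)))) ^ j
  have hlim : Tendsto (fun s : ℝ => -((C₀ * 4 * X) * -(1 / (1 + s)))) atTop (𝓝 0) := by
    simpa using ((tendsto_neg_one_div_add 1).const_mul (C₀ * 4 * X)).neg
  refine squeeze_zero_norm' ?_ hlim
  filter_upwards [eventually_ge_atTop 0] with s hs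
  rw [wkbCoeff]
  refine (norm_tailIntegral_le (f := fun s => G s * (wkbCoeff K G (j + 1)).2 s) (s := (s : ℂ))
    (M := C₀ * 4 * X) (by simp; linarith) fun t ht => ?_).trans (by simp [div_eq_mul_inv])
  have hst : (s : ℂ) + t ∈ halfTube (ρ / 2) :=
    add_ofReal_mem_halfTube (ofReal_mem_halfTube (by positivity) hs) ht.le
  have hsρ := halfTube_mono (by linarith : ρ / 2 ≤ ρ) hst
  rw [norm_mul, mul_assoc (C₀ * 4)]
  gcongr
  · exact (hD.G_le _ hsρ).trans (by gcongr; exact hD.weight_le hsρ)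
  · have := norm_coeff_snd_succ_le hD hB (coeffBound hD hB hB1 hB2 j) hd (by rw [e]; linarith)
      (s := (s : ℂ) + t) (by rw [e]; convert hst using 2; ring)
    simpa [add_assoc] using this

theorem tendsto_coeff_snd (hD : WkbData ρ c₀ C₀ K G) (hB : 1 ≤ B) (hB1 : 4 + C₀ ≤ B * (2 * c₀))
    (hB2 : 8 * C₀ * (4 + C₀) ≤ B * (2 * c₀)) (j : ℕ) :
    Tendsto (fun s : ℝ => (wkbCoeff K G j).2 s) atTop (𝓝 0) := by
  have hρ := hD.rho_pos
  have hd : 0 < ρ / (2 * (j + 1)) := by positivity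
  have e : j * (ρ / (2 * (j + 1))) ≤ ρ / 2 := by
    rw [mul_div, div_le_div_iff₀ (by positivity) (by positivity)]
    nlinarith
  have hlim : Tendsto (fun s : ℝ => (B / (ρ / (2 * (j + 1)))) ^ j *
      (-(1 / (1 + s)) * -(1 / (1 + s)))) atTop (𝓝 0) := by
    simpa using ((tendsto_neg_one_div_add 1).mul (tendsto_neg_one_div_add 1)).const_mul
      ((B / (ρ / (2 * (j + 1)))) ^ j)
  refine squeeze_zero_norm' ?_ hlim
  filter_upwards [eventually_ge_atTop 0] with s hs
  refine (((coeffBound hD hB hB1 hB2 j).2.2 _ hd (by linarith) s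
    (ofReal_mem_halfTube (by linarith) hs)).1).trans (le_of_eq ?_)
  simp [sq]

/-- The error after `N + 1` terms of the formal expansion. -/
theorem error_bound (hD : WkbData ρ c₀ C₀ K G) (hB : 1 ≤ B) (hB1 : 4 + C₀ ≤ B * (2 * c₀))
    (hB2 : 8 * C₀ * (4 + C₀) ≤ B * (2 * c₀)) {h : ℝ} (hh : 0 < h) {p q : ℝ → ℂ}
    (hp : ∀ s : ℝ, 0 ≤ s → HasDerivAt p (G s * q s) s)
    (hq : ∀ s : ℝ, 0 ≤ s → HasDerivAt q (2 * K s / h * q s + G s * p s) s)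
    (hp1 : Tendsto p atTop (𝓝 1)) (hq1 : Tendsto q atTop (𝓝 0)) (N : ℕ) {d : ℝ} (hd : 0 < d)
    (hNd : (N + 1) * d < ρ) :
    ‖p 0 - ∑ j ∈ Finset.range (N + 1), (wkbCoeff K G j).1 0 * (h : ℂ) ^ j‖
      ≤ h ^ N * ((4 + C₀) / d * (B / d) ^ N) * Real.exp (2 * C₀ + 1) ∧
    ‖q 0 - ∑ j ∈ Finset.range (N + 1), (wkbCoeff K G j).2 0 * (h : ℂ) ^ j‖
      ≤ h ^ N * ((4 + C₀) / d * (B / d) ^ N) * Real.exp (2 * C₀ + 1) := by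
  have hρ := hD.rho_pos
  have hC := hD.C_nonneg
  have hne : (h : ℂ) ≠ 0 := by exact_mod_cast hh.ne'
  have hmem : ∀ s : ℝ, 0 ≤ s → (s : ℂ) ∈ halfTube ρ := fun s hs => ofReal_mem_halfTube hρ hs
  have key := norm_le_of_vanishing_atTop (C₀ := C₀) (ε := h ^ N * ((4 + C₀) / d * (B / d) ^ N))
    (p := fun s => p s - ∑ j ∈ Finset.range (N + 1), (wkbCoeff K G j).1 s * (h : ℂ) ^ j)
    (q := fun s => q s - ∑ j ∈ Finset.range (N + 1), (wkbCoeff K G j).2 s * (h : ℂ) ^ j)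
    (κ := fun s => 2 * K s / h) (G := fun s => G s)
    (r := fun s => h ^ N * (deriv (wkbCoeff K G N).2 s - G s * (wkbCoeff K G N).1 s))
    (by positivity) hC ?_ ?_ ?_ ?_ ?_ ?_ ?_
  · simpa using key
  · intro s hs
    have h1 := (hp s hs).sub (HasDerivAt.fun_sum (u := Finset.range (N + 1)) fun j _ =>
      ((hasDerivAt_coeff_fst hD hB hB1 hB2 j (hmem s hs)).comp_ofReal.mul_const ((h : ℂ) ^ j)))
    refine h1.congr_deriv ?_
    rw [mul_sub, Finset.mul_sum]
    congr 1
    exact Finset.sum_congr rfl fun j _ => by ring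
  · intro s hs
    have h1 := (hq s hs).sub (HasDerivAt.fun_sum (u := Finset.range (N + 1)) fun j _ =>
      ((hasDerivAt_coeff_snd hD hB hB1 hB2 j (hmem s hs)).comp_ofReal.mul_const ((h : ℂ) ^ j)))
    refine h1.congr_deriv ?_
    have hK := hD.K_ne (hmem s hs)
    have e0 : (h : ℂ) ^ N * (deriv (wkbCoeff K G N).2 s - G s * (wkbCoeff K G N).1 s)
        = h ^ N * (2 * K s * (wkbCoeff K G (N + 1)).2 s) := by
      rw [wkbCoeff]; field_simp
    have e1 : ∑ j ∈ Finset.range (N + 1), (wkbCoeff K G j).2 s * (h : ℂ) ^ j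
        = h * ∑ j ∈ Finset.range (N + 1), (wkbCoeff K G (j + 1)).2 s * (h : ℂ) ^ j
          - h * ((wkbCoeff K G (N + 1)).2 s * (h : ℂ) ^ N) := by
      rw [Finset.sum_range_succ', Finset.sum_range_succ _ N, mul_add, add_sub_cancel_right,
        Finset.mul_sum]
      have : (wkbCoeff K G 0).2 s = 0 := rfl
      rw [this, zero_mul, add_zero]
      exact Finset.sum_congr rfl fun j _ => by ring
    have e2 : ∑ j ∈ Finset.range (N + 1), (G s * (wkbCoeff K G j).1 s
        + 2 * K s * (wkbCoeff K G (j + 1)).2 s) * (h : ℂ) ^ j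
        = G s * ∑ j ∈ Finset.range (N + 1), (wkbCoeff K G j).1 s * (h : ℂ) ^ j
          + 2 * K s * ∑ j ∈ Finset.range (N + 1), (wkbCoeff K G (j + 1)).2 s * (h : ℂ) ^ j := by
      rw [Finset.mul_sum, Finset.mul_sum, ← Finset.sum_add_distrib]
      exact Finset.sum_congr rfl fun j _ => by ring
    rw [e0, e2, e1]
    field_simp
    ring
  · intro s hs
    rw [mul_div_assoc, ← ofReal_ofNat, re_ofReal_mul, div_ofReal_re]
    have := hD.re_K s hs
    positivity
  · intro s hs
    simpa using hD.G_le s (hmem s hs)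
  · intro s hs
    have := numerator_bound hD hB (coeffBound hD hB hB1 hB2 N) hd hNd (s := s)
      (ofReal_mem_halfTube (by linarith) hs)
    rw [norm_mul, norm_pow, Complex.norm_of_nonneg hh.le, mul_assoc]
    gcongr
    simpa using this
  · have h1 : Tendsto (fun s : ℝ => p s - ∑ j ∈ Finset.range (N + 1),
        (wkbCoeff K G j).1 s * (h : ℂ) ^ j) atTop
        (𝓝 (1 - ∑ j ∈ Finset.range (N + 1), (if j = 0 then 1 else 0) * (h : ℂ) ^ j)) := by
      refine hp1.sub (tendsto_finsetSum _ fun j _ => Tendsto.mul_const _ ?_)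
      cases j with
      | zero => exact tendsto_const_nhds
      | succ j => simpa using tendsto_coeff_fst hD hB hB1 hB2 j
    simpa using h1
  · have h1 : Tendsto (fun s : ℝ => q s - ∑ j ∈ Finset.range (N + 1),
        (wkbCoeff K G j).2 s * (h : ℂ) ^ j) atTop
        (𝓝 (0 - ∑ j ∈ Finset.range (N + 1), 0 * (h : ℂ) ^ j)) :=
      hq1.sub (tendsto_finsetSum _ fun j _ =>
        Tendsto.mul_const _ (tendsto_coeff_snd hD hB hB1 hB2 j))
    simpa using h1

theorem exists_gevrey (hD : WkbData ρ c₀ C₀ K G) :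
    ∃ a b : ℕ → ℂ, a 0 = 1 ∧ b 0 = 0 ∧ ∀ p q : ℝ → ℝ → ℂ,
      (∀ h : ℝ, 0 < h → h < 1 →
        (∀ s : ℝ, 0 ≤ s → HasDerivAt (p h) (G s * q h s) s) ∧
        (∀ s : ℝ, 0 ≤ s → HasDerivAt (q h) (2 * K s / h * q h s + G s * p h s) s) ∧
        Tendsto (p h) atTop (𝓝 1) ∧ Tendsto (q h) atTop (𝓝 0)) →
      HasGevreyExpansion 1 (fun h => p h 0) a ∧ HasGevreyExpansion 1 (fun h => q h 0) b := by
  obtain ⟨B, hB, hB1, hB2⟩ := hD.exists_factor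
  have hρ := hD.rho_pos
  have hρ1 : ρ ≤ 1 := by linarith [hD.rho_le]
  have hC := hD.C_nonneg
  refine ⟨fun j => (wkbCoeff K G j).1 0, fun j => (wkbCoeff K G j).2 0, rfl, rfl, fun p q H => ?_⟩
  set M := (4 + C₀) * Real.exp (2 * C₀ + 1) + 1 with hM
  have hM1 : 1 ≤ M := by rw [hM]; have : 0 ≤ (4 + C₀) * Real.exp (2 * C₀ + 1) := by positivity
                         linarith
  set L := 2 * B * Real.exp 2 * M / ρ with hL
  have hL1 : 1 ≤ L := by
    rw [hL, le_div_iff₀ hρ, one_mul]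
    have h1 : 1 ≤ Real.exp 2 := Real.one_le_exp (by norm_num)
    have h2 : 1 ≤ 2 * B := by linarith
    exact hρ1.trans (one_le_mul_of_one_le_of_one_le (one_le_mul_of_one_le_of_one_le h2 h1) hM1)
  have hfac : ∀ N : ℕ, M * (((N : ℝ) + 2) / ρ) ^ (N + 1) * B ^ N ≤ L ^ (N + 1) * N.factorial := by
    intro N
    have h1 : ((N : ℝ) + 2) ^ (N + 1) ≤ Real.exp 2 ^ (N + 1) * (2 ^ N * N.factorial) := by
      have h2 := Real.pow_div_factorial_le_exp ((N : ℝ) + 2) (by positivity) (N + 1)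
      rw [div_le_iff₀ (by positivity)] at h2
      have h3 : Real.exp ((N : ℝ) + 2) ≤ Real.exp 2 ^ (N + 1) := by
        rw [← Real.exp_nat_mul]
        gcongr
        push_cast
        have : (0 : ℝ) ≤ N := by positivity
        linarith
      have h4 : ((N + 1).factorial : ℝ) ≤ 2 ^ N * N.factorial := by
        rw [Nat.factorial_succ]
        push_cast
        gcongr
        exact_mod_cast Nat.succ_le_of_lt Nat.lt_two_pow_self
      exact h2.trans (mul_le_mul h3 h4 (by positivity) (by positivity))
    calc M * (((N : ℝ) + 2) / ρ) ^ (N + 1) * B ^ N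
        = M * B ^ N / ρ ^ (N + 1) * ((N : ℝ) + 2) ^ (N + 1) := by rw [div_pow]; ring
      _ ≤ M ^ (N + 1) * B ^ (N + 1) / ρ ^ (N + 1) *
          (Real.exp 2 ^ (N + 1) * (2 ^ (N + 1) * N.factorial)) := by
          have e1 : M ≤ M ^ (N + 1) := le_self_pow₀ hM1 (by omega)
          have e2 : B ^ N ≤ B ^ (N + 1) := pow_le_pow_right₀ hB (by omega)
          have e3 : (2 : ℝ) ^ N ≤ 2 ^ (N + 1) := pow_le_pow_right₀ (by norm_num) (by omega)
          refine mul_le_mul (by gcongr) (h1.trans (by gcongr)) (by positivity) (by positivity)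
      _ = L ^ (N + 1) * N.factorial := by rw [hL]; simp only [div_pow, mul_pow]; ring
  have hmain : ∀ (x : ℂ) (h : ℝ) (a : ℕ → ℂ) (N : ℕ), 0 < h →
      ‖x - ∑ j ∈ Finset.range (N + 1), a j * (h : ℂ) ^ j‖
        ≤ h ^ N * ((4 + C₀) / (ρ / (N + 2)) * (B / (ρ / (N + 2))) ^ N) * Real.exp (2 * C₀ + 1) →
      ‖a N‖ ≤ (B / (ρ / (N + 2))) ^ N →
      ‖x - ∑ j ∈ Finset.range N, a j * (h : ℂ) ^ j‖ ≤ L ^ (N + 1) * N.factorial * h ^ N := by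
    intro x h a N hh h1 h2
    have e1 : x - ∑ j ∈ Finset.range N, a j * (h : ℂ) ^ j
        = (x - ∑ j ∈ Finset.range (N + 1), a j * (h : ℂ) ^ j) + a N * (h : ℂ) ^ N := by
      rw [Finset.sum_range_succ]; ring
    have h3 : ‖a N * (h : ℂ) ^ N‖ ≤ (B / (ρ / (N + 2))) ^ N * (((N : ℝ) + 2) / ρ) * h ^ N := by
      rw [norm_mul, norm_pow, Complex.norm_of_nonneg hh.le]
      gcongr
      refine h2.trans (le_mul_of_one_le_right (by positivity) ?_)
      rw [le_div_iff₀ hρ]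
      have : (0 : ℝ) ≤ N := by positivity
      linarith
    rw [e1]
    refine (norm_add_le _ _).trans ((add_le_add h1 h3).trans ?_)
    calc _ = M * (((N : ℝ) + 2) / ρ) ^ (N + 1) * B ^ N * h ^ N := by
          rw [hM]; simp only [div_eq_mul_inv, mul_inv, inv_inv, mul_pow]; ring
      _ ≤ _ := mul_le_mul_of_nonneg_right (hfac N) (by positivity)
  have hd : ∀ N : ℕ, 0 < ρ / (N + 2) := fun N => by positivity
  have hNd : ∀ N : ℕ, (N + 1) * (ρ / (N + 2)) < ρ := by
    intro N
    rw [mul_div, div_lt_iff₀ (by positivity)]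
    nlinarith
  have hb : ∀ N : ℕ, ‖(wkbCoeff K G N).2 0‖ ≤ (B / (ρ / (N + 2))) ^ N ∧
      ‖(wkbCoeff K G N).1 0‖ ≤ (B / (ρ / (N + 2))) ^ N := by
    intro N
    have h1 : N * (ρ / (N + 2)) < ρ := by
      have := hNd N; have := hd N; linarith
    have := (coeffBound hD hB hB1 hB2 N).2.2 _ (hd N) h1 ((0 : ℝ) : ℂ)
      (ofReal_mem_halfTube (by linarith) le_rfl)
    simpa using this
  constructor
  · refine HasGevreyExpansion.of_bound hL1 fun h hh hh1 N => ?_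
    obtain ⟨H1, H2, H3, H4⟩ := H h hh hh1
    exact hmain _ h (fun j => (wkbCoeff K G j).1 0) N hh
      (error_bound hD hB hB1 hB2 hh H1 H2 H3 H4 N (hd N) (hNd N)).1 (hb N).2
  · refine HasGevreyExpansion.of_bound hL1 fun h hh hh1 N => ?_
    obtain ⟨H1, H2, H3, H4⟩ := H h hh hh1
    exact hmain _ h (fun j => (wkbCoeff K G j).2 0) N hh
      (error_bound hD hB hB1 hB2 hh H1 H2 H3 H4 N (hd N) (hNd N)).2 (hb N).1

end WkbData

/-- The primitive of `f` vanishing at `b`, obtained by integrating along segments from `b`. -/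
noncomputable def segmentPrimitive (b : ℂ) (f : ℂ → ℂ) (z : ℂ) : ℂ :=
  ∫ t in (0 : ℝ)..1, (z - b) * f (b + t * (z - b))

theorem StarConvex.add_ofReal_mul_sub_mem {U : Set ℂ} {b z : ℂ} (hs : StarConvex ℝ b U)
    (hz : z ∈ U) {t : ℝ} (h0 : 0 ≤ t) (h1 : t ≤ 1) : b + t * (z - b) ∈ U := by
  have := hs.add_smul_sub_mem hz h0 h1
  rwa [real_smul] at this

section Primitive

variable {U : Set ℂ} {b : ℂ} {f : ℂ → ℂ}

theorem hasDerivAt_segmentPrimitive (hU : IsOpen U) (hs : StarConvex ℝ b U)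
    (hf : DifferentiableOn ℂ f U) {z : ℂ} (hz : z ∈ U) :
    HasDerivAt (segmentPrimitive b f) (f z) z := by
  obtain ⟨r, hr, hball⟩ := Metric.isOpen_iff.1 hU z hz
  have hcl : Metric.closedBall z (r / 2) ⊆ U :=
    (Metric.closedBall_subset_ball (by linarith)).trans hball
  have hmem : ∀ w ∈ Metric.closedBall z (r / 2), ∀ t ∈ Icc (0 : ℝ) 1, b + t * (w - b) ∈ U :=
    fun w hw t ht => hs.add_ofReal_mul_sub_mem (hcl hw) ht.1 ht.2
  have hzc : z ∈ Metric.closedBall z (r / 2) := Metric.mem_closedBall_self (by linarith)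
  have hder : ∀ w ∈ Metric.closedBall z (r / 2), ∀ t ∈ Icc (0 : ℝ) 1,
      HasDerivAt (fun w => (w - b) * f (b + t * (w - b)))
        (f (b + t * (w - b)) + (w - b) * (deriv f (b + t * (w - b)) * t)) w := by
    intro w hw t ht
    have h1 : HasDerivAt (fun w => w - b) 1 w := (hasDerivAt_id w).sub_const b
    have h2 : HasDerivAt (fun w => b + t * (w - b)) (t : ℂ) w := by
      simpa using (h1.const_mul (t : ℂ)).const_add b
    have h3 : HasDerivAt (fun w => f (b + t * (w - b))) (deriv f (b + t * (w - b)) * t) w :=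
      ((hf.differentiableAt (hU.mem_nhds (hmem w hw t ht))).hasDerivAt).comp w h2
    exact (h1.fun_mul h3).congr_deriv (by rw [one_mul])
  have hdf : ContinuousOn (deriv f) U := (hf.deriv hU).continuousOn
  have hcomp : ∀ g : ℂ → ℂ, ContinuousOn g U →
      ContinuousOn (fun p : ℂ × ℝ => g (b + p.2 * (p.1 - b)))
        (Metric.closedBall z (r / 2) ×ˢ Icc (0 : ℝ) 1) := by
    intro g hg
    have h1 : Continuous fun p : ℂ × ℝ => b + p.2 * (p.1 - b) := by fun_prop
    have h2 : MapsTo (fun p : ℂ × ℝ => b + p.2 * (p.1 - b))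
        (Metric.closedBall z (r / 2) ×ˢ Icc (0 : ℝ) 1) U := fun p hp => hmem p.1 hp.1 p.2 hp.2
    exact ContinuousOn.comp (f := fun p : ℂ × ℝ => b + p.2 * (p.1 - b)) hg h1.continuousOn h2
  have hF' : ContinuousOn (fun p : ℂ × ℝ => f (b + p.2 * (p.1 - b)) + (p.1 - b) *
      (deriv f (b + p.2 * (p.1 - b)) * p.2)) (Metric.closedBall z (r / 2) ×ˢ Icc (0 : ℝ) 1) := by
    have h1 := hcomp f hf.continuousOn
    have h2 := hcomp _ hdf
    have h3 : Continuous fun p : ℂ × ℝ => p.1 - b := by fun_prop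
    have h4 : Continuous fun p : ℂ × ℝ => (p.2 : ℂ) := by fun_prop
    exact h1.add (h3.continuousOn.mul (h2.mul h4.continuousOn))
  obtain ⟨C, hC⟩ := ((isCompact_closedBall z (r / 2)).prod isCompact_Icc).exists_bound_of_continuousOn
    hF'
  have hslice : ∀ w ∈ Metric.closedBall z (r / 2),
      MapsTo (fun t : ℝ => (w, t)) (Icc 0 1) (Metric.closedBall z (r / 2) ×ˢ Icc (0 : ℝ) 1) :=
    fun w hw t ht => ⟨hw, ht⟩
  have hFc : ∀ w ∈ Metric.closedBall z (r / 2),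
      ContinuousOn (fun t : ℝ => (w - b) * f (b + t * (w - b))) (Icc 0 1) := by
    intro w hw
    have h1 : Continuous fun t : ℝ => (w, t) := by fun_prop
    have h2 : ContinuousOn (fun t : ℝ => f (b + t * (w - b))) (Icc 0 1) :=
      ContinuousOn.comp (g := fun p : ℂ × ℝ => f (b + p.2 * (p.1 - b))) (f := fun t : ℝ => (w, t))
        (hcomp f hf.continuousOn) h1.continuousOn (hslice w hw)
    exact continuousOn_const.mul h2
  have hF'c : ContinuousOn (fun t : ℝ => f (b + t * (z - b)) + (z - b) *
      (deriv f (b + t * (z - b)) * t)) (Icc 0 1) := by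
    have h1 : Continuous fun t : ℝ => (z, t) := by fun_prop
    exact ContinuousOn.comp (g := fun p : ℂ × ℝ => f (b + p.2 * (p.1 - b)) + (p.1 - b) *
      (deriv f (b + p.2 * (p.1 - b)) * p.2)) (f := fun t : ℝ => (z, t)) hF' h1.continuousOn
      (hslice z hzc)
  have hIoc : uIoc (0 : ℝ) 1 ⊆ Icc 0 1 := by
    rw [uIoc_of_le zero_le_one]; exact Ioc_subset_Icc_self
  have hnhds := Metric.closedBall_mem_nhds z (by linarith : 0 < r / 2)
  have hmeas : ∀ w ∈ Metric.closedBall z (r / 2), AEStronglyMeasurable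
      (fun t : ℝ => (w - b) * f (b + t * (w - b))) (volume.restrict (uIoc (0 : ℝ) 1)) :=
    fun w hw => ((hFc w hw).mono hIoc).aestronglyMeasurable measurableSet_uIoc
  have hbd : ∀ᵐ t : ℝ ∂volume, t ∈ uIoc (0 : ℝ) 1 → ∀ w ∈ Metric.closedBall z (r / 2),
      ‖f (b + t * (w - b)) + (w - b) * (deriv f (b + t * (w - b)) * t)‖ ≤ C :=
    Eventually.of_forall fun t ht w hw => hC (w, t) ⟨hw, hIoc ht⟩
  have hdiff : ∀ᵐ t : ℝ ∂volume, t ∈ uIoc (0 : ℝ) 1 → ∀ w ∈ Metric.closedBall z (r / 2),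
      HasDerivAt (fun w => (w - b) * f (b + t * (w - b)))
        (f (b + t * (w - b)) + (w - b) * (deriv f (b + t * (w - b)) * t)) w :=
    Eventually.of_forall fun t ht w hw => hder w hw t (hIoc ht)
  have hint : IntervalIntegrable (fun t : ℝ => (z - b) * f (b + t * (z - b))) volume 0 1 :=
    (hFc z hzc).intervalIntegrable_of_Icc zero_le_one
  have hmeas' := (hF'c.mono hIoc).aestronglyMeasurable (μ := volume) measurableSet_uIoc
  have hconst : IntervalIntegrable (fun _ : ℝ => C) volume 0 1 := intervalIntegrable_const
  have key := intervalIntegral.hasDerivAt_integral_of_dominated_loc_of_deriv_le hnhds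
    (eventually_of_mem hnhds hmeas) hint hmeas' hbd hconst hdiff
  have e : ∫ t in (0 : ℝ)..1, (f (b + t * (z - b)) + (z - b) * (deriv f (b + t * (z - b)) * t))
      = f z := by
    have h1 : ∀ t ∈ uIcc (0 : ℝ) 1, HasDerivAt (fun t : ℝ => (t : ℂ) * f (b + t * (z - b)))
        (f (b + t * (z - b)) + (z - b) * (deriv f (b + t * (z - b)) * t)) t := by
      intro t ht
      rw [uIcc_of_le zero_le_one] at ht
      have h2 : HasDerivAt (fun s : ℂ => b + s * (z - b)) (z - b) (t : ℂ) := by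
        simpa using ((hasDerivAt_id (t : ℂ)).mul_const (z - b)).const_add b
      have h3 : HasDerivAt (fun s : ℂ => f (b + s * (z - b)))
          (deriv f (b + t * (z - b)) * (z - b)) t :=
        ((hf.differentiableAt (hU.mem_nhds (hmem z hzc t ht))).hasDerivAt).comp (t : ℂ) h2
      have h4 : HasDerivAt (fun s : ℂ => s * f (b + s * (z - b)))
          (1 * f (b + t * (z - b)) + t * (deriv f (b + t * (z - b)) * (z - b))) t :=
        (hasDerivAt_id' (t : ℂ)).fun_mul h3
      exact h4.comp_ofReal.congr_deriv (by ring)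
    rw [intervalIntegral.integral_eq_sub_of_hasDerivAt h1 key.1]
    simp
  have := key.2
  rw [e] at this
  exact this

end Primitive

/-- The horizontal strip `{|Im z| < η}`. -/
def strip (η : ℝ) : Set ℂ := {z : ℂ | |z.im| < η}

theorem isOpen_strip (η : ℝ) : IsOpen (strip η) :=
  isOpen_lt (continuous_abs.comp continuous_im) continuous_const

theorem convex_strip (η : ℝ) : Convex ℝ (strip η) := by
  have : strip η = imLm ⁻¹' (Metric.ball 0 η) := by
    ext z; simp [strip]
  rw [this]
  exact (convex_ball 0 η).linear_preimage _

theorem ofReal_mem_strip {η : ℝ} (hη : 0 < η) (x : ℝ) : (x : ℂ) ∈ strip η := by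
  simpa [strip] using hη

/-- Picard iterates for the system `u' = a v`, `v' = b u`. -/
noncomputable def picard (a b : ℂ → ℂ) (A B : ℂ) : ℕ → (ℂ → ℂ) × (ℂ → ℂ)
  | 0 => (fun _ => A, fun _ => B)
  | n + 1 => (segmentPrimitive 0 fun z => a z * (picard a b A B n).2 z,
      segmentPrimitive 0 fun z => b z * (picard a b A B n).1 z)

section Picard

variable {η M : ℝ} {a b : ℂ → ℂ}

theorem norm_segmentPrimitive_zero_le (hη : 0 < η) (ha : ∀ z ∈ strip η, ‖a z‖ ≤ M) {f : ℂ → ℂ}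
    {X : ℝ} {n : ℕ} (hM : 0 ≤ M)
    (hf : ∀ z ∈ strip η, ‖f z‖ ≤ X * (M * ‖z‖) ^ n / n.factorial) {z : ℂ} (hz : z ∈ strip η) :
    ‖segmentPrimitive 0 (fun z => a z * f z) z‖
      ≤ X * (M * ‖z‖) ^ (n + 1) / (n + 1).factorial := by
  have h0 : (0 : ℂ) ∈ strip η := by simpa using ofReal_mem_strip hη 0
  have hst := (convex_strip η).starConvex h0
  have hi : IntervalIntegrable (fun t : ℝ => X * (M * ‖z‖) ^ (n + 1) / n.factorial * t ^ n) volume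
      0 1 := (by fun_prop : Continuous _).intervalIntegrable _ _
  have hb : ∀ᵐ t, t ∈ Ioc (0 : ℝ) 1 → ‖(z - 0) * (a (0 + t * (z - 0)) * f (0 + t * (z - 0)))‖
      ≤ X * (M * ‖z‖) ^ (n + 1) / n.factorial * t ^ n := by
    refine Eventually.of_forall fun t ht => ?_
    have hm := hst.add_ofReal_mul_sub_mem hz ht.1.le ht.2
    have h1 := ha _ hm
    have h2 := hf _ hm
    rw [norm_mul, norm_mul]
    calc _ ≤ ‖z - 0‖ * (M * (X * (M * ‖0 + t * (z - 0)‖) ^ n / n.factorial)) := by gcongr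
      _ = _ := by
        rw [sub_zero, zero_add, norm_mul, Complex.norm_of_nonneg ht.1.le]
        ring
  refine (intervalIntegral.norm_integral_le_of_norm_le zero_le_one hb hi).trans (le_of_eq ?_)
  rw [intervalIntegral.integral_const_mul, integral_pow, Nat.factorial_succ]
  push_cast
  simp
  field_simp

theorem picard_bound (hη : 0 < η) (hM : 0 ≤ M) (ha : ∀ z ∈ strip η, ‖a z‖ ≤ M)
    (hb : ∀ z ∈ strip η, ‖b z‖ ≤ M) (A B : ℂ) (n : ℕ) : ∀ z ∈ strip η,
    ‖(picard a b A B n).1 z‖ ≤ (‖A‖ + ‖B‖) * (M * ‖z‖) ^ n / n.factorial ∧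
    ‖(picard a b A B n).2 z‖ ≤ (‖A‖ + ‖B‖) * (M * ‖z‖) ^ n / n.factorial := by
  induction n with
  | zero => intro z _; simp [picard]
  | succ n ih =>
    intro z hz
    exact ⟨norm_segmentPrimitive_zero_le hη ha hM (fun z hz => (ih z hz).2) hz,
      norm_segmentPrimitive_zero_le hη hb hM (fun z hz => (ih z hz).1) hz⟩

theorem picard_hasDerivAt (hη : 0 < η) (ha : DifferentiableOn ℂ a (strip η))
    (hb : DifferentiableOn ℂ b (strip η)) (A B : ℂ) (n : ℕ) :
    (DifferentiableOn ℂ (picard a b A B n).1 (strip η) ∧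
      DifferentiableOn ℂ (picard a b A B n).2 (strip η)) ∧ ∀ z ∈ strip η,
    HasDerivAt (picard a b A B (n + 1)).1 (a z * (picard a b A B n).2 z) z ∧
    HasDerivAt (picard a b A B (n + 1)).2 (b z * (picard a b A B n).1 z) z := by
  have h0 : (0 : ℂ) ∈ strip η := by simpa using ofReal_mem_strip hη 0
  have hst := (convex_strip η).starConvex h0
  have hd : ∀ n, DifferentiableOn ℂ (picard a b A B n).1 (strip η) →
      DifferentiableOn ℂ (picard a b A B n).2 (strip η) → ∀ z ∈ strip η,
      HasDerivAt (picard a b A B (n + 1)).1 (a z * (picard a b A B n).2 z) z ∧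
      HasDerivAt (picard a b A B (n + 1)).2 (b z * (picard a b A B n).1 z) z :=
    fun n h1 h2 z hz => ⟨hasDerivAt_segmentPrimitive (isOpen_strip η) hst (ha.mul h2) hz,
      hasDerivAt_segmentPrimitive (isOpen_strip η) hst (hb.mul h1) hz⟩
  have h : DifferentiableOn ℂ (picard a b A B n).1 (strip η) ∧
      DifferentiableOn ℂ (picard a b A B n).2 (strip η) := by
    induction n with
    | zero => simp only [picard]; exact ⟨by fun_prop, by fun_prop⟩
    | succ n ih =>
      have := hd n ih.1 ih.2
      exact ⟨fun z hz => (this z hz).1.differentiableAt.differentiableWithinAt,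
        fun z hz => (this z hz).2.differentiableAt.differentiableWithinAt⟩
  exact ⟨h, hd n h.1 h.2⟩

theorem exists_holomorphic_solution (hη : 0 < η) (ha : DifferentiableOn ℂ a (strip η))
    (hb : DifferentiableOn ℂ b (strip η)) (haM : ∀ z ∈ strip η, ‖a z‖ ≤ M)
    (hbM : ∀ z ∈ strip η, ‖b z‖ ≤ M) (A B : ℂ) :
    ∃ U W : ℂ → ℂ, U 0 = A ∧ W 0 = B ∧ ∀ z ∈ strip η,
      HasDerivAt U (a z * W z) z ∧ HasDerivAt W (b z * U z) z := by
  have h0 : (0 : ℂ) ∈ strip η := by simpa using ofReal_mem_strip hη 0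
  have hM : 0 ≤ M := (norm_nonneg _).trans (haM 0 h0)
  have hbd := picard_bound hη hM haM hbM A B
  have hsum : ∀ R : ℝ, Summable fun n : ℕ => (‖A‖ + ‖B‖) * (M * R) ^ n / n.factorial := by
    intro R
    simp_rw [mul_div_assoc]
    exact (Real.summable_pow_div_factorial _).mul_left _
  have hS1 : ∀ z ∈ strip η, Summable fun n => (picard a b A B n).1 z := fun z hz =>
    Summable.of_norm_bounded (hsum ‖z‖) fun n => (hbd n z hz).1
  have hS2 : ∀ z ∈ strip η, Summable fun n => (picard a b A B n).2 z := fun z hz =>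
    Summable.of_norm_bounded (hsum ‖z‖) fun n => (hbd n z hz).2
  have hT1 : ∀ z ∈ strip η, Summable fun n => (picard a b A B (n + 1)).1 z := fun z hz =>
    (hS1 z hz).comp_injective (add_left_injective 1)
  have hT2 : ∀ z ∈ strip η, Summable fun n => (picard a b A B (n + 1)).2 z := fun z hz =>
    (hS2 z hz).comp_injective (add_left_injective 1)
  have hz1 : ∀ n, (picard a b A B (n + 1)).1 0 = 0 ∧ (picard a b A B (n + 1)).2 0 = 0 := by
    intro n; constructor <;> simp [picard, segmentPrimitive]
  refine ⟨fun z => ∑' n, (picard a b A B n).1 z, fun z => ∑' n, (picard a b A B n).2 z, ?_, ?_, ?_⟩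
  · exact tsum_eq_single 0 fun n hn => by
      obtain ⟨m, rfl⟩ := Nat.exists_eq_succ_of_ne_zero hn
      exact (hz1 m).1
  · exact tsum_eq_single 0 fun n hn => by
      obtain ⟨m, rfl⟩ := Nat.exists_eq_succ_of_ne_zero hn
      exact (hz1 m).2
  · intro z hz
    set R := ‖z‖ + 1 with hR
    have hopen : IsOpen (strip η ∩ Metric.ball 0 R) := (isOpen_strip η).inter Metric.isOpen_ball
    have hconn : IsPreconnected (strip η ∩ Metric.ball (0 : ℂ) R) :=
      ((convex_strip η).inter (convex_ball 0 R)).isPreconnected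
    have hzm : z ∈ strip η ∩ Metric.ball 0 R := ⟨hz, by simp [hR]⟩
    have hle : ∀ n, ∀ y ∈ strip η ∩ Metric.ball (0 : ℂ) R,
        (‖A‖ + ‖B‖) * (M * ‖y‖) ^ n / n.factorial ≤ (‖A‖ + ‖B‖) * (M * R) ^ n / n.factorial := by
      intro n y hy
      have := (mem_ball_zero_iff.1 hy.2).le
      gcongr
    have hs := (hsum R).mul_left M
    have hd := picard_hasDerivAt hη ha hb A B
    constructor
    · have key := hasDerivAt_tsum_of_isPreconnected (𝕜 := ℂ) hs hopen hconn
        (g := fun n => (picard a b A B (n + 1)).1) (fun n y hy => ((hd n).2 y hy.1).1)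
        (fun n y hy => by
          rw [norm_mul]
          exact mul_le_mul (haM y hy.1) (((hbd n y hy.1).2).trans (hle n y hy)) (norm_nonneg _) hM)
        hzm (hT1 z hz) hzm
      rw [tsum_mul_left] at key
      refine (key.const_add A).congr_of_eventuallyEq ?_
      filter_upwards [(isOpen_strip η).mem_nhds hz] with y hy
      rw [(hS1 y hy).tsum_eq_zero_add]
      rfl
    · have key := hasDerivAt_tsum_of_isPreconnected (𝕜 := ℂ) hs hopen hconn
        (g := fun n => (picard a b A B (n + 1)).2) (fun n y hy => ((hd n).2 y hy.1).2)
        (fun n y hy => by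
          rw [norm_mul]
          exact mul_le_mul (hbM y hy.1) (((hbd n y hy.1).1).trans (hle n y hy)) (norm_nonneg _) hM)
        hzm (hT2 z hz) hzm
      rw [tsum_mul_left] at key
      refine (key.const_add B).congr_of_eventuallyEq ?_
      filter_upwards [(isOpen_strip η).mem_nhds hz] with y hy
      rw [(hS2 y hy).tsum_eq_zero_add]
      rfl

theorem linear_system_unique {a b : ℝ → ℂ} {M : ℝ} (ha : ∀ x, ‖a x‖ ≤ M) (hb : ∀ x, ‖b x‖ ≤ M)
    {u v u' v' : ℝ → ℂ} (hu : ∀ x, HasDerivAt u (a x * v x) x) (hv : ∀ x, HasDerivAt v (b x * u x) x)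
    (hu' : ∀ x, HasDerivAt u' (a x * v' x) x) (hv' : ∀ x, HasDerivAt v' (b x * u' x) x)
    (h1 : u 0 = u' 0) (h2 : v 0 = v' 0) : u = u' ∧ v = v' := by
  have hM : 0 ≤ M := (norm_nonneg _).trans (ha 0)
  have hlip : ∀ t, LipschitzOnWith M.toNNReal (fun p : ℂ × ℂ => (a t * p.2, b t * p.1)) univ := by
    intro t
    refine LipschitzOnWith.of_dist_le_mul fun p _ q _ => ?_
    rw [Real.coe_toNNReal M hM, Prod.dist_eq, Prod.dist_eq]
    refine max_le ?_ ?_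
    · rw [dist_eq_norm, ← mul_sub, norm_mul, ← dist_eq_norm]
      exact mul_le_mul (ha t) (le_max_right _ _) dist_nonneg hM
    · rw [dist_eq_norm, ← mul_sub, norm_mul, ← dist_eq_norm]
      exact mul_le_mul (hb t) (le_max_left _ _) dist_nonneg hM
  have hf : ∀ t, HasDerivAt (fun x => (u x, v x)) (a t * v t, b t * u t) t :=
    fun t => (hu t).prodMk (hv t)
  have hg : ∀ t, HasDerivAt (fun x => (u' x, v' x)) (a t * v' t, b t * u' t) t :=
    fun t => (hu' t).prodMk (hv' t)
  have key : (fun x => (u x, v x)) = fun x => (u' x, v' x) :=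
    ODE_solution_unique_univ (v := fun t (p : ℂ × ℂ) => (a t * p.2, b t * p.1))
      (s := fun _ => univ) (t₀ := 0) hlip (fun t => ⟨hf t, mem_univ _⟩)
      (fun t => ⟨hg t, mem_univ _⟩) (Prod.ext h1 h2)
  exact ⟨funext fun x => congrArg Prod.fst (congrFun key x),
    funext fun x => congrArg Prod.snd (congrFun key x)⟩

theorem exists_holomorphic_extension (hη : 0 < η) (ha : DifferentiableOn ℂ a (strip η))
    (hb : DifferentiableOn ℂ b (strip η)) (haM : ∀ z ∈ strip η, ‖a z‖ ≤ M)
    (hbM : ∀ z ∈ strip η, ‖b z‖ ≤ M) {u v : ℝ → ℂ}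
    (hu : ∀ x : ℝ, HasDerivAt u (a x * v x) x) (hv : ∀ x : ℝ, HasDerivAt v (b x * u x) x) :
    ∃ U W : ℂ → ℂ, (∀ x : ℝ, U x = u x ∧ W x = v x) ∧ ∀ z ∈ strip η,
      HasDerivAt U (a z * W z) z ∧ HasDerivAt W (b z * U z) z := by
  obtain ⟨U, W, hU, hW, H⟩ := exists_holomorphic_solution hη ha hb haM hbM (u 0) (v 0)
  have hr := fun x => ofReal_mem_strip hη x
  have := linear_system_unique (a := fun x : ℝ => a x) (b := fun x : ℝ => b x)
    (fun x => haM _ (hr x)) (fun x => hbM _ (hr x))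
    (u := fun x : ℝ => U x) (v := fun x : ℝ => W x) (fun x => (H x (hr x)).1.comp_ofReal)
    (fun x => (H x (hr x)).2.comp_ofReal) hu hv (by simpa using hU) (by simpa using hW)
  exact ⟨U, W, fun x => ⟨congrFun this.1 x, congrFun this.2 x⟩, H⟩

end Picard

theorem exists_pos_le_of_tendsto {f : ℝ → ℝ} {a L : ℝ} (hf : ContinuousOn f (Ici a))
    (hpos : ∀ x, a ≤ x → 0 < f x) (hL : 0 < L) (h : Tendsto f atTop (𝓝 L)) :
    ∃ c > 0, ∀ x, a ≤ x → c ≤ f x := by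
  obtain ⟨R, hR⟩ := eventually_atTop.1 (h.eventually (lt_mem_nhds (half_lt_self hL)))
  obtain ⟨y, hy, hmin⟩ := (isCompact_Icc (a := a) (b := max a R)).exists_isMinOn
    ⟨a, le_rfl, le_max_left _ _⟩ (hf.mono Icc_subset_Ici_self)
  refine ⟨min (f y) (L / 2), lt_min (hpos y hy.1) (half_pos hL), fun x hx => ?_⟩
  rcases le_total x (max a R) with h1 | h1
  · exact (min_le_left _ _).trans (hmin ⟨hx, h1⟩)
  · exact (min_le_right _ _).trans (hR x ((le_max_right _ _).trans h1)).le

theorem deriv_decay_of_sector {V : ℂ → ℂ} {ε η δ C R : ℝ} {W : ℂ} (hε : 0 < ε)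
    (hδ : 1 < δ) (hV : AnalyticOnNhd ℂ V (Sector ε η)) {s : ℝ} (hs : s = 1 ∨ s = -1)
    (hb : ∀ x ∈ Sector ε η, R ≤ s * x.re → ‖V x - W‖ ≤ C * (1 + ‖x‖ ^ 2) ^ (-(δ / 2))) :
    ∃ R₁ C₁ : ℝ, ∀ z : ℂ, |z.im| < η → R₁ ≤ s * z.re →
      ‖V z‖ ≤ C₁ ∧ ‖deriv V z‖ ≤ C₁ / (1 + |z.re|) ^ 2 := by
  set ρ := min ε 1 / 4 with hρ
  have hρ0 : 0 < ρ := by positivity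
  have hρε : 4 * ρ ≤ ε := by rw [hρ]; linarith [min_le_left ε 1]
  have hρ1 : 4 * ρ ≤ 1 := by rw [hρ]; linarith [min_le_right ε 1]
  have habs : ∀ y : ℝ, s * y ≤ |y| := by
    intro y
    rcases hs with rfl | rfl
    · simpa using le_abs_self y
    · simpa using neg_le_abs y
  refine ⟨max (2 * |R|) 1, ‖W‖ + 2 * |C| + 8 * |C| / ρ, fun z hz hzR => ?_⟩
  set X := s * z.re with hX
  have hX1 : 1 ≤ X := (le_max_right _ _).trans hzR
  have hXR : 2 * |R| ≤ X := (le_max_left _ _).trans hzR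
  have hXabs : |z.re| = X := by
    have : |X| = |z.re| := by
      rw [hX, abs_mul]; rcases hs with rfl | rfl <;> simp
    rw [← this, abs_of_pos (by linarith)]
  have hball : ∀ w ∈ Metric.closedBall z (ρ * X), w ∈ Sector ε η ∧ X / 2 ≤ s * w.re := by
    intro w hw
    rw [Metric.mem_closedBall, dist_eq_norm] at hw
    have h1 := (abs_re_le_norm (w - z)).trans hw
    have h2 := (abs_im_le_norm (w - z)).trans hw
    rw [sub_re] at h1
    rw [sub_im] at h2
    have h3 : X - ρ * X ≤ s * w.re := by
      have := habs (z.re - w.re)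
      rw [abs_sub_comm] at this
      have e : s * (z.re - w.re) = X - s * w.re := by rw [hX]; ring
      linarith
    have h4 : |w.im| ≤ |z.im| + ρ * X := by
      have := abs_sub_abs_le_abs_sub w.im z.im
      linarith
    have h5 : ρ * X ≤ X / 4 := by nlinarith
    have h6 := habs w.re
    refine ⟨?_, by linarith⟩
    show |w.im| < ε * |w.re| + η
    have h7 : ε * (X / 2) ≤ ε * |w.re| := by gcongr; linarith
    nlinarith
  have hdec : ∀ w ∈ Metric.closedBall z (ρ * X), ‖V w - W‖ ≤ 2 * |C| / X := by
    intro w hw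
    obtain ⟨h1, h2⟩ := hball w hw
    have h3 := hb w h1 (by linarith [le_abs_self R])
    have h4 : X / 2 ≤ ‖w‖ := h2.trans ((habs _).trans (abs_re_le_norm w))
    have h5 : (1 + ‖w‖ ^ 2) ^ (-(δ / 2)) ≤ 2 / X := by
      calc (1 + ‖w‖ ^ 2) ^ (-(δ / 2)) ≤ (1 + ‖w‖ ^ 2) ^ (-(1 / 2 : ℝ)) :=
            Real.rpow_le_rpow_of_exponent_le (by nlinarith [norm_nonneg w]) (by linarith)
        _ = (Real.sqrt (1 + ‖w‖ ^ 2))⁻¹ := by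
            rw [Real.rpow_neg (by positivity), Real.sqrt_eq_rpow]
        _ ≤ (X / 2)⁻¹ := by
            apply inv_anti₀ (by linarith)
            exact Real.le_sqrt_of_sq_le (by nlinarith [norm_nonneg w])
        _ = 2 / X := by rw [inv_div]
    calc ‖V w - W‖ ≤ C * (1 + ‖w‖ ^ 2) ^ (-(δ / 2)) := h3
      _ ≤ |C| * (2 / X) := mul_le_mul (le_abs_self C) h5 (by positivity) (abs_nonneg C)
      _ = 2 * |C| / X := by ring
  have hρX : 0 < ρ * X := by positivity
  have hC0 := abs_nonneg C
  constructor
  · have h1 := hdec z (Metric.mem_closedBall_self hρX.le)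
    have h2 : 2 * |C| / X ≤ 2 * |C| := div_le_self (by positivity) hX1
    have h3 : ‖V z‖ ≤ ‖W‖ + ‖V z - W‖ := by
      simpa using norm_add_le W (V z - W)
    have h4 : 0 ≤ 8 * |C| / ρ := by positivity
    linarith
  · have hd : DiffContOnCl ℂ (fun w => V w - W) (Metric.ball z (ρ * X)) := by
      apply DifferentiableOn.diffContOnCl
      rw [closure_ball z hρX.ne']
      exact (fun w hw => ((hV w (hball w hw).1).differentiableAt.sub_const W).differentiableWithinAt)
    have h1 := norm_deriv_le_of_forall_mem_sphere_norm_le hρX hd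
      (fun w hw => hdec w (Metric.sphere_subset_closedBall hw))
    rw [deriv_sub_const] at h1
    rw [hXabs]
    refine h1.trans ?_
    have h2 : 2 * |C| / X / (ρ * X) ≤ 8 * |C| / ρ / (1 + X) ^ 2 := by
      rw [div_div, div_div, div_le_div_iff₀ (by positivity) (by positivity)]
      have : (1 + X) ^ 2 ≤ 4 * X ^ 2 := by nlinarith
      have := mul_le_mul_of_nonneg_left this (by positivity : 0 ≤ 2 * |C| * ρ)
      nlinarith
    refine h2.trans ?_
    gcongr
    linarith [norm_nonneg W]

namespace AssumptionA

variable {V : ℂ → ℂ} {Vm Vp : ℝ}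

theorem exists_strip_bounds (hA : AssumptionA V Vm Vp) : ∃ η > 0, ∃ C : ℝ, 0 ≤ C ∧
    DifferentiableOn ℂ V (strip η) ∧
    ∀ z ∈ strip η, ‖V z‖ ≤ C ∧ ‖deriv V z‖ ≤ C / (1 + |z.re|) ^ 2 := by
  obtain ⟨ε, hε, η, hη, δ, hδ, hV, ⟨C₁, R₁, h1⟩, C₂, R₂, h2⟩ := hA.sector
  obtain ⟨R₃, C₃, h3⟩ := deriv_decay_of_sector hε hδ hV (s := 1) (Or.inl rfl) (R := R₁)
    (C := C₁) (W := Vp) (fun x hx hx' => h1 x hx (by linarith))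
  obtain ⟨R₄, C₄, h4⟩ := deriv_decay_of_sector hε hδ hV (s := -1) (Or.inr rfl) (R := R₂)
    (C := C₂) (W := Vm) (fun x hx hx' => h2 x hx (by linarith))
  have hsub : ∀ z : ℂ, |z.im| < η → z ∈ Sector ε η := fun z hz => by
    show |z.im| < ε * |z.re| + η
    have := mul_nonneg hε.le (abs_nonneg z.re)
    linarith
  set R := max (max R₃ R₄) 0
  have hK : IsCompact (Icc (-R) R ×ℂ Icc (-(η / 2)) (η / 2)) := isCompact_Icc.reProdIm isCompact_Icc
  have hKs : ∀ z ∈ Icc (-R) R ×ℂ Icc (-(η / 2)) (η / 2), z ∈ Sector ε η := by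
    intro z hz
    have := abs_le.2 ((mem_reProdIm.1 hz).2)
    exact hsub z (by linarith)
  obtain ⟨C₅, h5⟩ := hK.exists_bound_of_continuousOn (f := V)
    (fun z hz => (hV z (hKs z hz)).continuousAt.continuousWithinAt)
  obtain ⟨C₆, h6⟩ := hK.exists_bound_of_continuousOn (f := deriv V)
    (fun z hz => (hV z (hKs z hz)).deriv.continuousAt.continuousWithinAt)
  set C := max (max |C₃| |C₄|) (max |C₅| (|C₆| * (1 + R) ^ 2))
  have hC3 : C₃ ≤ C := (le_abs_self _).trans ((le_max_left _ _).trans (le_max_left _ _))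
  have hC4 : C₄ ≤ C := (le_abs_self _).trans ((le_max_right _ _).trans (le_max_left _ _))
  have hC5 : C₅ ≤ C := (le_abs_self _).trans ((le_max_left _ _).trans (le_max_right _ _))
  have hC6 : |C₆| * (1 + R) ^ 2 ≤ C := (le_max_right _ _).trans (le_max_right _ _)
  refine ⟨η / 2, half_pos hη, C, (abs_nonneg _).trans ((le_max_left _ _).trans (le_max_left _ _)),
    fun z hz => (hV z (hsub z ?_)).differentiableAt.differentiableWithinAt, fun z hz => ?_⟩
  · have : |z.im| < η / 2 := hz
    linarith
  have hz' : |z.im| < η / 2 := hz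
  have hzη : |z.im| < η := by linarith
  by_cases hR : |z.re| ≤ R
  · have hzK : z ∈ Icc (-R) R ×ℂ Icc (-(η / 2)) (η / 2) :=
      mem_reProdIm.2 ⟨abs_le.1 hR, abs_le.1 hz'.le⟩
    refine ⟨(h5 z hzK).trans hC5, ?_⟩
    rw [le_div_iff₀ (by positivity)]
    calc _ ≤ |C₆| * (1 + R) ^ 2 := by
          gcongr
          exact (h6 z hzK).trans (le_abs_self _)
      _ ≤ C := hC6
  · push Not at hR
    have hR3 : R₃ ≤ R := (le_max_left _ _).trans (le_max_left _ _)
    have hR4 : R₄ ≤ R := (le_max_right _ _).trans (le_max_left _ _)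
    rcases lt_abs.1 hR with h | h
    · obtain ⟨h7, h8⟩ := h3 z hzη (by linarith)
      exact ⟨h7.trans hC3, h8.trans (by gcongr)⟩
    · obtain ⟨h7, h8⟩ := h4 z hzη (by linarith)
      exact ⟨h7.trans hC4, h8.trans (by gcongr)⟩

theorem exists_tail_bound (hA : AssumptionA V Vm Vp) : ∃ δ > (1 : ℝ), ∃ C R : ℝ, 0 < R ∧
    ∀ x : ℝ, R ≤ x → ‖V x - Vp‖ ≤ C * x ^ (-δ) ∧ ‖V ((-x : ℝ) : ℂ) - Vm‖ ≤ C * x ^ (-δ) := by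
  obtain ⟨ε, hε, η, hη, δ, hδ, -, ⟨C₁, R₁, h1⟩, C₂, R₂, h2⟩ := hA.sector
  have hsub : ∀ x : ℝ, (x : ℂ) ∈ Sector ε η := fun x => by
    show |(x : ℂ).im| < ε * |(x : ℂ).re| + η
    rw [ofReal_im, abs_zero]
    positivity
  refine ⟨δ, hδ, max |C₁| |C₂|, max 1 (max R₁ R₂), by positivity, fun x hx => ?_⟩
  have hx1 : 1 ≤ x := (le_max_left _ _).trans hx
  have hw : (1 + x ^ 2) ^ (-(δ / 2)) ≤ x ^ (-δ) := by
    calc (1 + x ^ 2) ^ (-(δ / 2)) ≤ (x ^ 2) ^ (-(δ / 2)) :=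
          Real.rpow_le_rpow_of_nonpos (by positivity) (by linarith) (by linarith)
      _ = x ^ (-δ) := by
          rw [← Real.rpow_natCast, ← Real.rpow_mul (by linarith)]
          congr 1; push_cast; ring
  constructor
  · have := h1 x (hsub x) (by
      rw [ofReal_re]; exact ((le_max_left _ _).trans (le_max_right _ _)).trans hx)
    rw [norm_real, Real.norm_eq_abs, sq_abs] at this
    exact this.trans (mul_le_mul ((le_abs_self _).trans (le_max_left _ _)) hw (by positivity)
      ((abs_nonneg _).trans (le_max_left _ _)))
  · have := h2 ((-x : ℝ) : ℂ) (hsub _) (by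
      rw [ofReal_re]; linarith [((le_max_right _ _).trans (le_max_right _ _)).trans hx])
    rw [norm_real, Real.norm_eq_abs, sq_abs, neg_sq] at this
    exact this.trans (mul_le_mul ((le_abs_self _).trans (le_max_right _ _)) hw (by positivity)
      ((abs_nonneg _).trans (le_max_left _ _)))

theorem tendsto_atTop (hA : AssumptionA V Vm Vp) :
    Tendsto (fun x : ℝ => (V x).re) atTop (𝓝 Vp) ∧
    Tendsto (fun x : ℝ => (V ((-x : ℝ) : ℂ)).re) atTop (𝓝 Vm) := by
  obtain ⟨δ, hδ, C, R, hR, h⟩ := hA.exists_tail_bound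
  have h0 : Tendsto (fun x : ℝ => C * x ^ (-δ)) atTop (𝓝 0) := by
    simpa using (tendsto_rpow_neg_atTop (by linarith : 0 < δ)).const_mul C
  constructor
  · have : Tendsto (fun x : ℝ => V x) atTop (𝓝 (Vp : ℂ)) := by
      rw [tendsto_iff_norm_sub_tendsto_zero]
      exact squeeze_zero' (Eventually.of_forall fun _ => norm_nonneg _)
        ((eventually_ge_atTop R).mono fun x hx => (h x hx).1) h0
    exact (continuous_re.tendsto (Vp : ℂ)).comp this
  · have : Tendsto (fun x : ℝ => V ((-x : ℝ) : ℂ)) atTop (𝓝 (Vm : ℂ)) := by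
      rw [tendsto_iff_norm_sub_tendsto_zero]
      exact squeeze_zero' (Eventually.of_forall fun _ => norm_nonneg _)
        ((eventually_ge_atTop R).mono fun x hx => (h x hx).2) h0
    exact (continuous_re.tendsto (Vm : ℂ)).comp this

end AssumptionA

/-- Two functions on a strip, real on the real axis, with derivatives decaying quadratically;
`f₁` has a simple zero at `t₁` as its only zero, `f₂` takes values in a sector around the positive
half-line, and so does the quotient `f₁ z / (z - t₁)`. -/
structure TurningPoint (η t₁ : ℝ) (f₁ f₂ : ℂ → ℂ) : Prop where
  eta_pos : 0 < η
  diff₁ : DifferentiableOn ℂ f₁ (strip η)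
  diff₂ : DifferentiableOn ℂ f₂ (strip η)
  real₁ : ∀ x : ℝ, (f₁ x).im = 0
  real₂ : ∀ x : ℝ, (f₂ x).im = 0
  zero : f₁ t₁ = 0
  sector₁ : ∀ z ∈ strip η, |(dslope f₁ t₁ z).im| < (dslope f₁ t₁ z).re
  sector₂ : ∀ z ∈ strip η, |(f₂ z).im| < (f₂ z).re
  bound : ∃ C > 0, ∀ z ∈ strip η, ‖f₁ z‖ ≤ C ∧ ‖f₂ z‖ ≤ C ∧
    ‖deriv f₁ z‖ ≤ C / (1 + |z.re|) ^ 2 ∧ ‖deriv f₂ z‖ ≤ C / (1 + |z.re|) ^ 2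
  lower₂ : ∃ c > 0, ∀ z ∈ strip η, c ≤ ‖f₂ z‖
  lower₁ : ∀ r > 0, ∃ c > 0, ∀ z ∈ strip η, r ≤ ‖z - t₁‖ → c ≤ ‖f₁ z‖

theorem strip_mono {η η' : ℝ} (h : η ≤ η') : strip η ⊆ strip η' :=
  fun _ hz => lt_of_lt_of_le hz h

theorem norm_sub_re_le {η C : ℝ} {f : ℂ → ℂ} (hη : 0 < η) (hf : DifferentiableOn ℂ f (strip η))
    (hC : ∀ z ∈ strip η, ‖deriv f z‖ ≤ C) {z : ℂ} (hz : z ∈ strip η) :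
    ‖f z - f z.re‖ ≤ C * |z.im| := by
  have h := (convex_strip η).norm_image_sub_le_of_norm_deriv_le
    (fun w hw => hf.differentiableAt ((isOpen_strip η).mem_nhds hw)) hC
    (ofReal_mem_strip hη z.re) hz
  have e : z - z.re = z.im * I := by
    apply Complex.ext <;> simp
  rwa [e, norm_mul, norm_I, mul_one, norm_real, Real.norm_eq_abs] at h

theorem exists_turningPoint {η₀ t₁ C : ℝ} {f₁ f₂ : ℂ → ℂ} {l₁ l₂ r₁ r₂ : ℝ} (hη₀ : 0 < η₀)
    (hC : 0 < C)
    (diff₁ : DifferentiableOn ℂ f₁ (strip η₀)) (diff₂ : DifferentiableOn ℂ f₂ (strip η₀))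
    (real₁ : ∀ x : ℝ, (f₁ x).im = 0) (real₂ : ∀ x : ℝ, (f₂ x).im = 0)
    (zero : f₁ t₁ = 0) (hd : 0 < (deriv f₁ t₁).re)
    (bound : ∀ z ∈ strip η₀, ‖f₁ z‖ ≤ C ∧ ‖f₂ z‖ ≤ C ∧
      ‖deriv f₁ z‖ ≤ C / (1 + |z.re|) ^ 2 ∧ ‖deriv f₂ z‖ ≤ C / (1 + |z.re|) ^ 2)
    (pos₂ : ∀ x : ℝ, 0 < (f₂ x).re) (pos₁ : ∀ x : ℝ, t₁ < x → 0 < (f₁ x).re)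
    (neg₁ : ∀ x : ℝ, x < t₁ → (f₁ x).re < 0)
    (hr₁ : Tendsto (fun x : ℝ => (f₁ x).re) atTop (𝓝 r₁)) (hr₁' : 0 < r₁)
    (hr₂ : Tendsto (fun x : ℝ => (f₂ x).re) atTop (𝓝 r₂)) (hr₂' : 0 < r₂)
    (hl₁ : Tendsto (fun x : ℝ => (f₁ ((-x : ℝ) : ℂ)).re) atTop (𝓝 l₁)) (hl₁' : l₁ < 0)
    (hl₂ : Tendsto (fun x : ℝ => (f₂ ((-x : ℝ) : ℂ)).re) atTop (𝓝 l₂)) (hl₂' : 0 < l₂) :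
    ∃ η > 0, η ≤ η₀ ∧ TurningPoint η t₁ f₁ f₂ := by
  have hcont : ∀ f : ℂ → ℂ, DifferentiableOn ℂ f (strip η₀) → Continuous fun x : ℝ => (f x).re := by
    intro f hf
    exact continuous_re.comp (hf.continuousOn.comp_continuous continuous_ofReal
      (ofReal_mem_strip hη₀))
  have hderiv : ∀ z : ℂ, C / (1 + |z.re|) ^ 2 ≤ C := fun z =>
    div_le_self hC.le (by nlinarith [abs_nonneg z.re])
  have hval : ∀ f : ℂ → ℂ, (∀ x : ℝ, (f x).im = 0) → ∀ x : ℝ, f x = ((f x).re : ℂ) :=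
    fun f hf x => Complex.ext (by simp) (by simp [hf x])
  -- lower bound for `f₂` on the real axis
  obtain ⟨c₂, hc₂, hlow₂⟩ : ∃ c > 0, ∀ x : ℝ, c ≤ (f₂ x).re := by
    obtain ⟨c, hc, h⟩ := exists_pos_le_of_tendsto (a := 0) (hcont f₂ diff₂).continuousOn
      (fun x _ => pos₂ x) hr₂' hr₂
    obtain ⟨c', hc', h'⟩ := exists_pos_le_of_tendsto (a := 0)
      (((hcont f₂ diff₂).comp continuous_neg).continuousOn) (fun x _ => pos₂ (-x)) hl₂' hl₂
    refine ⟨min c c', lt_min hc hc', fun x => ?_⟩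
    rcases le_total 0 x with hx | hx
    · exact (min_le_left _ _).trans (h x hx)
    · refine (min_le_right _ _).trans ?_
      simpa using h' (-x) (by linarith)
  -- the quotient near `t₁`
  have ht₁ : (t₁ : ℂ) ∈ strip η₀ := ofReal_mem_strip hη₀ t₁
  have hd₁ := diff₁.differentiableAt ((isOpen_strip η₀).mem_nhds ht₁)
  set d := deriv f₁ t₁ with hd_def
  have hdre : d = (d.re : ℂ) := by
    have h1 : HasDerivAt (fun x : ℝ => f₁ x) d t₁ := hd₁.hasDerivAt.comp_ofReal
    have h2 : HasDerivAt (fun x : ℝ => (f₁ x).im) d.im t₁ :=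
      (imCLM.hasFDerivAt.comp_hasDerivAt t₁ h1)
    have h3 : HasDerivAt (fun x : ℝ => (f₁ x).im) 0 t₁ := by
      simp only [real₁]; exact hasDerivAt_const _ _
    exact Complex.ext (by simp) (by simp [h2.unique h3])
  obtain ⟨r, hr, hnear⟩ : ∃ r > 0, ∀ z : ℂ, ‖z - t₁‖ < 2 * r →
      ‖dslope f₁ t₁ z - d‖ < d.re / 4 := by
    have h1 : ContinuousAt (dslope f₁ t₁) t₁ := continuousAt_dslope_same.2 hd₁
    obtain ⟨s, hs, h2⟩ := Metric.continuousAt_iff.1 h1 (d.re / 4) (by linarith)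
    refine ⟨s / 2, half_pos hs, fun z hz => ?_⟩
    have := h2 (x := z) (by rw [dist_eq_norm]; linarith)
    rwa [dslope_same, dist_eq_norm] at this
  -- lower bound for `f₁` on the real axis away from `t₁`
  obtain ⟨c₁, hc₁, hlow₁⟩ : ∃ c > 0, ∀ x : ℝ, r ≤ |x - t₁| → c * |x - t₁| ≤ (f₁ x).re * (x - t₁) := by
    obtain ⟨c, hc, h⟩ := exists_pos_le_of_tendsto (a := t₁ + r) (hcont f₁ diff₁).continuousOn
      (fun x hx => pos₁ x (by linarith)) hr₁' hr₁
    obtain ⟨c', hc', h'⟩ := exists_pos_le_of_tendsto (a := r - t₁)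
      (((hcont f₁ diff₁).comp continuous_neg).neg.continuousOn)
      (fun x hx => neg_pos.2 (neg₁ (-x) (by linarith))) (neg_pos.2 hl₁') hl₁.neg
    refine ⟨min c c', lt_min hc hc', fun x hx => ?_⟩
    rcases le_abs.1 hx with hx | hx
    · rw [abs_of_pos (by linarith)]
      have := (min_le_left c c').trans (h x (by linarith))
      nlinarith
    · rw [abs_of_neg (by linarith)]
      have h1 := (min_le_right c c').trans (h' (-x) (by linarith))
      have h2 : min c c' ≤ -(f₁ x).re := by simpa using h1
      nlinarith
  -- choice of the width
  set A := 2 * C + C / r with hA_def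
  have hA : 0 < A := by positivity
  set η := min (min η₀ r) (min (c₂ / (4 * C)) (c₁ / (4 * A)))
  have hη : 0 < η := by positivity
  have h1 : η ≤ η₀ := (min_le_left _ _).trans (min_le_left _ _)
  have h2 : η ≤ r := (min_le_left _ _).trans (min_le_right _ _)
  have h3 : C * η ≤ c₂ / 4 := by
    calc C * η ≤ C * (c₂ / (4 * C)) := by gcongr; exact (min_le_right _ _).trans (min_le_left _ _)
      _ = c₂ / 4 := by field_simp
  have h4 : A * η ≤ c₁ / 4 := by
    calc A * η ≤ A * (c₁ / (4 * A)) := by gcongr; exact (min_le_right _ _).trans (min_le_right _ _)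
      _ = c₁ / 4 := by field_simp
  have h5 : C * η ≤ c₁ / 4 := by
    refine le_trans ?_ h4
    gcongr
    have : 0 < C / r := by positivity
    linarith
  have hsub := strip_mono h1
  have hdiff₁ : ∀ z ∈ strip η, ‖f₁ z - f₁ z.re‖ ≤ C * |z.im| := fun z hz =>
    norm_sub_re_le hη₀ diff₁ (fun w hw => (bound w hw).2.2.1.trans (hderiv w)) (hsub hz)
  have hdiff₂ : ∀ z ∈ strip η, ‖f₂ z - f₂ z.re‖ ≤ c₂ / 4 := fun z hz => by
    refine (norm_sub_re_le hη₀ diff₂ (fun w hw => (bound w hw).2.2.2.trans (hderiv w))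
      (hsub hz)).trans (le_trans ?_ h3)
    have : |z.im| < η := hz
    gcongr
  have hs₂ : ∀ z ∈ strip η, 3 * c₂ / 4 ≤ (f₂ z).re ∧ |(f₂ z).im| ≤ c₂ / 4 := by
    intro z hz
    have e1 := (abs_re_le_norm _).trans (hdiff₂ z hz)
    have e2 := (abs_im_le_norm _).trans (hdiff₂ z hz)
    rw [sub_re, abs_le] at e1
    rw [sub_im, real₂, sub_zero] at e2
    exact ⟨by linarith [hlow₂ z.re], e2⟩
  have hfar : ∀ z ∈ strip η, 2 * r ≤ ‖z - t₁‖ → r ≤ |z.re - t₁| ∧ |z.im| ≤ |z.re - t₁| := by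
    intro z hz hzr
    have e1 := norm_le_abs_re_add_abs_im (z - t₁)
    have e2 : |z.im| < η := hz
    rw [sub_re, sub_im, ofReal_re, ofReal_im, sub_zero] at e1
    exact ⟨by linarith, by linarith⟩
  refine ⟨η, hη, h1, hη, diff₁.mono hsub, diff₂.mono hsub, real₁, real₂, zero, fun z hz => ?_,
    fun z hz => ?_, ⟨C, hC, fun z hz => bound z (hsub hz)⟩, ⟨3 * c₂ / 4, by positivity,
    fun z hz => (hs₂ z hz).1.trans (re_le_norm _)⟩, fun s hs => ?_⟩
  · by_cases hzr : ‖z - t₁‖ < 2 * r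
    · have e := hnear z hzr
      have e1 := (abs_re_le_norm _).trans_lt e
      have e2 := (abs_im_le_norm _).trans_lt e
      have e3 : d.im = 0 := by rw [hdre, ofReal_im]
      rw [sub_re, abs_lt] at e1
      rw [sub_im, e3, sub_zero] at e2
      linarith
    · push Not at hzr
      obtain ⟨e1, e2⟩ := hfar z hz hzr
      have e3 : |z.im| < η := hz
      set a := z.re - t₁ with ha
      have ha0 : 0 < |a| := by linarith
      have hne : z - t₁ ≠ 0 := norm_pos_iff.1 (by linarith)
      have hne' : z ≠ t₁ := sub_ne_zero.1 hne
      set w := f₁ z - f₁ z.re with hw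
      have hw1 : ‖w‖ ≤ C * |z.im| := hdiff₁ z hz
      have hconj : starRingEnd ℂ (z - t₁) = a - z.im * I := by
        apply Complex.ext <;> simp [ha]
      have hn : 0 < normSq (z - t₁) := normSq_pos.2 hne
      have hquot : dslope f₁ t₁ z = (((normSq (z - t₁))⁻¹ : ℝ) : ℂ) *
          ((((f₁ z.re).re * a : ℝ) : ℂ) + (w * (a - z.im * I) - z.im * I * (f₁ z.re).re)) := by
        have : (((f₁ z.re).re * a : ℝ) : ℂ) + (w * (a - z.im * I) - z.im * I * (f₁ z.re).re)
            = f₁ z * starRingEnd ℂ (z - t₁) := by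
          rw [hconj, hw, hval f₁ real₁ z.re]
          push_cast
          simp only [ofReal_re]
          ring
        rw [this, dslope_of_ne _ hne', slope_def_field, zero, sub_zero, div_eq_mul_inv, inv_def]
        ring
      have herr : ‖w * (a - z.im * I) - z.im * I * (f₁ z.re).re‖ ≤ c₁ / 4 * |a| := by
        have g1 : ‖(a : ℂ) - z.im * I‖ ≤ |a| + |z.im| := by
          refine (norm_sub_le _ _).trans (le_of_eq ?_)
          rw [norm_mul, norm_I, norm_real, norm_real, mul_one, Real.norm_eq_abs, Real.norm_eq_abs]
        have g2 : |(f₁ z.re).re| ≤ C :=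
          (abs_re_le_norm _).trans (bound _ (ofReal_mem_strip hη₀ _)).1
        calc _ ≤ ‖w‖ * ‖(a : ℂ) - z.im * I‖ + |z.im| * |(f₁ z.re).re| := by
              refine (norm_sub_le _ _).trans (le_of_eq ?_)
              rw [norm_mul, norm_mul, norm_mul, norm_I, norm_real, norm_real, mul_one,
                Real.norm_eq_abs, Real.norm_eq_abs]
          _ ≤ C * |z.im| * (|a| + |a|) + |z.im| * C := by
              refine add_le_add (mul_le_mul hw1 (g1.trans (by linarith)) (norm_nonneg _)
                (by positivity)) (mul_le_mul_of_nonneg_left g2 (abs_nonneg _))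
          _ ≤ C * η * (|a| + |a|) + η * (C / r * |a|) := by
              have g3 : C ≤ C / r * |a| := by
                rw [div_mul_eq_mul_div, le_div_iff₀ hr]
                exact mul_le_mul_of_nonneg_left e1 hC.le
              gcongr
          _ = A * η * |a| := by rw [hA_def]; ring
          _ ≤ c₁ / 4 * |a| := by gcongr
      have e4 := hlow₁ z.re e1
      rw [← ha] at e4
      have e5 := (abs_re_le_norm _).trans herr
      have e6 := (abs_im_le_norm _).trans herr
      rw [hquot, re_ofReal_mul, im_ofReal_mul, add_re, add_im, ofReal_re, ofReal_im, zero_add,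
        abs_mul, abs_of_pos (inv_pos.2 hn)]
      refine mul_lt_mul_of_pos_left ?_ (inv_pos.2 hn)
      rw [abs_le] at e5
      have : 0 < c₁ * |a| := by positivity
      linarith
  · obtain ⟨e1, e2⟩ := hs₂ z hz
    linarith
  · refine ⟨min (3 * c₁ / 4) (s * (3 * d.re / 4)), by positivity, fun z hz hzs => ?_⟩
    by_cases hzr : ‖z - t₁‖ < 2 * r
    · refine (min_le_right _ _).trans ?_
      have e := hnear z hzr
      have e1 := (abs_re_le_norm _).trans_lt e
      rw [sub_re, abs_lt] at e1
      have hne : z - t₁ ≠ 0 := norm_pos_iff.1 (by linarith)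
      have e2 : f₁ z = (z - t₁) * dslope f₁ t₁ z := by
        have := sub_smul_dslope f₁ t₁ z
        rw [zero, sub_zero, smul_eq_mul] at this
        exact this.symm
      rw [e2, norm_mul]
      refine mul_le_mul hzs ?_ (by positivity) (norm_nonneg _)
      exact le_trans (by linarith) (re_le_norm _)
    · push Not at hzr
      refine (min_le_left _ _).trans ?_
      obtain ⟨e1, e2⟩ := hfar z hz hzr
      have e3 : |z.im| < η := hz
      have e4 := hlow₁ z.re e1
      have e5 : c₁ ≤ |(f₁ z.re).re| := by
        have g : (f₁ z.re).re * (z.re - t₁) ≤ |(f₁ z.re).re| * |z.re - t₁| := by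
          rw [← abs_mul]; exact le_abs_self _
        exact le_of_mul_le_mul_right (e4.trans g) (by linarith)
      have e6 := hdiff₁ z hz
      have e7 : C * |z.im| ≤ c₁ / 4 := le_trans (by gcongr) h5
      have e8 := norm_sub_norm_le (f₁ z.re) (f₁ z)
      rw [norm_sub_rev] at e8
      have e9 := abs_re_le_norm (f₁ z.re)
      linarith

/-- The strip of width `η` cut along the vertical segment above `t₁`. -/
def cutStrip (η t₁ : ℝ) : Set ℂ := {z | z ∈ strip η ∧ I * (z - t₁) ∈ slitPlane}

/-- The branch of `log f₁` on the strip cut above the zero `t₁` of `f₁`. -/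
noncomputable def turningLog (t₁ : ℝ) (f₁ : ℂ → ℂ) (z : ℂ) : ℂ :=
  log (I * (z - t₁)) - Real.pi / 2 * I + log (dslope f₁ t₁ z)

/-- The branch of `√(f₁ f₂) / c` on the cut strip. -/
noncomputable def wkbK (t₁ c : ℝ) (f₁ f₂ : ℂ → ℂ) (z : ℂ) : ℂ :=
  exp ((turningLog t₁ f₁ z + log (f₂ z)) / 2) / c

/-- The branch of `(f₂ / f₁)^{1/4}` on the cut strip. -/
noncomputable def wkbT (t₁ : ℝ) (f₁ f₂ : ℂ → ℂ) (z : ℂ) : ℂ :=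
  exp ((log (f₂ z) - turningLog t₁ f₁ z) / 4)

/-- The logarithmic derivative of `(f₂ / f₁)^{1/4}`. -/
noncomputable def wkbG (f₁ f₂ : ℂ → ℂ) (z : ℂ) : ℂ :=
  (deriv f₂ z / f₂ z - deriv f₁ z / f₁ z) / 4

theorem isOpen_cutStrip (η t₁ : ℝ) : IsOpen (cutStrip η t₁) :=
  (isOpen_strip η).inter (isOpen_slitPlane.preimage (by fun_prop))

theorem starConvex_cutStrip {η : ℝ} (hη : 0 < η) (t₁ : ℝ) :
    StarConvex ℝ ((t₁ : ℂ) - η / 2 * I) (cutStrip η t₁) := by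
  have hb : (t₁ : ℂ) - η / 2 * I ∈ strip η := by
    show |((t₁ : ℂ) - η / 2 * I).im| < η
    have : ((t₁ : ℂ) - η / 2 * I).im = -(η / 2) := by simp
    rw [this, abs_neg, abs_of_pos (half_pos hη)]
    linarith
  intro z hz a b ha hb' hab
  refine ⟨(convex_strip η).starConvex hb hz.1 ha hb' hab, ?_⟩
  have h := starConvex_ofReal_slitPlane (half_pos hη) hz.2 ha hb' hab
  have hab' : (a : ℂ) + b = 1 := by exact_mod_cast hab
  have e : I * ((a • ((t₁ : ℂ) - η / 2 * I) + b • z) - t₁)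
      = a • (((η / 2 : ℝ) : ℂ)) + b • (I * (z - t₁)) := by
    simp only [real_smul]
    push_cast
    linear_combination (-(a : ℂ) * η / 2) * I_mul_I + I * t₁ * hab'
  rw [e]
  exact h

theorem mem_cutStrip_of_im_neg {η t₁ : ℝ} {z : ℂ} (hz : z ∈ strip η) (h : z.im < 0) :
    z ∈ cutStrip η t₁ := by
  refine ⟨hz, mem_slitPlane_iff.2 (Or.inl ?_)⟩
  simpa using h

theorem ofReal_mem_cutStrip {η t₁ : ℝ} (hη : 0 < η) {x : ℝ} (hx : x ≠ t₁) :
    (x : ℂ) ∈ cutStrip η t₁ := by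
  refine ⟨ofReal_mem_strip hη x, mem_slitPlane_iff.2 (Or.inr ?_)⟩
  simpa using sub_ne_zero.2 hx

theorem abs_arg_lt_of_abs_im_lt_re {w : ℂ} (h : |w.im| < w.re) : |w.arg| < Real.pi / 4 := by
  have hre : 0 < w.re := (abs_nonneg _).trans_lt h
  have hw : |w.arg| < Real.pi / 2 := abs_arg_lt_pi_div_two_iff.2 (Or.inl hre)
  have hpi := Real.pi_pos
  rw [abs_lt] at hw
  have ht : |Real.tan w.arg| < 1 := by
    rwa [tan_arg, abs_div, abs_of_pos hre, div_lt_one hre]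
  rw [abs_lt] at ht ⊢
  constructor
  · by_contra! hcon
    have := Real.strictMonoOn_tan.monotoneOn (a := w.arg) (b := -(Real.pi / 4))
      ⟨hw.1, hw.2⟩ ⟨by linarith, by linarith⟩ hcon
    rw [Real.tan_neg, Real.tan_pi_div_four] at this
    linarith
  · by_contra! hcon
    have := Real.strictMonoOn_tan.monotoneOn (a := Real.pi / 4) (b := w.arg)
      ⟨by linarith, by linarith⟩ ⟨hw.1, hw.2⟩ hcon
    rw [Real.tan_pi_div_four] at this
    linarith

namespace TurningPoint

variable {η t₁ c : ℝ} {f₁ f₂ : ℂ → ℂ}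

theorem eq_mul_dslope (hT : TurningPoint η t₁ f₁ f₂) (z : ℂ) :
    f₁ z = (z - t₁) * dslope f₁ t₁ z := by
  have := sub_smul_dslope f₁ (t₁ : ℂ) z
  rw [hT.zero, sub_zero, smul_eq_mul] at this
  exact this.symm

theorem dslope_ne (hT : TurningPoint η t₁ f₁ f₂) {z : ℂ} (hz : z ∈ strip η) :
    dslope f₁ t₁ z ∈ slitPlane ∧ dslope f₁ t₁ z ≠ 0 := by
  have h := (abs_nonneg _).trans_lt (hT.sector₁ z hz)
  exact ⟨mem_slitPlane_iff.2 (Or.inl h), fun h0 => by simp [h0] at h⟩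

theorem f₂_ne (hT : TurningPoint η t₁ f₁ f₂) {z : ℂ} (hz : z ∈ strip η) :
    f₂ z ∈ slitPlane ∧ f₂ z ≠ 0 := by
  have h := (abs_nonneg _).trans_lt (hT.sector₂ z hz)
  exact ⟨mem_slitPlane_iff.2 (Or.inl h), fun h0 => by simp [h0] at h⟩

theorem exp_turningLog (hT : TurningPoint η t₁ f₁ f₂) {z : ℂ} (hz : z ∈ cutStrip η t₁) :
    exp (turningLog t₁ f₁ z) = f₁ z := by
  rw [turningLog, exp_add, exp_sub, exp_log (slitPlane_ne_zero hz.2),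
    exp_log (hT.dslope_ne hz.1).2, exp_pi_div_two_mul_I, hT.eq_mul_dslope z]
  field_simp

theorem f₁_ne (hT : TurningPoint η t₁ f₁ f₂) {z : ℂ} (hz : z ∈ cutStrip η t₁) : f₁ z ≠ 0 := by
  rw [← hT.exp_turningLog hz]; exact exp_ne_zero _

theorem hasDerivAt_f₁ (hT : TurningPoint η t₁ f₁ f₂) {z : ℂ} (hz : z ∈ strip η) :
    HasDerivAt f₁ (deriv f₁ z) z :=
  (hT.diff₁.differentiableAt ((isOpen_strip η).mem_nhds hz)).hasDerivAt

theorem hasDerivAt_f₂ (hT : TurningPoint η t₁ f₁ f₂) {z : ℂ} (hz : z ∈ strip η) :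
    HasDerivAt f₂ (deriv f₂ z) z :=
  (hT.diff₂.differentiableAt ((isOpen_strip η).mem_nhds hz)).hasDerivAt

theorem hasDerivAt_turningLog (hT : TurningPoint η t₁ f₁ f₂) {z : ℂ} (hz : z ∈ cutStrip η t₁) :
    HasDerivAt (turningLog t₁ f₁) (deriv f₁ z / f₁ z) z := by
  have hd : DifferentiableAt ℂ (dslope f₁ t₁) z :=
    ((differentiableOn_dslope ((isOpen_strip η).mem_nhds (ofReal_mem_strip hT.eta_pos t₁))).2
      hT.diff₁).differentiableAt ((isOpen_strip η).mem_nhds hz.1)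
  have h1 : DifferentiableAt ℂ (turningLog t₁ f₁) z := by
    have e1 : DifferentiableAt ℂ (fun z => log (I * (z - t₁))) z :=
      DifferentiableAt.clog (by fun_prop) hz.2
    have e2 : DifferentiableAt ℂ (fun z => log (dslope f₁ t₁ z)) z :=
      DifferentiableAt.clog hd (hT.dslope_ne hz.1).1
    exact (e1.sub_const (Real.pi / 2 * I)).add e2
  have h2 : HasDerivAt f₁ (exp (turningLog t₁ f₁ z) * deriv (turningLog t₁ f₁) z) z := by
    refine h1.hasDerivAt.cexp.congr_of_eventuallyEq ?_
    filter_upwards [(isOpen_cutStrip η t₁).mem_nhds hz] with w hw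
    exact (hT.exp_turningLog hw).symm
  have h3 := h2.unique (hT.hasDerivAt_f₁ hz.1)
  rw [hT.exp_turningLog hz] at h3
  rw [← h3, mul_div_cancel_left₀ _ (hT.f₁_ne hz)]
  exact h1.hasDerivAt

theorem hasDerivAt_log_f₂ (hT : TurningPoint η t₁ f₁ f₂) {z : ℂ} (hz : z ∈ strip η) :
    HasDerivAt (fun z => log (f₂ z)) (deriv f₂ z / f₂ z) z :=
  (hT.hasDerivAt_f₂ hz).clog (hT.f₂_ne hz).1

theorem hasDerivAt_wkbT (hT : TurningPoint η t₁ f₁ f₂) {z : ℂ} (hz : z ∈ cutStrip η t₁) :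
    HasDerivAt (wkbT t₁ f₁ f₂) (wkbG f₁ f₂ z * wkbT t₁ f₁ f₂ z) z := by
  have h := (((hT.hasDerivAt_log_f₂ hz.1).sub (hT.hasDerivAt_turningLog hz)).div_const 4).cexp
  rw [mul_comm] at h
  exact h

theorem wkbT_ne (z : ℂ) : wkbT t₁ f₁ f₂ z ≠ 0 :=
  exp_ne_zero ((log (f₂ z) - turningLog t₁ f₁ z) / 4)

theorem differentiableOn_wkbK (hT : TurningPoint η t₁ f₁ f₂) (c : ℝ) :
    DifferentiableOn ℂ (wkbK t₁ c f₁ f₂) (cutStrip η t₁) := fun _ hz =>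
  ((((hT.hasDerivAt_turningLog hz).add (hT.hasDerivAt_log_f₂ hz.1)).div_const 2).cexp.div_const
    (c : ℂ)).differentiableAt.differentiableWithinAt

theorem differentiableOn_wkbG (hT : TurningPoint η t₁ f₁ f₂) :
    DifferentiableOn ℂ (wkbG f₁ f₂) (cutStrip η t₁) := by
  have hsub : cutStrip η t₁ ⊆ strip η := fun z hz => hz.1
  have h1 := (hT.diff₁.deriv (isOpen_strip η)).mono hsub
  have h2 := (hT.diff₂.deriv (isOpen_strip η)).mono hsub
  exact ((h2.div (hT.diff₂.mono hsub) fun z hz => (hT.f₂_ne hz.1).2).sub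
    (h1.div (hT.diff₁.mono hsub) fun z hz => hT.f₁_ne hz)).div_const 4

theorem wkbK_sq (hT : TurningPoint η t₁ f₁ f₂) (hc : 0 < c) {z : ℂ} (hz : z ∈ cutStrip η t₁) :
    (c * wkbK t₁ c f₁ f₂ z) ^ 2 = f₁ z * f₂ z := by
  have hc' : (c : ℂ) ≠ 0 := ofReal_ne_zero.2 hc.ne'
  rw [wkbK, mul_div_cancel₀ _ hc', ← exp_nat_mul, ← hT.exp_turningLog hz]
  nth_rewrite 2 [← exp_log (hT.f₂_ne hz.1).2]
  rw [← exp_add]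
  congr 1
  push_cast
  ring

theorem wkbK_mul_wkbT_sq (hT : TurningPoint η t₁ f₁ f₂) (hc : 0 < c) {z : ℂ}
    (hz : z ∈ cutStrip η t₁) :
    c * wkbK t₁ c f₁ f₂ z * wkbT t₁ f₁ f₂ z ^ 2 = f₂ z ∧
    c * wkbK t₁ c f₁ f₂ z = f₁ z * wkbT t₁ f₁ f₂ z ^ 2 := by
  have hc' : (c : ℂ) ≠ 0 := ofReal_ne_zero.2 hc.ne'
  have e : wkbT t₁ f₁ f₂ z ^ 2 = exp ((log (f₂ z) - turningLog t₁ f₁ z) / 2) := by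
    rw [wkbT, ← exp_nat_mul]
    congr 1
    push_cast
    ring
  rw [wkbK, mul_div_cancel₀ _ hc', e, ← exp_add]
  constructor
  · nth_rewrite 3 [← exp_log (hT.f₂_ne hz.1).2]
    congr 1
    ring
  · rw [← hT.exp_turningLog hz, ← exp_add]
    congr 1
    ring

theorem exists_norm_wkbK_le (hT : TurningPoint η t₁ f₁ f₂) (hc : 0 < c) :
    ∃ M, ∀ z ∈ cutStrip η t₁, ‖wkbK t₁ c f₁ f₂ z‖ ≤ M := by
  obtain ⟨C, hC, hb⟩ := hT.bound
  refine ⟨C / c, fun z hz => ?_⟩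
  obtain ⟨h1, h2, -⟩ := hb z hz.1
  rw [le_div_iff₀ hc]
  have h3 := congrArg norm (hT.wkbK_sq hc hz)
  rw [norm_pow, norm_mul, norm_mul, norm_real, Real.norm_of_nonneg hc.le] at h3
  refine le_of_sq_le_sq ?_ hC.le
  calc (‖wkbK t₁ c f₁ f₂ z‖ * c) ^ 2 = ‖f₁ z‖ * ‖f₂ z‖ := by rw [← h3]; ring
    _ ≤ C * C := by gcongr
    _ = C ^ 2 := by ring

theorem exists_wkb_bounds (hT : TurningPoint η t₁ f₁ f₂) (hc : 0 < c) {r : ℝ} (hr : 0 < r) :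
    ∃ d > 0, ∃ C > 0, ∀ z ∈ cutStrip η t₁, r ≤ ‖z - t₁‖ →
      d ≤ ‖wkbK t₁ c f₁ f₂ z‖ ∧ ‖wkbG f₁ f₂ z‖ ≤ C / (1 + |z.re|) ^ 2 := by
  obtain ⟨C, hC, hb⟩ := hT.bound
  obtain ⟨c₁, hc₁, h1⟩ := hT.lower₁ r hr
  obtain ⟨c₂, hc₂, h2⟩ := hT.lower₂
  refine ⟨min c₁ c₂ / c, by positivity, (C / c₂ + C / c₁) / 4, by positivity, fun z hz hzr => ⟨?_, ?_⟩⟩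
  · rw [div_le_iff₀ hc]
    have h3 := congrArg norm (hT.wkbK_sq hc hz)
    rw [norm_pow, norm_mul, norm_mul, norm_real, Real.norm_of_nonneg hc.le] at h3
    refine le_of_sq_le_sq ?_ (by positivity)
    calc min c₁ c₂ ^ 2 = min c₁ c₂ * min c₁ c₂ := sq _
      _ ≤ ‖f₁ z‖ * ‖f₂ z‖ := mul_le_mul ((min_le_left _ _).trans (h1 z hz.1 hzr))
          ((min_le_right _ _).trans (h2 z hz.1)) (by positivity) (norm_nonneg _)
      _ = _ := by rw [← h3]; ring
  · obtain ⟨-, -, h3, h4⟩ := hb z hz.1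
    rw [wkbG, norm_div, norm_ofNat]
    calc ‖deriv f₂ z / f₂ z - deriv f₁ z / f₁ z‖ / 4
        ≤ (C / (1 + |z.re|) ^ 2 / c₂ + C / (1 + |z.re|) ^ 2 / c₁) / 4 := by
          gcongr
          refine (norm_sub_le _ _).trans (add_le_add ?_ ?_)
          · rw [norm_div]
            exact div_le_div₀ (by positivity) h4 hc₂ (h2 z hz.1)
          · rw [norm_div]
            exact div_le_div₀ (by positivity) h3 hc₁ (h1 z hz.1 hzr)
      _ = (C / c₂ + C / c₁) / 4 / (1 + |z.re|) ^ 2 := by field_simp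

theorem re_wkbK_pos (hT : TurningPoint η t₁ f₁ f₂) (hc : 0 < c) {z : ℂ} (hz : z ∈ cutStrip η t₁)
    (him : z.im ≤ 0) (hre : t₁ ≤ z.re) : 0 < (wkbK t₁ c f₁ f₂ z).re := by
  have h1 := abs_lt.1 (abs_arg_lt_of_abs_im_lt_re (hT.sector₁ z hz.1))
  have h2 := abs_lt.1 (abs_arg_lt_of_abs_im_lt_re (hT.sector₂ z hz.1))
  have h3 : 0 ≤ arg (I * (z - t₁)) := arg_nonneg_iff.2 (by simpa using hre)
  have h4 := abs_le.1 (abs_arg_le_pi_div_two_iff.2 (by simpa using him : 0 ≤ (I * (z - t₁)).re))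
  rw [wkbK, div_ofReal_re, exp_re]
  refine div_pos (mul_pos (Real.exp_pos _) (Real.cos_pos_of_mem_Ioo ?_)) hc
  have e : ((turningLog t₁ f₁ z + log (f₂ z)) / 2).im
      = (arg (I * (z - t₁)) - Real.pi / 2 + arg (dslope f₁ t₁ z) + arg (f₂ z)) / 2 := by
    simp [turningLog, log_im]
  rw [e]
  constructor <;> linarith

theorem im_wkbK_neg (hT : TurningPoint η t₁ f₁ f₂) (hc : 0 < c) {z : ℂ} (hz : z ∈ cutStrip η t₁)
    (him : z.im ≤ 0) (hre : z.re ≤ t₁) : (wkbK t₁ c f₁ f₂ z).im < 0 := by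
  have h1 := abs_lt.1 (abs_arg_lt_of_abs_im_lt_re (hT.sector₁ z hz.1))
  have h2 := abs_lt.1 (abs_arg_lt_of_abs_im_lt_re (hT.sector₂ z hz.1))
  have h4 := abs_le.1 (abs_arg_le_pi_div_two_iff.2 (by simpa using him : 0 ≤ (I * (z - t₁)).re))
  have hI0 : I * (z - t₁) ≠ 0 := slitPlane_ne_zero hz.2
  have h3 : arg (I * (z - t₁)) ≤ 0 := by
    have hi : (I * (z - t₁)).im ≤ 0 := by simpa using hre
    rcases hi.lt_or_eq with hi | hi
    · exact (arg_neg_iff.2 hi).le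
    · exact (arg_eq_zero_iff.2 ⟨by simpa using him, hi⟩).le
  have hpi := Real.pi_pos
  rw [wkbK, div_ofReal_im, exp_im]
  refine div_neg_of_neg_of_pos (mul_neg_of_pos_of_neg (Real.exp_pos _)
    (Real.sin_neg_of_neg_of_neg_pi_lt ?_ ?_)) hc
  all_goals
    have e : ((turningLog t₁ f₁ z + log (f₂ z)) / 2).im
        = (arg (I * (z - t₁)) - Real.pi / 2 + arg (dslope f₁ t₁ z) + arg (f₂ z)) / 2 := by
      simp [turningLog, log_im]
    rw [e]
    linarith

end TurningPoint

theorem tendsto_atTop_of_integrableOn_deriv {f f' : ℝ → ℂ} {a : ℝ} {A : ℂ}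
    (hd : ∀ x, a < x → HasDerivAt f (f' x) x) (hA : Tendsto f (𝓝[>] a) (𝓝 A))
    (hi : IntegrableOn f' (Ioi a)) : Tendsto f atTop (𝓝 (A + ∫ x in Ioi a, f' x)) := by
  have h1 := tendsto_limUnder_of_hasDerivAt_of_integrableOn_Ioi (fun x hx => hd x hx) hi
  set F := Function.update f a A with hF
  have hFf : ∀ x, a < x → F =ᶠ[𝓝 x] f := fun x hx => by
    filter_upwards [isOpen_Ioi.mem_nhds hx] with y hy
    exact Function.update_of_ne (ne_of_gt hy) _ _
  have h2 : ContinuousWithinAt F (Ici a) a := by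
    rw [hF, continuousWithinAt_update_same, Ici_sdiff_left]
    exact hA
  have h3 : Tendsto F atTop (𝓝 (limUnder atTop f)) := by
    refine h1.congr' ?_
    filter_upwards [eventually_gt_atTop a] with x hx
    exact (Function.update_of_ne (ne_of_gt hx) _ _).symm
  have h4 := integral_Ioi_of_hasDerivAt_of_tendsto h2
    (fun x hx => (hd x hx).congr_of_eventuallyEq (hFf x hx)) hi h3
  rw [hF, Function.update_self] at h4
  rwa [h4, add_sub_cancel]

theorem tendsto_atBot_of_integrableOn_deriv {f f' : ℝ → ℂ} {a : ℝ} {A : ℂ}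
    (hd : ∀ x, x < a → HasDerivAt f (f' x) x) (hA : Tendsto f (𝓝[<] a) (𝓝 A))
    (hi : IntegrableOn f' (Iic a)) : Tendsto f atBot (𝓝 (A - ∫ x in Iic a, f' x)) := by
  have h1 := tendsto_limUnder_of_hasDerivAt_of_integrableOn_Iic
    (fun x (hx : x ∈ Iic (a - 1)) => hd x (by have := mem_Iic.1 hx; linarith))
    (hi.mono_set (Iic_subset_Iic.2 (by linarith)))
  set F := Function.update f a A with hF
  have hFf : ∀ x, x < a → F =ᶠ[𝓝 x] f := fun x hx => by
    filter_upwards [isOpen_Iio.mem_nhds hx] with y hy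
    exact Function.update_of_ne (ne_of_lt hy) _ _
  have h2 : ContinuousWithinAt F (Iic a) a := by
    rw [hF, continuousWithinAt_update_same, Iic_sdiff_right]
    exact hA
  have h3 : Tendsto F atBot (𝓝 (limUnder atBot f)) := by
    refine h1.congr' ?_
    filter_upwards [eventually_lt_atBot a] with x hx
    exact (Function.update_of_ne (ne_of_lt hx) _ _).symm
  have h4 := integral_Iic_of_hasDerivAt_of_tendsto h2
    (fun x hx => (hd x hx).congr_of_eventuallyEq (hFf x hx)) hi h3
  rw [hF, Function.update_self] at h4
  rwa [h4, sub_sub_cancel]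

namespace TurningPoint

variable {η t₁ c : ℝ} {f₁ f₂ : ℂ → ℂ}

theorem ofReal_re₁ (hT : TurningPoint η t₁ f₁ f₂) (x : ℝ) : f₁ x = ((f₁ x).re : ℂ) :=
  Complex.ext (by simp) (by simp [hT.real₁ x])

theorem ofReal_re₂ (hT : TurningPoint η t₁ f₁ f₂) (x : ℝ) : f₂ x = ((f₂ x).re : ℂ) :=
  Complex.ext (by simp) (by simp [hT.real₂ x])

theorem dslope_ofReal (hT : TurningPoint η t₁ f₁ f₂) {x : ℝ} (hx : x ≠ t₁) :
    dslope f₁ t₁ x = (((f₁ x).re / (x - t₁) : ℝ) : ℂ) ∧ 0 < (f₁ x).re / (x - t₁) := by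
  have hx' : (x : ℂ) ≠ t₁ := fun h => hx (ofReal_injective h)
  have e : dslope f₁ t₁ x = (((f₁ x).re / (x - t₁) : ℝ) : ℂ) := by
    rw [dslope_of_ne _ hx', slope_def_field, hT.zero, sub_zero, hT.ofReal_re₁ x]
    push_cast
    simp
  refine ⟨e, ?_⟩
  have := (abs_nonneg _).trans_lt (hT.sector₁ x (ofReal_mem_strip hT.eta_pos x))
  rwa [e, ofReal_re] at this

theorem re₂_pos (hT : TurningPoint η t₁ f₁ f₂) (x : ℝ) : 0 < (f₂ x).re :=
  (abs_nonneg _).trans_lt (hT.sector₂ x (ofReal_mem_strip hT.eta_pos x))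

theorem re₁_pos (hT : TurningPoint η t₁ f₁ f₂) {x : ℝ} (hx : t₁ < x) : 0 < (f₁ x).re := by
  have := mul_pos (hT.dslope_ofReal hx.ne').2 (sub_pos.2 hx)
  rwa [div_mul_cancel₀ _ (sub_pos.2 hx).ne'] at this

theorem re₁_neg (hT : TurningPoint η t₁ f₁ f₂) {x : ℝ} (hx : x < t₁) : (f₁ x).re < 0 := by
  have := mul_neg_of_pos_of_neg (hT.dslope_ofReal hx.ne).2 (sub_neg.2 hx)
  rwa [div_mul_cancel₀ _ (sub_neg.2 hx).ne] at this

theorem log_f₂_ofReal (hT : TurningPoint η t₁ f₁ f₂) (x : ℝ) :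
    log (f₂ x) = (Real.log (f₂ x).re : ℂ) := by
  rw [hT.ofReal_re₂ x, ofReal_re, ofReal_log (hT.re₂_pos x).le]

theorem turningLog_of_gt (hT : TurningPoint η t₁ f₁ f₂) {x : ℝ} (hx : t₁ < x) :
    turningLog t₁ f₁ x = (Real.log (f₁ x).re : ℂ) := by
  obtain ⟨e, h⟩ := hT.dslope_ofReal hx.ne'
  have h1 : I * ((x : ℂ) - t₁) = ((x - t₁ : ℝ) : ℂ) * I := by push_cast; ring
  rw [turningLog, e, ← ofReal_log h.le, h1, log_ofReal_mul (sub_pos.2 hx) I_ne_zero, log_I,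
    Real.log_div (hT.re₁_pos hx).ne' (sub_pos.2 hx).ne']
  push_cast
  ring

theorem turningLog_of_lt (hT : TurningPoint η t₁ f₁ f₂) {x : ℝ} (hx : x < t₁) :
    turningLog t₁ f₁ x = (Real.log (-(f₁ x).re) : ℂ) - Real.pi * I := by
  obtain ⟨e, h⟩ := hT.dslope_ofReal hx.ne
  have h1 : I * ((x : ℂ) - t₁) = ((t₁ - x : ℝ) : ℂ) * -I := by push_cast; ring
  have h2 : (f₁ x).re / (x - t₁) = -(f₁ x).re / (t₁ - x) := by
    rw [← neg_sub t₁ x, div_neg, neg_div]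
  rw [turningLog, e, ← ofReal_log h.le, h1, log_ofReal_mul (sub_pos.2 hx) (neg_ne_zero.2 I_ne_zero),
    log_neg_I, h2, Real.log_div (neg_pos.2 (hT.re₁_neg hx)).ne' (sub_pos.2 hx).ne']
  push_cast
  ring

theorem wkbK_of_gt (hT : TurningPoint η t₁ f₁ f₂) {x : ℝ} (hx : t₁ < x) :
    wkbK t₁ c f₁ f₂ x = ((Real.sqrt ((f₁ x).re * (f₂ x).re) / c : ℝ) : ℂ) := by
  have h1 := hT.re₁_pos hx
  have h2 := hT.re₂_pos x
  rw [wkbK, hT.turningLog_of_gt hx, hT.log_f₂_ofReal, Real.sqrt_eq_rpow,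
    Real.rpow_def_of_pos (mul_pos h1 h2), Real.log_mul h1.ne' h2.ne']
  push_cast
  ring_nf

theorem wkbK_of_lt (hT : TurningPoint η t₁ f₁ f₂) {x : ℝ} (hx : x < t₁) :
    wkbK t₁ c f₁ f₂ x = -I * ((Real.sqrt (-(f₁ x).re * (f₂ x).re) / c : ℝ) : ℂ) := by
  have h1 := neg_pos.2 (hT.re₁_neg hx)
  have h2 := hT.re₂_pos x
  have e : (((Real.log (-(f₁ x).re) : ℂ) - Real.pi * I + (Real.log (f₂ x).re : ℂ)) / 2)
      = -(Real.pi / 2 * I) + (((Real.log (-(f₁ x).re) + Real.log (f₂ x).re) * (1 / 2) : ℝ) : ℂ) := by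
    push_cast; ring
  rw [wkbK, hT.turningLog_of_lt hx, hT.log_f₂_ofReal, Real.sqrt_eq_rpow,
    Real.rpow_def_of_pos (mul_pos h1 h2), Real.log_mul h1.ne' h2.ne', e, exp_add, exp_neg,
    exp_pi_div_two_mul_I, inv_I]
  push_cast
  ring

theorem wkbT_of_gt (hT : TurningPoint η t₁ f₁ f₂) {x : ℝ} (hx : t₁ < x) :
    wkbT t₁ f₁ f₂ x = ((((f₂ x).re / (f₁ x).re) ^ (1 / 4 : ℝ) : ℝ) : ℂ) := by
  have h1 := hT.re₁_pos hx
  have h2 := hT.re₂_pos x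
  rw [wkbT, hT.turningLog_of_gt hx, hT.log_f₂_ofReal, Real.rpow_def_of_pos (div_pos h2 h1),
    Real.log_div h2.ne' h1.ne']
  push_cast
  ring_nf

theorem wkbT_of_lt (hT : TurningPoint η t₁ f₁ f₂) {x : ℝ} (hx : x < t₁) :
    wkbT t₁ f₁ f₂ x
      = exp (I * Real.pi / 4) * ((((f₂ x).re / -(f₁ x).re) ^ (1 / 4 : ℝ) : ℝ) : ℂ) := by
  have h1 := neg_pos.2 (hT.re₁_neg hx)
  have h2 := hT.re₂_pos x
  rw [wkbT, hT.turningLog_of_lt hx, hT.log_f₂_ofReal, Real.rpow_def_of_pos (div_pos h2 h1),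
    Real.log_div h2.ne' h1.ne', ofReal_exp, ← exp_add]
  congr 1
  push_cast
  ring

theorem exists_tendsto_primitive (hT : TurningPoint η t₁ f₁ f₂) (hc : 0 < c) :
    ∃ Z₀, Tendsto (segmentPrimitive (t₁ - η / 2 * I) (wkbK t₁ c f₁ f₂)) (𝓝[cutStrip η t₁] t₁)
      (𝓝 Z₀) := by
  obtain ⟨M, hM⟩ := hT.exists_norm_wkbK_le hc
  set b : ℂ := t₁ - η / 2 * I with hb
  set k := wkbK t₁ c f₁ f₂ with hk
  have hst := starConvex_cutStrip hT.eta_pos t₁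
  have hkc : ContinuousOn k (cutStrip η t₁) := (hT.differentiableOn_wkbK c).continuousOn
  have hMb : ∀ᶠ z in 𝓝[cutStrip η t₁] (t₁ : ℂ), ‖z - b‖ ≤ ‖(t₁ : ℂ) - b‖ + 1 := by
    apply nhdsWithin_le_nhds
    have : Tendsto (fun z : ℂ => ‖z - b‖) (𝓝 (t₁ : ℂ)) (𝓝 ‖(t₁ : ℂ) - b‖) :=
      Continuous.tendsto (by fun_prop) _
    exact this.eventually (ge_mem_nhds (by linarith))
  refine ⟨∫ t in (0 : ℝ)..1, (t₁ - b) * k (b + t * (t₁ - b)),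
    intervalIntegral.tendsto_integral_filter_of_dominated_convergence
      (fun _ => (‖(t₁ : ℂ) - b‖ + 1) * M) ?_ ?_ intervalIntegrable_const ?_⟩
  · filter_upwards [self_mem_nhdsWithin] with z hz
    have h1 : ContinuousOn (fun t : ℝ => (z - b) * k (b + t * (z - b))) (Icc 0 1) := by
      have h2 : Continuous fun t : ℝ => b + t * (z - b) := by fun_prop
      have h3 : ContinuousOn (fun t : ℝ => k (b + t * (z - b))) (Icc 0 1) :=
        ContinuousOn.comp (f := fun t : ℝ => b + t * (z - b)) hkc h2.continuousOn
          fun t ht => hst.add_ofReal_mul_sub_mem hz ht.1 ht.2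
      exact continuousOn_const.mul h3
    refine (h1.mono ?_).aestronglyMeasurable measurableSet_uIoc
    rw [uIoc_of_le zero_le_one]
    exact Ioc_subset_Icc_self
  · filter_upwards [self_mem_nhdsWithin, hMb] with z hz hzb
    refine Eventually.of_forall fun t ht => ?_
    rw [uIoc_of_le zero_le_one] at ht
    rw [norm_mul]
    exact mul_le_mul hzb (hM _ (hst.add_ofReal_mul_sub_mem hz ht.1.le ht.2)) (norm_nonneg _)
      (by positivity)
  · have hne : ∀ᵐ t : ℝ, t ≠ 1 := by simp [ae_iff]
    filter_upwards [hne] with t ht1 ht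
    rw [uIoc_of_le zero_le_one] at ht
    have ht' : t < 1 := lt_of_le_of_ne ht.2 ht1
    have hmem : b + t * ((t₁ : ℂ) - b) ∈ cutStrip η t₁ := by
      have e : b + t * ((t₁ : ℂ) - b) = t₁ + ((-(η / 2 * (1 - t)) : ℝ) : ℂ) * I := by
        rw [hb]; push_cast; ring
      have hη := hT.eta_pos
      have h0 : 0 < η / 2 * (1 - t) := by
        have := sub_pos.2 ht'
        positivity
      have him : (b + t * ((t₁ : ℂ) - b)).im = -(η / 2 * (1 - t)) := by
        rw [e]; simp
      apply mem_cutStrip_of_im_neg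
      · show |_| < η
        rw [him, abs_neg, abs_of_pos h0]
        nlinarith [ht.1]
      · rw [him]; linarith
    have hcz : Tendsto (fun z : ℂ => b + t * (z - b)) (𝓝[cutStrip η t₁] (t₁ : ℂ))
        (𝓝 (b + t * (t₁ - b))) :=
      (Continuous.tendsto (by fun_prop : Continuous fun z : ℂ => b + t * (z - b)) _).mono_left
        nhdsWithin_le_nhds
    have hkt := (hkc.continuousAt ((isOpen_cutStrip η t₁).mem_nhds hmem)).tendsto.comp hcz
    have hsub : Tendsto (fun z : ℂ => z - b) (𝓝[cutStrip η t₁] (t₁ : ℂ)) (𝓝 (t₁ - b)) :=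
      (Continuous.tendsto (by fun_prop : Continuous fun z : ℂ => z - b) _).mono_left
        nhdsWithin_le_nhds
    exact hsub.mul hkt

/-- The two normalised phases: primitives of `k` asymptotic to `k₊ x` at `+∞` and to
`-i k₋ x` at `-∞`, with their difference. -/
theorem exists_phases (hT : TurningPoint η t₁ f₁ f₂) (hc : 0 < c) {qp qm : ℝ → ℝ} {kp km : ℝ}
    (hp : ∀ x : ℝ, t₁ < x → wkbK t₁ c f₁ f₂ x = ((qp x + kp : ℝ) : ℂ))
    (hm : ∀ x : ℝ, x < t₁ → wkbK t₁ c f₁ f₂ x = -I * ((qm x + km : ℝ) : ℂ))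
    (hqp : IntegrableOn qp (Ioi t₁)) (hqm : IntegrableOn qm (Iic t₁)) :
    ∃ ζR ζL : ℂ → ℂ, (∀ z ∈ cutStrip η t₁, HasDerivAt ζR (wkbK t₁ c f₁ f₂ z) z ∧
        HasDerivAt ζL (wkbK t₁ c f₁ f₂ z) z) ∧
      Tendsto (fun x : ℝ => ζR x - kp * x) atTop (𝓝 0) ∧
      Tendsto (fun x : ℝ => ζL x + I * km * x) atBot (𝓝 0) ∧
      ∀ z, ζL z - ζR z = (((∫ x in Ioi t₁, qp x) - kp * t₁ : ℝ) : ℂ)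
        - I * (((∫ x in Iic t₁, qm x) + km * t₁ : ℝ) : ℂ) := by
  obtain ⟨Z₀, hZ₀⟩ := hT.exists_tendsto_primitive hc
  set Z := segmentPrimitive (t₁ - η / 2 * I) (wkbK t₁ c f₁ f₂)
  have hZ : ∀ z ∈ cutStrip η t₁, HasDerivAt Z (wkbK t₁ c f₁ f₂ z) z := fun z hz =>
    hasDerivAt_segmentPrimitive (isOpen_cutStrip η t₁) (starConvex_cutStrip hT.eta_pos t₁)
      (hT.differentiableOn_wkbK c) hz
  have hreal : ∀ s : Set ℝ, (∀ x ∈ s, x ≠ t₁) →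
      Tendsto (fun x : ℝ => Z x) (𝓝[s] t₁) (𝓝 Z₀) := by
    intro s hs
    refine hZ₀.comp (tendsto_nhdsWithin_iff.2 ⟨continuous_ofReal.continuousWithinAt, ?_⟩)
    filter_upwards [self_mem_nhdsWithin] with x hx
    exact ofReal_mem_cutStrip hT.eta_pos (hs x hx)
  have hlin : ∀ (a : ℂ) (s : Set ℝ), Tendsto (fun x : ℝ => a * (x : ℂ)) (𝓝[s] t₁) (𝓝 (a * t₁)) :=
    fun a s => (Continuous.tendsto (by fun_prop : Continuous fun x : ℝ => a * (x : ℂ)) _).mono_left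
      nhdsWithin_le_nhds
  have hlind : ∀ (a : ℂ) (x : ℝ), HasDerivAt (fun x : ℝ => a * (x : ℂ)) a x := fun a x => by
    simpa using (hasDerivAt_id (x : ℂ)).comp_ofReal.const_mul a
  have hR := tendsto_atTop_of_integrableOn_deriv (f := fun x : ℝ => Z x - kp * x)
    (f' := fun x => ((qp x : ℝ) : ℂ)) (a := t₁) (A := Z₀ - kp * t₁)
    (fun x hx => by
      refine ((hZ x (ofReal_mem_cutStrip hT.eta_pos hx.ne')).comp_ofReal.sub
        (hlind kp x)).congr_deriv ?_
      rw [hp x hx]; push_cast; ring)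
    ((hreal _ fun x hx => ne_of_gt hx).sub (hlin _ _)) hqp.ofReal
  have hL := tendsto_atBot_of_integrableOn_deriv (f := fun x : ℝ => Z x + I * km * x)
    (f' := fun x => -I * ((qm x : ℝ) : ℂ)) (a := t₁) (A := Z₀ + I * km * t₁)
    (fun x hx => by
      refine ((hZ x (ofReal_mem_cutStrip hT.eta_pos hx.ne)).comp_ofReal.add
        (hlind (I * km) x)).congr_deriv ?_
      rw [hm x hx]; push_cast; ring)
    ((hreal _ fun x hx => ne_of_lt hx).add (hlin _ _)) (hqm.ofReal.const_mul (-I))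
  rw [integral_const_mul, integral_complex_ofReal] at hL
  rw [integral_complex_ofReal] at hR
  refine ⟨fun z => Z z - (Z₀ - kp * t₁ + ((∫ x in Ioi t₁, qp x : ℝ) : ℂ)),
    fun z => Z z - (Z₀ + I * km * t₁ - -I * ((∫ x in Iic t₁, qm x : ℝ) : ℂ)),
    fun z hz => ⟨(hZ z hz).sub_const _, (hZ z hz).sub_const _⟩, ?_, ?_, fun z => ?_⟩
  · have := hR.sub_const (Z₀ - kp * t₁ + ((∫ x in Ioi t₁, qp x : ℝ) : ℂ))
    rw [sub_self] at this
    refine this.congr fun x => ?_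
    ring
  · have := hL.sub_const (Z₀ + I * km * t₁ - -I * ((∫ x in Iic t₁, qm x : ℝ) : ℂ))
    rw [sub_self] at this
    refine this.congr fun x => ?_
    ring
  · push_cast
    ring

end TurningPoint

/-- The function `y₀ e^{-κ / (1 + s)}`, the height of the left contour below the real axis. -/
noncomputable def contourHeight (y₀ κ : ℝ) (s : ℂ) : ℂ := y₀ * exp (-(κ / (1 + s)))

theorem contourHeight_ofReal (y₀ κ s : ℝ) :
    contourHeight y₀ κ s = ((y₀ * Real.exp (-(κ / (1 + s))) : ℝ) : ℂ) := by
  rw [contourHeight]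
  push_cast
  rfl

theorem hasDerivAt_contourHeight (y₀ κ : ℝ) {s : ℂ} (hs : 1 + s ≠ 0) :
    HasDerivAt (contourHeight y₀ κ) (κ / (1 + s) ^ 2 * contourHeight y₀ κ s) s := by
  have h1 : HasDerivAt (fun s : ℂ => (1 + s)⁻¹) (-1 / (1 + s) ^ 2) s :=
    ((hasDerivAt_id s).const_add 1).fun_inv hs
  have h2 : HasDerivAt (fun s : ℂ => -(κ * (1 + s)⁻¹)) (-(κ * (-1 / (1 + s) ^ 2))) s :=
    (h1.const_mul (κ : ℂ)).fun_neg
  have h3 : HasDerivAt (fun s : ℂ => y₀ * exp (-(κ * (1 + s)⁻¹)))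
      (y₀ * (exp (-(κ * (1 + s)⁻¹)) * -(κ * (-1 / (1 + s) ^ 2)))) s := h2.cexp.const_mul _
  simp only [← div_eq_mul_inv] at h3
  refine h3.congr_deriv ?_
  rw [contourHeight]
  ring

theorem contourHeight_bounds {y₀ κ ρ : ℝ} (hy : 0 < y₀) (hκ : 0 < κ) (hρ : ρ ≤ 1 / 2)
    (hκρ : 4 * κ * ρ ≤ 1) {s : ℂ} (hs : s ∈ halfTube ρ) :
    y₀ * Real.exp (-(2 * κ)) / 2 ≤ (contourHeight y₀ κ s).re ∧ ‖contourHeight y₀ κ s‖ ≤ y₀ ∧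
      ‖κ / (1 + s) ^ 2 * contourHeight y₀ κ s‖ ≤ 4 * κ * y₀ := by
  set w : ℂ := 1 + s with hw
  have hre : 1 / 2 ≤ w.re := by
    have := hs.1
    simp [hw]; linarith
  have him : |w.im| < ρ := by simpa [hw] using hs.2
  have hn : 1 / 4 ≤ normSq w := by
    rw [normSq_apply]; nlinarith [mul_self_nonneg w.im]
  have hn' : 1 / 2 ≤ ‖w‖ := hre.trans ((le_abs_self _).trans (abs_re_le_norm w))
  have hn0 : 0 < normSq w := by linarith
  have e : (-(κ / w) : ℂ) = ((-(κ * (w.re / normSq w)) : ℝ) : ℂ)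
      + ((κ * (w.im / normSq w) : ℝ) : ℂ) * I := by
    rw [div_eq_mul_inv]
    apply Complex.ext
    · simp
    · simp [neg_div]
  have hr1 : 0 ≤ κ * (w.re / normSq w) := by
    have : 0 ≤ w.re := by linarith
    positivity
  have hr2 : κ * (w.re / normSq w) ≤ 2 * κ := by
    have : w.re / normSq w ≤ 2 := by
      rw [div_le_iff₀ hn0, normSq_apply]
      nlinarith [mul_self_nonneg w.im]
    nlinarith
  have hi : |κ * (w.im / normSq w)| ≤ 1 := by
    rw [abs_mul, abs_div, abs_of_pos hκ, abs_of_pos hn0]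
    have : |w.im| / normSq w ≤ 4 * ρ := by
      rw [div_le_iff₀ hn0]
      have := (abs_nonneg _).trans him.le
      nlinarith
    nlinarith
  have hcos : 1 / 2 ≤ Real.cos (κ * (w.im / normSq w)) := by
    have h1 := Real.one_sub_sq_div_two_le_cos (x := κ * (w.im / normSq w))
    have h2 := (sq_le_one_iff_abs_le_one _).2 hi
    linarith
  have hY : contourHeight y₀ κ s = y₀ * exp (-(κ / w)) := rfl
  have hnorm : ‖contourHeight y₀ κ s‖ ≤ y₀ := by
    rw [hY, norm_mul, norm_real, Real.norm_of_nonneg hy.le, norm_exp, e]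
    have h1 : (((-(κ * (w.re / normSq w)) : ℝ) : ℂ)
        + ((κ * (w.im / normSq w) : ℝ) : ℂ) * I).re = -(κ * (w.re / normSq w)) := by simp
    rw [h1]
    have : Real.exp (-(κ * (w.re / normSq w))) ≤ 1 := Real.exp_le_one_iff.2 (by linarith)
    nlinarith
  refine ⟨?_, hnorm, ?_⟩
  · have h1 : (contourHeight y₀ κ s).re
        = y₀ * (Real.exp (-(κ * (w.re / normSq w))) * Real.cos (κ * (w.im / normSq w))) := by
      rw [hY, re_ofReal_mul, e, exp_re]
      simp
    rw [h1, mul_div_assoc, div_eq_mul_inv]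
    have h2 : Real.exp (-(2 * κ)) ≤ Real.exp (-(κ * (w.re / normSq w))) :=
      Real.exp_le_exp.2 (by linarith)
    have h3 := Real.exp_pos (-(2 * κ))
    refine mul_le_mul_of_nonneg_left (mul_le_mul h2 ?_ (by norm_num) (h3.le.trans h2)) hy.le
    rw [← one_div]; exact hcos
  · rw [norm_mul, norm_div, norm_pow, norm_real, Real.norm_of_nonneg hκ.le]
    have h1 : κ / ‖w‖ ^ 2 ≤ 4 * κ := by
      rw [div_le_iff₀ (by positivity)]
      have : 1 / 4 ≤ ‖w‖ ^ 2 := by nlinarith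
      nlinarith
    exact mul_le_mul h1 hnorm (norm_nonneg _) (by positivity)

namespace TurningPoint

variable {η t₁ c : ℝ} {f₁ f₂ : ℂ → ℂ}

theorem wkbData_of_contour (hT : TurningPoint η t₁ f₁ f₂) (hc : 0 < c) {ρ r L : ℝ}
    {γ γ' : ℂ → ℂ} {σ : ℂ} (hσ : ‖σ‖ = 1) (hρ : 0 < ρ) (hρ' : ρ ≤ 1 / 2) (hr : 0 < r) (hL : 0 < L)
    (hd : ∀ s ∈ halfTube ρ, HasDerivAt γ (γ' s) s)
    (hm : ∀ s ∈ halfTube ρ, γ s ∈ cutStrip η t₁ ∧ r ≤ ‖γ s - t₁‖ ∧ 1 / 2 ≤ ‖γ' s‖ ∧ ‖γ' s‖ ≤ 2 ∧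
      1 + s.re ≤ L * (1 + |(γ s).re|))
    (hre : ∀ s : ℝ, 0 ≤ s → 0 ≤ (σ * (wkbK t₁ c f₁ f₂ (γ s) * γ' s)).re) :
    ∃ c₀ C₀, WkbData ρ c₀ C₀ (fun s => σ * (wkbK t₁ c f₁ f₂ (γ s) * γ' s))
      (fun s => -(wkbG f₁ f₂ (γ s) * γ' s)) := by
  obtain ⟨d, hd0, C, hC, hb⟩ := hT.exists_wkb_bounds hc hr
  have hγ : DifferentiableOn ℂ γ (halfTube ρ) := fun s hs =>
    (hd s hs).differentiableAt.differentiableWithinAt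
  have hγ' : DifferentiableOn ℂ γ' (halfTube ρ) :=
    (hγ.deriv (isOpen_halfTube ρ)).congr fun s hs => (hd s hs).deriv.symm
  have hmaps : MapsTo γ (halfTube ρ) (cutStrip η t₁) := fun s hs => (hm s hs).1
  have hk : DifferentiableOn ℂ (fun s => wkbK t₁ c f₁ f₂ (γ s)) (halfTube ρ) :=
    (hT.differentiableOn_wkbK c).comp hγ hmaps
  have hg : DifferentiableOn ℂ (fun s => wkbG f₁ f₂ (γ s)) (halfTube ρ) :=
    hT.differentiableOn_wkbG.comp hγ hmaps
  refine ⟨d * (1 / 2), C * L ^ 2 * 2, hρ, hρ', by positivity, by positivity,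
    (hk.mul hγ').const_mul σ, (hg.mul hγ').neg, fun s hs => ?_, fun s hs => ?_, hre⟩
  · obtain ⟨h1, h2, h3, h4, h5⟩ := hm s hs
    rw [norm_mul, hσ, one_mul, norm_mul]
    exact mul_le_mul (hb _ h1 h2).1 h3 (by norm_num) (norm_nonneg _)
  · obtain ⟨h1, h2, h3, h4, h5⟩ := hm s hs
    rw [norm_neg, norm_mul]
    have hs1 : 0 < 1 + s.re := by have := hs.1; linarith
    have h6 : C / (1 + |(γ s).re|) ^ 2 ≤ C * L ^ 2 * (1 / (1 + s.re) ^ 2) := by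
      rw [mul_one_div, div_le_div_iff₀ (by positivity) (by positivity)]
      have : (1 + s.re) ^ 2 ≤ (L * (1 + |(γ s).re|)) ^ 2 := by gcongr
      nlinarith
    calc ‖wkbG f₁ f₂ (γ s)‖ * ‖γ' s‖ ≤ (C * L ^ 2 * (1 / (1 + s.re) ^ 2)) * 2 :=
          mul_le_mul ((hb _ h1 h2).2.trans h6) h4 (norm_nonneg _) (by positivity)
      _ = _ := by ring

/-- On a left contour of small slope `-Y'` at height `-Y`, the sign condition for the left WKB
system reduces to a sign condition on the symbol. -/
theorem re_wkbK_mul_nonneg (hT : TurningPoint η t₁ f₁ f₂) (hc : 0 < c) {z : ℂ}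
    (hz : z ∈ cutStrip η t₁) (him : z.im ≤ 0) (hre : z.re ≤ t₁) {Y' : ℝ} (hY' : 0 ≤ Y')
    (h : 0 ≤ (-(f₁ z * f₂ z)).im + 2 * Y' * (-(f₁ z * f₂ z)).re ∨ 0 ≤ (-(f₁ z * f₂ z)).im) :
    0 ≤ (wkbK t₁ c f₁ f₂ z * (1 + Y' * I)).re := by
  set k := wkbK t₁ c f₁ f₂ z with hk
  have h1 : k.im < 0 := hT.im_wkbK_neg hc hz him hre
  have h2 : (c * k) ^ 2 = f₁ z * f₂ z := hT.wkbK_sq hc hz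
  rw [← h2] at h
  have e1 : (-(c * k) ^ 2).im = -(2 * c ^ 2 * k.re * k.im) := by
    simp [pow_two]; ring
  have e2 : (-(c * k) ^ 2).re = c ^ 2 * (k.im ^ 2 - k.re ^ 2) := by
    simp [pow_two]; ring
  have e3 : (k * (1 + Y' * I)).re = k.re - Y' * k.im := by
    simp; ring
  rw [e1, e2] at h
  rw [e3]
  have hc2 : 0 < c ^ 2 := by positivity
  have h3 : 0 ≤ (2 * c ^ 2 * -k.im) * (k.re - Y' * k.im) := by
    rcases h with h | h
    · nlinarith [mul_nonneg (mul_nonneg hY' hc2.le) (sq_nonneg k.re)]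
    · nlinarith [mul_nonneg (mul_nonneg hY' hc2.le) (sq_nonneg k.im)]
  exact nonneg_of_mul_nonneg_right h3 (by nlinarith)

end TurningPoint

/-- The values of a function on a vertical half-line through a real point. -/
theorem hasDerivAt_comp_sub_mul_I {D : ℂ → ℂ} {D' : ℂ} {t y : ℝ}
    (h : HasDerivAt D D' ((t : ℂ) - y * I)) :
    HasDerivAt (fun y : ℝ => D ((t : ℂ) - y * I)) (D' * -I) y := by
  have h1 : HasDerivAt (fun y : ℂ => (t : ℂ) - y * I) (-I) (y : ℂ) := by
    simpa using ((hasDerivAt_id (y : ℂ)).mul_const I).const_sub (t : ℂ)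
  exact (h.comp (y : ℂ) h1).comp_ofReal

theorem im_nonneg_below_real_axis {D : ℂ → ℂ} {t y : ℝ} (hy : 0 ≤ y) (h0 : (D t).im = 0)
    (hD : ∀ v : ℝ, 0 ≤ v → v ≤ y → DifferentiableAt ℂ D ((t : ℂ) - v * I) ∧
      (deriv D ((t : ℂ) - v * I)).re ≤ 0) : 0 ≤ (D ((t : ℂ) - y * I)).im := by
  have hd : ∀ v : ℝ, 0 ≤ v → v ≤ y → HasDerivAt (fun v : ℝ => (D ((t : ℂ) - v * I)).im)
      (-(deriv D ((t : ℂ) - v * I)).re) v := fun v h1 h2 => by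
    have h3 := hasDerivAt_comp_sub_mul_I (hD v h1 h2).1.hasDerivAt
    have h4 : HasDerivAt (fun v : ℝ => (D ((t : ℂ) - v * I)).im)
        ((deriv D ((t : ℂ) - v * I) * -I).im) v :=
      imCLM.hasFDerivAt.comp_hasDerivAt v h3
    refine h4.congr_deriv ?_
    simp
  have hmono : MonotoneOn (fun v : ℝ => (D ((t : ℂ) - v * I)).im) (Icc 0 y) := by
    refine monotoneOn_of_deriv_nonneg (convex_Icc 0 y)
      (fun v hv => (hd v hv.1 hv.2).continuousAt.continuousWithinAt)
      (fun v hv => ?_) (fun v hv => ?_)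
    · rw [interior_Icc] at hv
      exact (hd v hv.1.le hv.2.le).differentiableAt.differentiableWithinAt
    · rw [interior_Icc] at hv
      rw [(hd v hv.1.le hv.2.le).deriv]
      linarith [(hD v hv.1.le hv.2.le).2]
  have h5 := hmono (left_mem_Icc.2 hy) (right_mem_Icc.2 hy) hy
  simpa [h0] using h5

namespace TurningPoint

variable {η t₁ c : ℝ} {f₁ f₂ : ℂ → ℂ}

theorem _root_.sub_mul_I_mem_strip {t y : ℝ} (h1 : 0 ≤ y) (h2 : y < η) :
    (t : ℂ) - y * I ∈ strip η := by
  show |((t : ℂ) - y * I).im| < η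
  have : ((t : ℂ) - y * I).im = -y := by simp
  rw [this, abs_neg, abs_of_nonneg h1]
  exact h2

theorem exists_contour_slope (hT : TurningPoint η t₁ f₁ f₂) :
    ∃ κ > 0, ∃ y₁ > 0, 2 * y₁ < η ∧ ∀ s Y : ℝ, 0 ≤ s → 0 ≤ Y → Y ≤ y₁ →
      0 ≤ (-(f₁ (((t₁ - s : ℝ) : ℂ) - Y * I) * f₂ (((t₁ - s : ℝ) : ℂ) - Y * I))).im
        + 2 * (κ / (1 + s) ^ 2 * Y)
          * (-(f₁ (((t₁ - s : ℝ) : ℂ) - Y * I) * f₂ (((t₁ - s : ℝ) : ℂ) - Y * I))).re ∨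
      0 ≤ (-(f₁ (((t₁ - s : ℝ) : ℂ) - Y * I) * f₂ (((t₁ - s : ℝ) : ℂ) - Y * I))).im := by
  have hη := hT.eta_pos
  set D : ℂ → ℂ := fun z => -(f₁ z * f₂ z) with hD
  have hDd : ∀ z ∈ strip η, HasDerivAt D (-(deriv f₁ z * f₂ z + f₁ z * deriv f₂ z)) z :=
    fun z hz => ((hT.hasDerivAt_f₁ hz).fun_mul (hT.hasDerivAt_f₂ hz)).fun_neg
  have hDiff : DifferentiableOn ℂ D (strip η) := fun z hz =>
    (hDd z hz).differentiableAt.differentiableWithinAt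
  have hreal : ∀ x : ℝ, (D x).im = 0 := fun x => by
    simp [hD, hT.real₁ x, hT.real₂ x]
  -- the derivative of the symbol is negative near the turning point
  have hD1 : (deriv D t₁).re < 0 := by
    rw [(hDd _ (ofReal_mem_strip hη t₁)).deriv, hT.zero, zero_mul, add_zero, ← dslope_same f₁,
      hT.ofReal_re₂ t₁]
    have h1 := (abs_nonneg _).trans_lt (hT.sector₁ t₁ (ofReal_mem_strip hη t₁))
    have h2 := mul_pos h1 (hT.re₂_pos t₁)
    rw [neg_re, re_mul_ofReal]
    linarith
  obtain ⟨r, hr, hball⟩ : ∃ r > 0, ∀ z ∈ Metric.ball (t₁ : ℂ) r, z ∈ strip η ∧ (deriv D z).re < 0 := by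
    have hc : ContinuousAt (fun z => (deriv D z).re) (t₁ : ℂ) :=
      continuous_re.continuousAt.comp (((hDiff.deriv (isOpen_strip η)).continuousOn).continuousAt
        ((isOpen_strip η).mem_nhds (ofReal_mem_strip hη t₁)))
    exact Metric.eventually_nhds_iff_ball.1
      (((isOpen_strip η).eventually_mem (ofReal_mem_strip hη t₁)).and (hc.eventually (gt_mem_nhds hD1)))
  obtain ⟨C, hC, hb⟩ := hT.bound
  obtain ⟨c₂, hc₂, hl₂⟩ := hT.lower₂
  obtain ⟨c₁, hc₁, hl₁⟩ := hT.lower₁ (r / 2) (half_pos hr)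
  have hderiv : ∀ z ∈ strip η, ‖deriv D z‖ ≤ 2 * C ^ 2 / (1 + |z.re|) ^ 2 := fun z hz => by
    obtain ⟨h1, h2, h3, h4⟩ := hb z hz
    have h5 : 0 ≤ C / (1 + |z.re|) ^ 2 := by positivity
    rw [(hDd z hz).deriv, norm_neg]
    calc _ ≤ ‖deriv f₁ z‖ * ‖f₂ z‖ + ‖f₁ z‖ * ‖deriv f₂ z‖ := by
          refine (norm_add_le _ _).trans ?_
          rw [norm_mul, norm_mul]
      _ ≤ C / (1 + |z.re|) ^ 2 * C + C * (C / (1 + |z.re|) ^ 2) := by gcongr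
      _ = _ := by ring
  have hvert : ∀ t y : ℝ, 0 ≤ y → y < η →
      ‖D ((t : ℂ) - y * I) - D t‖ ≤ 2 * C ^ 2 / (1 + |t|) ^ 2 * y := fun t y h1 h2 => by
    have h3 := (convex_Icc (0 : ℝ) y).norm_image_sub_le_of_norm_hasDerivWithin_le
      (f := fun y : ℝ => D ((t : ℂ) - y * I))
      (f' := fun y : ℝ => deriv D ((t : ℂ) - y * I) * -I) (C := 2 * C ^ 2 / (1 + |t|) ^ 2)
      (fun v hv => (hasDerivAt_comp_sub_mul_I (hDd _ (sub_mul_I_mem_strip hv.1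
        (hv.2.trans_lt h2))).differentiableAt.hasDerivAt).hasDerivWithinAt)
      (fun v hv => by
        have h4 := hderiv _ (sub_mul_I_mem_strip (t := t) hv.1 (hv.2.trans_lt h2))
        have h5 : ((t : ℂ) - v * I).re = t := by simp
        rw [h5] at h4
        rw [norm_mul, norm_neg, norm_I, mul_one]
        exact h4) (left_mem_Icc.2 h1) (right_mem_Icc.2 h1)
    simpa [abs_of_nonneg h1] using h3
  set A := 2 * C ^ 2 * (1 + |t₁|) ^ 2 with hA
  have hA0 : 0 < A := by positivity
  refine ⟨A / (c₁ * c₂), by positivity,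
    min (min (η / 3) (r / 2)) (c₁ * c₂ / (2 * (2 * C ^ 2))), by positivity, ?_, ?_⟩
  · have : min (min (η / 3) (r / 2)) (c₁ * c₂ / (2 * (2 * C ^ 2))) ≤ η / 3 :=
      (min_le_left _ _).trans (min_le_left _ _)
    linarith
  intro s Y hs hY hYle
  have hY1 : Y ≤ η / 3 := hYle.trans ((min_le_left _ _).trans (min_le_left _ _))
  have hY2 : Y ≤ r / 2 := hYle.trans ((min_le_left _ _).trans (min_le_right _ _))
  have hY3 : Y ≤ c₁ * c₂ / (2 * (2 * C ^ 2)) := hYle.trans (min_le_right _ _)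
  rcases lt_or_ge s (r / 2) with hsr | hsr
  · right
    refine im_nonneg_below_real_axis (D := D) hY (hreal _) fun v hv0 hv1 => ?_
    have hmem : (((t₁ - s : ℝ) : ℂ) - v * I) ∈ Metric.ball (t₁ : ℂ) r := by
      rw [Metric.mem_ball, dist_eq_norm]
      have e : ((t₁ - s : ℝ) : ℂ) - v * I - t₁ = ((-s : ℝ) : ℂ) + ((-v : ℝ) : ℂ) * I := by
        push_cast; ring
      rw [e]
      refine (norm_add_le _ _).trans_lt ?_
      rw [norm_mul, norm_I, mul_one, norm_real, norm_real, norm_neg, norm_neg,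
        Real.norm_of_nonneg hs, Real.norm_of_nonneg hv0]
      linarith
    exact ⟨(hDd _ (hball _ hmem).1).differentiableAt, (hball _ hmem).2.le⟩
  · left
    set t := t₁ - s with ht
    have hv := hvert t Y hY (by linarith)
    have hst : 1 + s ≤ (1 + |t₁|) * (1 + |t|) := by
      have h1 : s ≤ |t₁| + |t| := by
        have : s = t₁ - t := by rw [ht]; ring
        linarith [le_abs_self t₁, neg_le_abs t]
      nlinarith [mul_nonneg (abs_nonneg t₁) (abs_nonneg t)]
    have hDt : c₁ * c₂ ≤ (D t).re := by
      have hts : t < t₁ := by rw [ht]; linarith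
      have h1 := hl₁ t (ofReal_mem_strip hη t) (by
        have e : (t : ℂ) - t₁ = ((-s : ℝ) : ℂ) := by rw [ht]; push_cast; ring
        rw [e, norm_real, norm_neg, Real.norm_of_nonneg hs]; exact hsr)
      have h2 := hl₂ t (ofReal_mem_strip hη t)
      have h3 := hT.re₁_neg hts
      have h4 := hT.re₂_pos t
      rw [hT.ofReal_re₁ t, norm_real, Real.norm_of_nonpos h3.le] at h1
      rw [hT.ofReal_re₂ t, norm_real, Real.norm_of_nonneg h4.le] at h2
      have h5 : (D t).re = -(f₁ t).re * (f₂ t).re := by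
        simp [hD, hT.real₁ t]
      rw [h5]
      exact mul_le_mul h1 h2 hc₂.le (by linarith)
    have h1t : 1 ≤ (1 + |t|) ^ 2 := by nlinarith [abs_nonneg t]
    have hre : c₁ * c₂ / 2 ≤ (D ((t : ℂ) - Y * I)).re := by
      have h1 := (abs_re_le_norm _).trans hv
      rw [sub_re, abs_le] at h1
      have h2 : 2 * C ^ 2 / (1 + |t|) ^ 2 * Y ≤ c₁ * c₂ / 2 := by
        have h3 : 2 * C ^ 2 / (1 + |t|) ^ 2 ≤ 2 * C ^ 2 := div_le_self (by positivity) h1t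
        rw [le_div_iff₀ (by positivity)] at hY3
        nlinarith
      linarith [h1.1]
    have him : -(A / (1 + s) ^ 2 * Y) ≤ (D ((t : ℂ) - Y * I)).im := by
      have h1 := (abs_im_le_norm _).trans hv
      rw [sub_im, hreal t, sub_zero, abs_le] at h1
      refine le_trans (neg_le_neg ?_) h1.1
      refine mul_le_mul_of_nonneg_right ?_ hY
      rw [div_le_div_iff₀ (by positivity) (by positivity), hA]
      have : (1 + s) ^ 2 ≤ ((1 + |t₁|) * (1 + |t|)) ^ 2 := by gcongr
      nlinarith [sq_nonneg C]
    have h6 : A / (1 + s) ^ 2 * Y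
        ≤ 2 * (A / (c₁ * c₂) / (1 + s) ^ 2 * Y) * (D ((t : ℂ) - Y * I)).re := by
      have h7 : 0 ≤ 2 * (A / (c₁ * c₂) / (1 + s) ^ 2 * Y) := by positivity
      refine le_trans (le_of_eq ?_) (mul_le_mul_of_nonneg_left hre h7)
      field_simp
    linarith

theorem exists_contours (hT : TurningPoint η t₁ f₁ f₂) (hc : 0 < c) :
    ∃ y₀ > 0, y₀ < η ∧ ∃ (x₀ : ℂ) (γ γ' : ℂ → ℂ) (ρ : ℝ), γ 0 = x₀ ∧
      (∀ s : ℝ, 0 ≤ s → (γ s).re = t₁ - s ∧ -y₀ ≤ (γ s).im ∧ (γ s).im < 0) ∧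
      (∀ s ∈ halfTube ρ, HasDerivAt γ (γ' s) s) ∧
      (∃ c₀ C₀, WkbData ρ c₀ C₀ (fun s => wkbK t₁ c f₁ f₂ (x₀ + s))
        (fun s => -wkbG f₁ f₂ (x₀ + s))) ∧
      ∃ c₀ C₀, WkbData ρ c₀ C₀ (fun s => -(wkbK t₁ c f₁ f₂ (γ s) * γ' s))
        (fun s => -(wkbG f₁ f₂ (γ s) * γ' s)) := by
  obtain ⟨κ, hκ, y₁, hy₁, hy₁η, hsign⟩ := hT.exists_contour_slope
  set y₀ := min y₁ (min 1 (1 / (8 * κ))) with hy₀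
  have hy₀0 : 0 < y₀ := by positivity
  have hy₀1 : y₀ ≤ y₁ := min_le_left _ _
  have hy₀2 : y₀ ≤ 1 := (min_le_right _ _).trans (min_le_left _ _)
  have hy₀3 : 4 * κ * y₀ ≤ 1 / 2 := by
    have : y₀ ≤ 1 / (8 * κ) := (min_le_right _ _).trans (min_le_right _ _)
    rw [le_div_iff₀ (by positivity)] at this
    linarith
  set ρ := y₀ * Real.exp (-(2 * κ)) / 4 with hρ
  have hexp : Real.exp (-(2 * κ)) ≤ 1 := Real.exp_le_one_iff.2 (by linarith)
  have hρ0 : 0 < ρ := by positivity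
  have hρy : ρ ≤ y₀ / 4 := by rw [hρ]; nlinarith
  have hρ' : ρ ≤ 1 / 2 := by linarith
  have hκρ : 4 * κ * ρ ≤ 1 := by nlinarith
  set Y := contourHeight y₀ κ with hY
  have hYb := fun {s : ℂ} (hs : s ∈ halfTube ρ) => contourHeight_bounds hy₀0 hκ hρ' hκρ hs
  have hYr : ∀ s : ℝ, 0 ≤ s → 0 < y₀ * Real.exp (-(κ / (1 + s))) ∧
      y₀ * Real.exp (-(κ / (1 + s))) ≤ y₀ := fun s hs => by
    refine ⟨by positivity, ?_⟩
    have : Real.exp (-(κ / (1 + s))) ≤ 1 := Real.exp_le_one_iff.2 (by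
      rw [neg_nonpos]; positivity)
    nlinarith
  set γ : ℂ → ℂ := fun s => t₁ - s - Y s * I with hγ
  set γ' : ℂ → ℂ := fun s => -1 - κ / (1 + s) ^ 2 * Y s * I with hγ'
  have hγr : ∀ s : ℝ, γ s = ((t₁ - s : ℝ) : ℂ)
      - ((y₀ * Real.exp (-(κ / (1 + s))) : ℝ) : ℂ) * I := fun s => by
    simp only [hγ, hY]
    rw [contourHeight_ofReal]
    push_cast
    ring
  have hγre : ∀ s : ℝ, (γ s).re = t₁ - s ∧ (γ s).im = -(y₀ * Real.exp (-(κ / (1 + s)))) :=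
    fun s => by
      rw [hγr s]
      constructor
      · rw [sub_re, ofReal_re, re_ofReal_mul, I_re, mul_zero, sub_zero]
      · rw [sub_im, ofReal_im, im_ofReal_mul, I_im, mul_one, zero_sub]
  have hd : ∀ s ∈ halfTube ρ, HasDerivAt γ (γ' s) s := fun s hs => by
    have hs0 : 1 + s ≠ 0 := fun h => by
      have h1 := congrArg re h
      have := hs.1
      simp at h1
      linarith
    exact ((hasDerivAt_id s).const_sub (t₁ : ℂ)).sub
      ((hasDerivAt_contourHeight y₀ κ hs0).mul_const I)
  have hreal : ∀ s : ℝ, 0 ≤ s → (γ s).re = t₁ - s ∧ -y₀ ≤ (γ s).im ∧ (γ s).im < 0 := fun s hs => by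
    obtain ⟨h1, h2⟩ := hγre s
    rw [h1, h2]
    exact ⟨rfl, neg_le_neg (hYr s hs).2, neg_neg_iff_pos.2 (hYr s hs).1⟩
  set x₀ := γ 0 with hx₀
  have hx₀' := hγre 0
  rw [ofReal_zero, ← hx₀, add_zero, div_one, sub_zero] at hx₀'
  have hx₀im : 2 * ρ ≤ y₀ * Real.exp (-κ) := by
    have : Real.exp (-(2 * κ)) ≤ Real.exp (-κ) := Real.exp_le_exp.2 (by linarith)
    rw [hρ]
    nlinarith [Real.exp_pos (-κ)]
  have hx₀im' : y₀ * Real.exp (-κ) ≤ y₀ := by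
    have : Real.exp (-κ) ≤ 1 := Real.exp_le_one_iff.2 (by linarith)
    nlinarith
  refine ⟨y₀, hy₀0, by linarith, x₀, γ, γ', ρ, rfl, hreal, hd, ?_, ?_⟩
  · have := hT.wkbData_of_contour hc (r := ρ) (L := 1 + |t₁|) (γ := fun s => x₀ + s)
      (γ' := fun _ => 1) (σ := 1) norm_one hρ0 hρ' hρ0 (by positivity)
      (fun s _ => (hasDerivAt_id s).const_add x₀) (fun s hs => ?_) (fun s hs => ?_)
    · simpa only [one_mul, mul_one] using this
    · have him := abs_lt.1 hs.2
      have h1 : (x₀ + s).im ≤ -ρ := by rw [add_im, hx₀'.2]; linarith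
      have h2 : -η < (x₀ + s).im := by rw [add_im, hx₀'.2]; linarith
      refine ⟨mem_cutStrip_of_im_neg (abs_lt.2 ⟨h2, by linarith [hT.eta_pos]⟩) (by linarith),
        ?_, by norm_num, by norm_num, ?_⟩
      · refine le_trans ?_ (abs_im_le_norm _)
        rw [sub_im, ofReal_im, sub_zero, le_abs]
        right; linarith
      · rw [add_re, hx₀'.1]
        have h3 : s.re ≤ |t₁ + s.re| + |t₁| := by
          have := le_abs_self (t₁ + s.re); have := neg_le_abs t₁; linarith
        nlinarith [mul_nonneg (abs_nonneg t₁) (abs_nonneg (t₁ + s.re))]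
    · have h1 : (x₀ + s).im < 0 := by rw [add_im, hx₀'.2, ofReal_im]; linarith
      have h2 : -η < (x₀ + s).im := by rw [add_im, hx₀'.2, ofReal_im]; linarith
      have h3 := hT.re_wkbK_pos hc (z := x₀ + s)
        (mem_cutStrip_of_im_neg (abs_lt.2 ⟨h2, by linarith [hT.eta_pos]⟩) h1) h1.le
        (by rw [add_re, hx₀'.1, ofReal_re]; linarith)
      simpa only [one_mul, mul_one] using h3.le
  · have := hT.wkbData_of_contour hc (r := ρ) (L := 1 + |t₁| + y₀) (γ := γ)
      (γ' := γ') (σ := -1) (by simp) hρ0 hρ' hρ0 (by positivity) hd (fun s hs => ?_)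
      (fun s hs => ?_)
    · simpa only [neg_one_mul] using this
    · obtain ⟨h1, h2, h3⟩ := hYb hs
      have him := abs_lt.1 hs.2
      have hYre := abs_le.1 ((abs_re_le_norm _).trans h2)
      have hYim := abs_le.1 ((abs_im_le_norm _).trans h2)
      have e1 : (γ s).im = -s.im - (Y s).re := by simp [hγ]
      have e2 : (γ s).re = t₁ - s.re + (Y s).im := by simp [hγ]
      have h4 : (γ s).im ≤ -ρ := by rw [e1]; linarith
      have h5 : -η < (γ s).im := by rw [e1]; linarith
      refine ⟨mem_cutStrip_of_im_neg (abs_lt.2 ⟨h5, by linarith [hT.eta_pos]⟩) (by linarith),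
        ?_, ?_, ?_, ?_⟩
      · refine le_trans ?_ (abs_im_le_norm _)
        rw [sub_im, ofReal_im, sub_zero, le_abs]
        right; linarith
      · have := norm_sub_norm_le (-1 : ℂ) (κ / (1 + s) ^ 2 * Y s * I)
        rw [norm_neg, norm_one, norm_mul, norm_I, mul_one] at this
        show _ ≤ ‖-1 - κ / (1 + s) ^ 2 * Y s * I‖
        linarith
      · have := norm_sub_le (-1 : ℂ) (κ / (1 + s) ^ 2 * Y s * I)
        rw [norm_neg, norm_one, norm_mul, norm_I, mul_one] at this
        show ‖-1 - κ / (1 + s) ^ 2 * Y s * I‖ ≤ _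
        linarith
      · have h6 : s.re ≤ |(γ s).re| + |t₁| + y₀ := by
          have := neg_le_abs (γ s).re; have := le_abs_self t₁
          linarith
        nlinarith [mul_nonneg (add_nonneg (abs_nonneg t₁) hy₀0.le) (abs_nonneg (γ s).re)]
    · obtain ⟨h1, h2, h3⟩ := hreal s hs
      have h5 : -η < (γ s).im := by linarith
      have h6 : (γ s).im < η := by linarith
      have h4 := hT.re_wkbK_mul_nonneg hc (z := γ s)
        (Y' := κ / (1 + s) ^ 2 * (y₀ * Real.exp (-(κ / (1 + s)))))
        (mem_cutStrip_of_im_neg (abs_lt.2 ⟨h5, h6⟩) h3)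
        h3.le (by linarith) (by have := (hYr s hs).1; positivity)
        (by
          rw [hγr s]
          exact hsign s _ hs (hYr s hs).1.le ((hYr s hs).2.trans hy₀1))
      have e : -1 * (wkbK t₁ c f₁ f₂ (γ s) * γ' s) = wkbK t₁ c f₁ f₂ (γ s)
          * (1 + ((κ / (1 + s) ^ 2 * (y₀ * Real.exp (-(κ / (1 + s)))) : ℝ) : ℂ) * I) := by
        simp only [hγ', hY]
        rw [contourHeight_ofReal]
        push_cast
        ring
      rw [e]
      exact h4

end TurningPoint

/-- Gronwall bound for the system `p' = a q`, `q' = b q + a p` on a vertical segment. -/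
theorem norm_sub_one_le_of_vertical {p q a b : ℂ → ℂ} {x y₀ M A : ℝ} (hM : 0 ≤ M) (hA : A ≤ 1)
    (h : ∀ y ∈ Icc 0 y₀, HasDerivAt p (a ((x : ℂ) - y * I) * q ((x : ℂ) - y * I)) ((x : ℂ) - y * I) ∧
      HasDerivAt q (b ((x : ℂ) - y * I) * q ((x : ℂ) - y * I) + a ((x : ℂ) - y * I) *
        p ((x : ℂ) - y * I)) ((x : ℂ) - y * I) ∧
      ‖a ((x : ℂ) - y * I)‖ ≤ A ∧ ‖b ((x : ℂ) - y * I)‖ ≤ M) {y : ℝ} (hy : y ∈ Icc 0 y₀) :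
    ‖(p ((x : ℂ) - y * I) - 1, q ((x : ℂ) - y * I))‖
      ≤ (‖(p x - 1, q x)‖ + A) * Real.exp ((M + 1) * y₀) := by
  have hA0 : 0 ≤ A := (norm_nonneg _).trans (h y hy).2.2.1
  set F : ℝ → ℂ × ℂ := fun y => (p ((x : ℂ) - y * I) - 1, q ((x : ℂ) - y * I)) with hF
  set F' : ℝ → ℂ × ℂ := fun y => (a ((x : ℂ) - y * I) * q ((x : ℂ) - y * I) * -I,
    (b ((x : ℂ) - y * I) * q ((x : ℂ) - y * I) + a ((x : ℂ) - y * I) *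
        p ((x : ℂ) - y * I)) * -I) with hF'
  have hd : ∀ y ∈ Icc 0 y₀, HasDerivAt F (F' y) y := fun y hy =>
    ((hasDerivAt_comp_sub_mul_I (h y hy).1).sub_const 1).prodMk
      (hasDerivAt_comp_sub_mul_I (h y hy).2.1)
  have hF0 : F 0 = (p x - 1, q x) := by simp [hF]
  have hg := norm_le_gronwallBound_of_norm_deriv_right_le (f := F) (f' := F') (δ := ‖F 0‖)
    (K := M + 1) (ε := A) (a := 0) (b := y₀)
    (fun v hv => (hd v hv).continuousAt.continuousWithinAt)
    (fun v hv => (hd v (Ico_subset_Icc_self hv)).hasDerivWithinAt) le_rfl (fun v hv => by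
      obtain ⟨-, -, h3, h4⟩ := h v (Ico_subset_Icc_self hv)
      set z : ℂ := (x : ℂ) - v * I
      have h5 : ‖p z - 1‖ ≤ ‖F v‖ := norm_fst_le (F v)
      have h6 : ‖q z‖ ≤ ‖F v‖ := norm_snd_le (F v)
      have h0 := norm_nonneg (F v)
      refine norm_prod_le_iff.2 ⟨?_, ?_⟩
      · show ‖a z * q z * -I‖ ≤ _
        rw [norm_mul, norm_neg, norm_I, mul_one, norm_mul]
        have := mul_le_mul h3 h6 (norm_nonneg _) hA0
        nlinarith
      · show ‖(b z * q z + a z * p z) * -I‖ ≤ _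
        rw [norm_mul, norm_neg, norm_I, mul_one]
        have e : b z * q z + a z * p z = b z * q z + a z * (p z - 1) + a z := by ring
        rw [e]
        refine (norm_add₃_le).trans ?_
        rw [norm_mul, norm_mul]
        have h7 := mul_le_mul h4 h6 (norm_nonneg _) hM
        have h8 := mul_le_mul h3 h5 (norm_nonneg _) hA0
        nlinarith) y hy
  rw [gronwallBound_of_K_ne_0 (by positivity), sub_zero] at hg
  rw [← hF0]
  refine hg.trans ?_
  have h1 : Real.exp ((M + 1) * y) ≤ Real.exp ((M + 1) * y₀) :=
    Real.exp_le_exp.2 (mul_le_mul_of_nonneg_left hy.2 (by positivity))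
  have h2 : A / (M + 1) ≤ A := div_le_self hA0 (by linarith)
  have h3 : 1 ≤ Real.exp ((M + 1) * y) :=
    Real.one_le_exp (mul_nonneg (by positivity) hy.1)
  have h4 : 0 ≤ A / (M + 1) := by positivity
  calc _ ≤ ‖F 0‖ * Real.exp ((M + 1) * y₀) + A * Real.exp ((M + 1) * y₀) :=
        add_le_add (mul_le_mul_of_nonneg_left h1 (norm_nonneg _))
          (mul_le_mul h2 (by linarith) (by linarith) hA0)
    _ = _ := by ring

theorem tendsto_of_vertical {p q a b : ℂ → ℂ} {l : Filter ℝ} {γ : ℝ → ℂ} {y₀ M : ℝ} {A : ℝ → ℝ}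
    (hM : 0 ≤ M) (h : ∀ᶠ s in l, -y₀ ≤ (γ s).im ∧ (γ s).im ≤ 0 ∧ ∀ y ∈ Icc 0 y₀,
      HasDerivAt p (a (((γ s).re : ℂ) - y * I) * q (((γ s).re : ℂ) - y * I))
        (((γ s).re : ℂ) - y * I) ∧
      HasDerivAt q (b (((γ s).re : ℂ) - y * I) * q (((γ s).re : ℂ) - y * I)
        + a (((γ s).re : ℂ) - y * I) * p (((γ s).re : ℂ) - y * I)) (((γ s).re : ℂ) - y * I) ∧
      ‖a (((γ s).re : ℂ) - y * I)‖ ≤ A s ∧ ‖b (((γ s).re : ℂ) - y * I)‖ ≤ M)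
    (hA : Tendsto A l (𝓝 0)) (hp : Tendsto (fun s => p ((γ s).re : ℂ)) l (𝓝 1))
    (hq : Tendsto (fun s => q ((γ s).re : ℂ)) l (𝓝 0)) :
    Tendsto (fun s => p (γ s)) l (𝓝 1) ∧ Tendsto (fun s => q (γ s)) l (𝓝 0) := by
  have h0 : Tendsto (fun s => (‖(p ((γ s).re : ℂ) - 1, q ((γ s).re : ℂ))‖ + A s)
      * Real.exp ((M + 1) * y₀)) l (𝓝 0) := by
    have h1 : Tendsto (fun s => (p ((γ s).re : ℂ) - 1, q ((γ s).re : ℂ))) l (𝓝 (1 - 1, 0)) :=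
      (hp.sub_const 1).prodMk_nhds hq
    have h2 := (h1.norm.add hA).mul_const (Real.exp ((M + 1) * y₀))
    simpa using h2
  have hle : ∀ᶠ s in l, ‖(p (γ s) - 1, q (γ s))‖
      ≤ (‖(p ((γ s).re : ℂ) - 1, q ((γ s).re : ℂ))‖ + A s) * Real.exp ((M + 1) * y₀) := by
    filter_upwards [h, hA.eventually (ge_mem_nhds zero_lt_one)] with s hs hA1
    have hy : -(γ s).im ∈ Icc 0 y₀ := ⟨by linarith [hs.2.1], by linarith [hs.1]⟩
    have h3 := norm_sub_one_le_of_vertical hM hA1 hs.2.2 hy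
    have e : ((γ s).re : ℂ) - ((-(γ s).im : ℝ) : ℂ) * I = γ s := by
      push_cast
      rw [neg_mul, sub_neg_eq_add, re_add_im]
    rwa [e] at h3
  constructor
  · have h4 : Tendsto (fun s => p (γ s) - 1) l (𝓝 0) :=
      squeeze_zero_norm' (hle.mono fun s hs =>
        (norm_fst_le (p (γ s) - 1, q (γ s))).trans hs) h0
    simpa using h4.add_const 1
  · exact squeeze_zero_norm' (hle.mono fun s hs =>
        (norm_snd_le (p (γ s) - 1, q (γ s))).trans hs) h0

/-- The diagonalised first-order system at a point. -/
def WkbSystem (t₁ c h : ℝ) (f₁ f₂ P Q : ℂ → ℂ) (z : ℂ) : Prop :=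
  HasDerivAt P (-(wkbK t₁ c f₁ f₂ z / h) * P z - wkbG f₁ f₂ z * Q z) z ∧
  HasDerivAt Q (wkbK t₁ c f₁ f₂ z / h * Q z - wkbG f₁ f₂ z * P z) z

namespace TurningPoint

variable {η t₁ c h : ℝ} {f₁ f₂ P Q ζ : ℂ → ℂ}

theorem sub_mul_I_mem_cutStrip {x y : ℝ} (hx : x ≠ t₁) (h1 : 0 ≤ y) (h2 : y < η) :
    (x : ℂ) - y * I ∈ cutStrip η t₁ := by
  rcases h1.eq_or_lt with rfl | h1
  · simpa using ofReal_mem_cutStrip h2 hx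
  · refine mem_cutStrip_of_im_neg (sub_mul_I_mem_strip h1.le h2) ?_
    simpa using h1

/-- Removing the phase of one component from a solution of the diagonalised system. -/
theorem _root_.WkbSystem.hasDerivAt_right {z : ℂ} (hP : WkbSystem t₁ c h f₁ f₂ P Q z)
    (hζ : HasDerivAt ζ (wkbK t₁ c f₁ f₂ z) z) :
    HasDerivAt (fun z => exp (ζ z / h) * P z) (-wkbG f₁ f₂ z * (exp (ζ z / h) * Q z)) z ∧
    HasDerivAt (fun z => exp (ζ z / h) * Q z) (2 * wkbK t₁ c f₁ f₂ z / h * (exp (ζ z / h) * Q z)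
      + -wkbG f₁ f₂ z * (exp (ζ z / h) * P z)) z := by
  have h1 := (hζ.div_const (h : ℂ)).cexp
  exact ⟨(h1.mul hP.1).congr_deriv (by ring), (h1.mul hP.2).congr_deriv (by ring)⟩

theorem _root_.WkbSystem.hasDerivAt_left {z : ℂ} (hP : WkbSystem t₁ c h f₁ f₂ P Q z)
    (hζ : HasDerivAt ζ (wkbK t₁ c f₁ f₂ z) z) :
    HasDerivAt (fun z => exp (-ζ z / h) * Q z) (-wkbG f₁ f₂ z * (exp (-ζ z / h) * P z)) z ∧
    HasDerivAt (fun z => exp (-ζ z / h) * P z)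
      (-(2 * wkbK t₁ c f₁ f₂ z / h) * (exp (-ζ z / h) * P z)
      + -wkbG f₁ f₂ z * (exp (-ζ z / h) * Q z)) z := by
  have h1 := (hζ.fun_neg.div_const (h : ℂ)).cexp
  exact ⟨(h1.mul hP.2).congr_deriv (by ring), (h1.mul hP.1).congr_deriv (by ring)⟩

theorem tendsto_along (hT : TurningPoint η t₁ f₁ f₂) (hc : 0 < c) {p q b : ℂ → ℂ} {M y₀ : ℝ}
    (hM : 0 ≤ M) (hy₀ : y₀ < η)
    (hpq : ∀ z ∈ cutStrip η t₁, HasDerivAt p (-wkbG f₁ f₂ z * q z) z ∧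
      HasDerivAt q (b z * q z + -wkbG f₁ f₂ z * p z) z ∧ ‖b z‖ ≤ M) {γ : ℝ → ℂ}
    (hγ : ∀ s : ℝ, 0 ≤ s → -y₀ ≤ (γ s).im ∧ (γ s).im ≤ 0)
    (hre : Tendsto (fun s => |(γ s).re|) atTop atTop)
    (hp : Tendsto (fun s => p ((γ s).re : ℂ)) atTop (𝓝 1))
    (hq : Tendsto (fun s => q ((γ s).re : ℂ)) atTop (𝓝 0)) :
    Tendsto (fun s => p (γ s)) atTop (𝓝 1) ∧ Tendsto (fun s => q (γ s)) atTop (𝓝 0) := by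
  obtain ⟨d, hd, C, hC, hb⟩ := hT.exists_wkb_bounds hc zero_lt_one
  refine tendsto_of_vertical (y₀ := y₀) (a := fun z => -wkbG f₁ f₂ z) (b := b)
    (A := fun s => C / (1 + |(γ s).re|) ^ 2) hM ?_ ?_ hp hq
  · filter_upwards [eventually_ge_atTop 0, hre.eventually_ge_atTop (|t₁| + 1)] with s hs hs1
    have hs2 : 1 ≤ |(γ s).re - t₁| := by
      have := abs_sub_abs_le_abs_sub (γ s).re t₁; linarith
    have hne : (γ s).re ≠ t₁ := fun h0 => by
      rw [h0, sub_self, abs_zero] at hs2; linarith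
    refine ⟨(hγ s hs).1, (hγ s hs).2, fun y hy => ?_⟩
    have hz := sub_mul_I_mem_cutStrip (η := η) hne hy.1 (hy.2.trans_lt hy₀)
    obtain ⟨h1, h2, h3⟩ := hpq _ hz
    have e : (((γ s).re : ℂ) - y * I).re = (γ s).re := by simp
    have h4 := (hb _ hz (hs2.trans (by
      refine le_trans (le_of_eq ?_) (abs_re_le_norm _)
      rw [sub_re, e, ofReal_re]))).2
    rw [e] at h4
    exact ⟨h1, h2, by rw [norm_neg]; exact h4, h3⟩
  · have h1 : Tendsto (fun s => (1 + |(γ s).re|) ^ 2) atTop atTop :=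
      (tendsto_pow_atTop two_ne_zero).comp (tendsto_atTop_add_const_left _ 1 hre)
    exact h1.const_div_atTop C

theorem exists_gevrey_wronskian (hT : TurningPoint η t₁ f₁ f₂) (hc : 0 < c) {ζR ζL : ℂ → ℂ}
    (hζ : ∀ z ∈ cutStrip η t₁, HasDerivAt ζR (wkbK t₁ c f₁ f₂ z) z ∧
      HasDerivAt ζL (wkbK t₁ c f₁ f₂ z) z) :
    ∃ x₀ ∈ cutStrip η t₁, ∃ a : ℕ → ℂ, a 0 = 1 ∧ ∀ PR QR PL QL : ℝ → ℂ → ℂ,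
      (∀ h, 0 < h → h < 1 →
        (∀ z ∈ cutStrip η t₁, WkbSystem t₁ c h f₁ f₂ (PR h) (QR h) z ∧
          WkbSystem t₁ c h f₁ f₂ (PL h) (QL h) z) ∧
        Tendsto (fun x : ℝ => exp (ζR x / h) * PR h x) atTop (𝓝 1) ∧
        Tendsto (fun x : ℝ => exp (ζR x / h) * QR h x) atTop (𝓝 0) ∧
        Tendsto (fun x : ℝ => exp (-ζL x / h) * QL h x) atBot (𝓝 1) ∧
        Tendsto (fun x : ℝ => exp (-ζL x / h) * PL h x) atBot (𝓝 0)) →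
      HasGevreyExpansion 1 (fun h : ℝ => exp (ζR x₀ / h) * PR h x₀ * (exp (-ζL x₀ / h) * QL h x₀)
        - exp (ζR x₀ / h) * QR h x₀ * (exp (-ζL x₀ / h) * PL h x₀)) a := by
  obtain ⟨y₀, hy₀, hy₀η, x₀, γ, γ', ρ, hγ0, hγ, hγd, ⟨_, _, hDR⟩, ⟨_, _, hDL⟩⟩ :=
    hT.exists_contours hc
  obtain ⟨aR, bR, haR, hbR, hR⟩ := hDR.exists_gevrey
  obtain ⟨aL, bL, haL, hbL, hL⟩ := hDL.exists_gevrey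
  obtain ⟨M, hM⟩ := hT.exists_norm_wkbK_le hc
  have hmem : ∀ z : ℂ, -y₀ ≤ z.im → z.im < 0 → z ∈ cutStrip η t₁ := fun z h1 h2 => by
    have h3 : -η < z.im := by linarith
    have h4 : z.im < η := by linarith
    exact mem_cutStrip_of_im_neg (abs_lt.2 ⟨h3, h4⟩) h2
  have hx₀ := hγ 0 le_rfl
  rw [ofReal_zero, hγ0, sub_zero] at hx₀
  have hx₀mem := hmem x₀ hx₀.2.1 hx₀.2.2
  have hM0 : 0 ≤ M := (norm_nonneg _).trans (hM x₀ hx₀mem)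
  refine ⟨x₀, hx₀mem, fun n => ∑ j ∈ Finset.range (n + 1), aR j * aL (n - j)
    - ∑ j ∈ Finset.range (n + 1), bR j * bL (n - j), by simp [haR, haL, hbR],
    fun PR QR PL QL hS => ?_⟩
  have hR' := hR (fun h s => exp (ζR (x₀ + s) / h) * PR h (x₀ + s))
    (fun h s => exp (ζR (x₀ + s) / h) * QR h (x₀ + s)) fun h h0 h1 => by
      obtain ⟨hW, hp, hq, -, -⟩ := hS h h0 h1
      have hdiff := fun z hz => (hW z hz).1.hasDerivAt_right (hζ z hz).1
      have hmemR : ∀ s : ℝ, x₀ + s ∈ cutStrip η t₁ := fun s =>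
        hmem _ (by simpa using hx₀.2.1) (by simpa using hx₀.2.2)
      have hshift : ∀ s : ℝ, HasDerivAt (fun z : ℂ => x₀ + z) 1 (s : ℂ) := fun s =>
        (hasDerivAt_id _).const_add x₀
      have htend : Tendsto (fun s : ℝ => (x₀ + s).re) atTop atTop := by
        simp only [add_re, ofReal_re]
        exact tendsto_atTop_add_const_left _ _ tendsto_id
      have hlim := hT.tendsto_along hc (M := 2 * M / h)
        (p := fun z => exp (ζR z / h) * PR h z) (q := fun z => exp (ζR z / h) * QR h z)
        (b := fun z => 2 * wkbK t₁ c f₁ f₂ z / h) (by positivity) hy₀η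
        (fun z hz => ⟨(hdiff z hz).1, (hdiff z hz).2, by
          rw [norm_div, norm_mul, norm_real, Real.norm_of_nonneg h0.le, Complex.norm_ofNat]
          have := hM z hz
          gcongr⟩) (γ := fun s : ℝ => x₀ + s)
        (fun s hs => by
          simp only [add_im, ofReal_im, add_zero]
          exact ⟨hx₀.2.1, hx₀.2.2.le⟩) (tendsto_abs_atTop_atTop.comp htend)
        (hp.comp htend) (hq.comp htend)
      refine ⟨fun s hs => ?_, fun s hs => ?_, hlim.1, hlim.2⟩
      · have := ((hdiff _ (hmemR s)).1.comp (s : ℂ) (hshift s)).comp_ofReal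
        rw [mul_one] at this
        exact this
      · have := ((hdiff _ (hmemR s)).2.comp (s : ℂ) (hshift s)).comp_ofReal
        rw [mul_one] at this
        exact this
  have hL' := hL (fun h s => exp (-ζL (γ s) / h) * QL h (γ s))
    (fun h s => exp (-ζL (γ s) / h) * PL h (γ s)) fun h h0 h1 => by
      obtain ⟨hW, -, -, hp, hq⟩ := hS h h0 h1
      have hdiff := fun z hz => (hW z hz).2.hasDerivAt_left (hζ z hz).2
      have hmemL : ∀ s : ℝ, 0 ≤ s → γ s ∈ cutStrip η t₁ := fun s hs =>
        hmem _ (hγ s hs).2.1 (hγ s hs).2.2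
      have hγs : ∀ s : ℝ, 0 ≤ s → HasDerivAt γ (γ' s) (s : ℂ) := fun s hs =>
        hγd s (ofReal_mem_halfTube hDL.rho_pos hs)
      have htend : Tendsto (fun s : ℝ => (γ s).re) atTop atBot := by
        have h2 : Tendsto (fun s : ℝ => t₁ - s) atTop atBot :=
          tendsto_atBot_add_const_left _ _ tendsto_neg_atTop_atBot
        refine h2.congr' ?_
        filter_upwards [eventually_ge_atTop 0] with s hs using (hγ s hs).1.symm
      have hlim := hT.tendsto_along hc (M := 2 * M / h)
        (p := fun z => exp (-ζL z / h) * QL h z) (q := fun z => exp (-ζL z / h) * PL h z)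
        (b := fun z => -(2 * wkbK t₁ c f₁ f₂ z / h)) (by positivity) hy₀η
        (fun z hz => ⟨(hdiff z hz).1, (hdiff z hz).2, by
          rw [norm_neg, norm_div, norm_mul, norm_real, Real.norm_of_nonneg h0.le,
            Complex.norm_ofNat]
          have := hM z hz
          gcongr⟩) (γ := fun s : ℝ => γ s)
        (fun s hs => ⟨(hγ s hs).2.1, (hγ s hs).2.2.le⟩) (tendsto_abs_atBot_atTop.comp htend)
        (hp.comp htend) (hq.comp htend)
      refine ⟨fun s hs => ?_, fun s hs => ?_, hlim.1, hlim.2⟩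
      · have := ((hdiff _ (hmemL s hs)).1.comp (s : ℂ) (hγs s hs)).comp_ofReal
        exact this.congr_deriv (by ring)
      · have := ((hdiff _ (hmemL s hs)).2.comp (s : ℂ) (hγs s hs)).comp_ofReal
        exact this.congr_deriv (by ring)
  simp only [ofReal_zero, add_zero, hγ0] at hR' hL'
  exact (HasGevreyExpansion.mul zero_lt_one hR'.1 hL'.1).sub
    (HasGevreyExpansion.mul zero_lt_one hR'.2 hL'.2)

end TurningPoint

/-- Solutions on the real line of `u₁' = (i / hc) f₂ u₂`, `u₂' = -(i / hc) f₁ u₁`. -/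
def IsSystemSolution (h c : ℝ) (f₁ f₂ : ℂ → ℂ) (u : ℝ → ℂ × ℂ) : Prop :=
  ∀ x : ℝ, HasDerivAt (fun x => (u x).1) (I / (h * c) * f₂ x * (u x).2) x ∧
    HasDerivAt (fun x => (u x).2) (-(I / (h * c)) * f₁ x * (u x).1) x

/-- The first component of a solution in the basis diagonalising the leading part of the system. -/
noncomputable def wkbP (t₁ : ℝ) (f₁ f₂ U W : ℂ → ℂ) (z : ℂ) : ℂ :=
  (I * (U z / wkbT t₁ f₁ f₂ z) + wkbT t₁ f₁ f₂ z * W z) / 2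

/-- The second component of a solution in the basis of `wkbP`. -/
noncomputable def wkbQ (t₁ : ℝ) (f₁ f₂ U W : ℂ → ℂ) (z : ℂ) : ℂ :=
  (I * (U z / wkbT t₁ f₁ f₂ z) - wkbT t₁ f₁ f₂ z * W z) / 2

theorem wkbP_mul_wkbQ_sub (t₁ : ℝ) (f₁ f₂ U W U' W' : ℂ → ℂ) (z : ℂ) :
    2 * I * (wkbP t₁ f₁ f₂ U W z * wkbQ t₁ f₁ f₂ U' W' z
      - wkbQ t₁ f₁ f₂ U W z * wkbP t₁ f₁ f₂ U' W' z) = U z * W' z - W z * U' z := by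
  have h := TurningPoint.wkbT_ne (t₁ := t₁) (f₁ := f₁) (f₂ := f₂) z
  rw [wkbP, wkbP, wkbQ, wkbQ]
  field_simp
  linear_combination 2 * wkbT t₁ f₁ f₂ z ^ 2 * (-U z * W' z + W z * U' z) * I_sq

theorem wronskian_eq {η c h : ℝ} {f₁ f₂ U W U' W' : ℂ → ℂ}
    (hd : ∀ z ∈ strip η,
      HasDerivAt U (I / (h * c) * f₂ z * W z) z ∧ HasDerivAt W (-(I / (h * c)) * f₁ z * U z) z)
    (hd' : ∀ z ∈ strip η,
      HasDerivAt U' (I / (h * c) * f₂ z * W' z) z ∧ HasDerivAt W' (-(I / (h * c)) * f₁ z * U' z) z)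
    {z w : ℂ} (hz : z ∈ strip η) (hw : w ∈ strip η) :
    U z * W' z - W z * U' z = U w * W' w - W w * U' w := by
  have hD : ∀ z ∈ strip η, HasDerivAt (fun z => U z * W' z - W z * U' z) 0 z := fun z hz => by
    refine (((hd z hz).1.fun_mul (hd' z hz).2).fun_sub
      ((hd z hz).2.fun_mul (hd' z hz).1)).congr_deriv ?_
    ring
  exact (convex_strip η).is_const_of_fderivWithin_eq_zero (𝕜 := ℂ)
    (fun z hz => (hD z hz).differentiableAt.differentiableWithinAt)
    (fun z hz => by
      rw [fderivWithin_of_isOpen (isOpen_strip η) hz]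
      have := (hD z hz).hasFDerivAt.fderiv
      rw [this]
      ext; simp) hz hw

namespace TurningPoint

variable {η t₁ c h : ℝ} {f₁ f₂ : ℂ → ℂ}

theorem wkbSystem (hT : TurningPoint η t₁ f₁ f₂) (hc : 0 < c) {U W : ℂ → ℂ} {z : ℂ}
    (hz : z ∈ cutStrip η t₁) (hU : HasDerivAt U (I / (h * c) * f₂ z * W z) z)
    (hW : HasDerivAt W (-(I / (h * c)) * f₁ z * U z) z) :
    WkbSystem t₁ c h f₁ f₂ (wkbP t₁ f₁ f₂ U W) (wkbQ t₁ f₁ f₂ U W) z := by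
  have hc' : (c : ℂ) ≠ 0 := ofReal_ne_zero.2 hc.ne'
  have hne := wkbT_ne (t₁ := t₁) (f₁ := f₁) (f₂ := f₂) z
  obtain ⟨e1, e2⟩ := hT.wkbK_mul_wkbT_sq hc hz
  have hT' := hT.hasDerivAt_wkbT hz
  set T := wkbT t₁ f₁ f₂ z with hTz
  set k := wkbK t₁ c f₁ f₂ z
  set g := wkbG f₁ f₂ z
  have hA : HasDerivAt (fun z => I * (U z / wkbT t₁ f₁ f₂ z))
      (-(k / h) * (T * W z) - g * (I * (U z / T))) z := by
    refine ((hU.fun_div hT' hne).const_mul I).congr_deriv ?_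
    rw [← e1, ← hTz]
    field_simp
    linear_combination (W z * k * T ^ 2 / h) * I_sq
  have hB : HasDerivAt (fun z => wkbT t₁ f₁ f₂ z * W z)
      (-(k / h) * (I * (U z / T)) + g * (T * W z)) z := by
    refine (hT'.fun_mul hW).congr_deriv ?_
    have e3 : f₁ z * T = c * k / T := by rw [e2]; field_simp
    rw [← hTz]
    have e4 : T * (-(I / (h * c)) * f₁ z * U z) = -(I / (h * c)) * (f₁ z * T) * U z := by ring
    rw [e4, e3]
    field_simp
    ring
  constructor
  · refine ((hA.fun_add hB).div_const 2).congr_deriv ?_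
    rw [wkbP, wkbQ, ← hTz]
    ring
  · refine ((hA.fun_sub hB).div_const 2).congr_deriv ?_
    rw [wkbP, wkbQ, ← hTz]
    ring

theorem exists_extension (hT : TurningPoint η t₁ f₁ f₂) {u : ℝ → ℂ × ℂ}
    (hu : IsSystemSolution h c f₁ f₂ u) :
    ∃ U W : ℂ → ℂ, (∀ x : ℝ, U x = (u x).1 ∧ W x = (u x).2) ∧ ∀ z ∈ strip η,
      HasDerivAt U (I / (h * c) * f₂ z * W z) z ∧ HasDerivAt W (-(I / (h * c)) * f₁ z * U z) z := by
  obtain ⟨C, hC, hb⟩ := hT.bound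
  exact exists_holomorphic_extension hT.eta_pos (M := ‖I / ((h : ℂ) * c)‖ * C)
    (a := fun z => I / (h * c) * f₂ z) (b := fun z => -(I / (h * c)) * f₁ z)
    (u := fun x => (u x).1) (v := fun x => (u x).2)
    (hT.diff₂.const_mul _) (hT.diff₁.const_mul _)
    (fun z hz => by
      rw [norm_mul]; exact mul_le_mul_of_nonneg_left (hb z hz).2.1 (norm_nonneg _))
    (fun z hz => by
      rw [norm_mul, norm_neg]; exact mul_le_mul_of_nonneg_left (hb z hz).1 (norm_nonneg _))
    (fun x => (hu x).1) (fun x => (hu x).2)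

end TurningPoint

theorem WkbSystem.const_mul {t₁ c h : ℝ} {f₁ f₂ P Q : ℂ → ℂ} {z : ℂ}
    (hS : WkbSystem t₁ c h f₁ f₂ P Q z) (b : ℂ) :
    WkbSystem t₁ c h f₁ f₂ (fun z => b * P z) (fun z => b * Q z) z :=
  ⟨(hS.1.const_mul b).congr_deriv (by ring), (hS.2.const_mul b).congr_deriv (by ring)⟩

theorem tendsto_exp_mul_wkb {l : Filter ℝ} {t₁ : ℝ} {f₁ f₂ U W : ℂ → ℂ} {u : ℝ → ℂ × ℂ}
    {s : ℝ → ℂ} {θ τ : ℂ} {v : ℂ × ℂ} (hs : Tendsto (fun x : ℝ => s x + θ * x) l (𝓝 0))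
    (hτ : Tendsto (fun x : ℝ => wkbT t₁ f₁ f₂ x) l (𝓝 τ)) (hτ' : τ ≠ 0)
    (hU : ∀ x : ℝ, U x = (u x).1 ∧ W x = (u x).2) (hu : JostAsymp u θ v l) :
    Tendsto (fun x : ℝ => exp (s x) * wkbP t₁ f₁ f₂ U W x) l (𝓝 ((I * (v.1 / τ) + τ * v.2) / 2)) ∧
    Tendsto (fun x : ℝ => exp (s x) * wkbQ t₁ f₁ f₂ U W x) l
      (𝓝 ((I * (v.1 / τ) - τ * v.2) / 2)) := by
  have he : Tendsto (fun x : ℝ => exp (s x + θ * x)) l (𝓝 1) := by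
    have := (continuous_exp.tendsto _).comp hs
    rwa [Complex.exp_zero] at this
  have h1 := (hu.1.div hτ hτ').const_mul I
  have h2 := hτ.mul hu.2
  have e : ∀ x : ℝ, exp (s x) = exp (s x + θ * x) * exp (-(θ * x)) := fun x => by
    rw [← Complex.exp_add]; ring_nf
  constructor
  · refine ((he.mul ((h1.add h2).div_const 2)).congr fun x => ?_).trans (by rw [one_mul])
    rw [e x, wkbP, (hU x).1, (hU x).2]
    simp only [Pi.div_apply]
    ring
  · refine ((he.mul ((h1.sub h2).div_const 2)).congr fun x => ?_).trans (by rw [one_mul])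
    rw [e x, wkbQ, (hU x).1, (hU x).2]
    simp only [Pi.div_apply]
    ring

namespace TurningPoint

variable {η t₁ c : ℝ} {f₁ f₂ : ℂ → ℂ}

theorem tendsto_wkbT_atTop (hT : TurningPoint η t₁ f₁ f₂) {r₁ r₂ : ℝ}
    (hr₁ : Tendsto (fun x : ℝ => (f₁ x).re) atTop (𝓝 r₁)) (hr₁' : 0 < r₁)
    (hr₂ : Tendsto (fun x : ℝ => (f₂ x).re) atTop (𝓝 r₂)) :
    Tendsto (fun x : ℝ => wkbT t₁ f₁ f₂ x) atTop (𝓝 (((r₂ / r₁) ^ (1 / 4 : ℝ) : ℝ) : ℂ)) := by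
  have h := (hr₂.div hr₁ hr₁'.ne').rpow_const (p := (1 / 4 : ℝ)) (Or.inr (by norm_num))
  refine ((continuous_ofReal.tendsto _).comp h).congr' ?_
  filter_upwards [eventually_gt_atTop t₁] with x hx
  rw [hT.wkbT_of_gt hx]
  rfl

theorem tendsto_wkbT_atBot (hT : TurningPoint η t₁ f₁ f₂) {l₁ l₂ : ℝ}
    (hl₁ : Tendsto (fun x : ℝ => (f₁ x).re) atBot (𝓝 l₁)) (hl₁' : l₁ < 0)
    (hl₂ : Tendsto (fun x : ℝ => (f₂ x).re) atBot (𝓝 l₂)) :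
    Tendsto (fun x : ℝ => wkbT t₁ f₁ f₂ x) atBot
      (𝓝 (exp (I * Real.pi / 4) * (((l₂ / -l₁) ^ (1 / 4 : ℝ) : ℝ) : ℂ))) := by
  have h := (hl₂.div hl₁.neg (neg_pos.2 hl₁').ne').rpow_const (p := (1 / 4 : ℝ))
    (Or.inr (by norm_num))
  refine (((continuous_ofReal.tendsto _).comp h).const_mul (exp (I * Real.pi / 4))).congr' ?_
  filter_upwards [eventually_lt_atBot t₁] with x hx
  rw [hT.wkbT_of_lt hx]
  rfl

/-- The Wronskian of the solution decaying at `+∞` and of an oscillating solution at `-∞`, up to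
its explicit exponential factor, has an asymptotic expansion of Gevrey type. -/
theorem exists_gevrey_connection (hT : TurningPoint η t₁ f₁ f₂) (hc : 0 < c) {qp qm : ℝ → ℝ}
    {kp km r₁ r₂ l₁ l₂ : ℝ}
    (hp : ∀ x : ℝ, t₁ < x → wkbK t₁ c f₁ f₂ x = ((qp x + kp : ℝ) : ℂ))
    (hm : ∀ x : ℝ, x < t₁ → wkbK t₁ c f₁ f₂ x = -I * ((qm x + km : ℝ) : ℂ))
    (hqp : IntegrableOn qp (Ioi t₁)) (hqm : IntegrableOn qm (Iic t₁))
    (hr₁ : Tendsto (fun x : ℝ => (f₁ x).re) atTop (𝓝 r₁)) (hr₁' : 0 < r₁)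
    (hr₂ : Tendsto (fun x : ℝ => (f₂ x).re) atTop (𝓝 r₂)) (hr₂' : 0 < r₂)
    (hl₁ : Tendsto (fun x : ℝ => (f₁ x).re) atBot (𝓝 l₁)) (hl₁' : l₁ < 0)
    (hl₂ : Tendsto (fun x : ℝ => (f₂ x).re) atBot (𝓝 l₂)) (hl₂' : 0 < l₂) :
    ∃ a : ℕ → ℂ, a 0 = 1 ∧ ∀ ωd ωo : ℝ → ℝ → ℂ × ℂ,
      (∀ h : ℝ, 0 < h → h < 1 →
        IsSystemSolution h c f₁ f₂ (ωd h) ∧ IsSystemSolution h c f₁ f₂ (ωo h) ∧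
        JostAsymp (ωd h) (-kp / h)
          (-I * (((r₂ / r₁) ^ (1 / 4 : ℝ) : ℝ) : ℂ), (((r₂ / r₁) ^ (1 / 4 : ℝ) : ℝ) : ℂ)⁻¹) atTop ∧
        JostAsymp (ωo h) (-I * km / h)
          ((((l₂ / -l₁) ^ (1 / 4 : ℝ) : ℝ) : ℂ), -(((l₂ / -l₁) ^ (1 / 4 : ℝ) : ℝ) : ℂ)⁻¹) atBot) →
      HasGevreyExpansion 1 (fun h => exp (-(I * Real.pi / 4)) *
        exp (-((((∫ x in Ioi t₁, qp x) - kp * t₁ : ℝ) : ℂ)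
          - I * (((∫ x in Iic t₁, qm x) + km * t₁ : ℝ) : ℂ)) / h) *
        (Wron (ωd h 0) (ωo h 0) / (2 * I))) a := by
  obtain ⟨ζR, ζL, hζ, hζR, hζL, hΘ⟩ := hT.exists_phases hc hp hm hqp hqm
  obtain ⟨x₀, hx₀, a, ha, H⟩ := hT.exists_gevrey_wronskian hc hζ
  refine ⟨a, ha, fun ωd ωo hω => ?_⟩
  have hext : ∀ ω : ℝ → ℝ → ℂ × ℂ, (∀ h : ℝ, 0 < h → h < 1 → IsSystemSolution h c f₁ f₂ (ω h)) →
      ∀ h : ℝ, ∃ U W : ℂ → ℂ, 0 < h → h < 1 → (∀ x : ℝ, U x = (ω h x).1 ∧ W x = (ω h x).2) ∧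
        ∀ z ∈ strip η, HasDerivAt U (I / (h * c) * f₂ z * W z) z ∧
          HasDerivAt W (-(I / (h * c)) * f₁ z * U z) z := by
    intro ω hω h
    by_cases h01 : 0 < h ∧ h < 1
    · obtain ⟨U, W, hUW⟩ := hT.exists_extension (hω h h01.1 h01.2)
      exact ⟨U, W, fun _ _ => hUW⟩
    · exact ⟨0, 0, fun h0 h1 => absurd ⟨h0, h1⟩ h01⟩
  choose Ud Wd hd using hext ωd fun h h0 h1 => (hω h h0 h1).1
  choose Uo Wo ho using hext ωo fun h h0 h1 => (hω h h0 h1).2.1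
  have hBne : ((((r₂ / r₁) ^ (1 / 4 : ℝ) : ℝ)) : ℂ) ≠ 0 :=
    ofReal_ne_zero.2 (Real.rpow_pos_of_pos (div_pos hr₂' hr₁') _).ne'
  have hAne : ((((l₂ / -l₁) ^ (1 / 4 : ℝ) : ℝ)) : ℂ) ≠ 0 :=
    ofReal_ne_zero.2 (Real.rpow_pos_of_pos (div_pos hl₂' (neg_pos.2 hl₁')) _).ne'
  have hTr := hT.tendsto_wkbT_atTop hr₁ hr₁' hr₂
  have hTl := hT.tendsto_wkbT_atBot hl₁ hl₁' hl₂
  set B : ℂ := (((r₂ / r₁) ^ (1 / 4 : ℝ) : ℝ) : ℂ)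
  set A : ℂ := (((l₂ / -l₁) ^ (1 / 4 : ℝ) : ℝ) : ℂ)
  set e : ℂ := exp (I * Real.pi / 4) with he
  have hene : e ≠ 0 := exp_ne_zero _
  have he2 : e ^ 2 = I := by
    rw [he, ← Complex.exp_nat_mul]
    exact (congrArg exp (by push_cast; ring)).trans exp_pi_div_two_mul_I
  have heinv : exp (-(I * Real.pi / 4)) = e⁻¹ := Complex.exp_neg _
  refine (H (fun h => wkbP t₁ f₁ f₂ (Ud h) (Wd h)) (fun h => wkbQ t₁ f₁ f₂ (Ud h) (Wd h))
    (fun h z => e⁻¹ * wkbP t₁ f₁ f₂ (Uo h) (Wo h) z)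
    (fun h z => e⁻¹ * wkbQ t₁ f₁ f₂ (Uo h) (Wo h) z) fun h h0 h1 => ?_).congr fun h h0 h1 => ?_
  · obtain ⟨-, -, hjd, hjo⟩ := hω h h0 h1
    obtain ⟨hd1, hd2⟩ := hd h h0 h1
    obtain ⟨ho1, ho2⟩ := ho h h0 h1
    have hhne : (h : ℂ) ≠ 0 := ofReal_ne_zero.2 h0.ne'
    have hsR : Tendsto (fun x : ℝ => ζR x / h + -kp / h * x) atTop (𝓝 0) := by
      have := hζR.div_const (h : ℂ)
      rw [zero_div] at this
      exact this.congr fun x => by ring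
    have hsL : Tendsto (fun x : ℝ => -ζL x / h + -I * km / h * x) atBot (𝓝 0) := by
      have := (hζL.div_const (h : ℂ)).neg
      rw [zero_div, neg_zero] at this
      exact this.congr fun x => by ring
    obtain ⟨r1, r2⟩ := tendsto_exp_mul_wkb hsR hTr hBne hd1 hjd
    obtain ⟨s1, s2⟩ := tendsto_exp_mul_wkb hsL hTl (mul_ne_zero hene hAne) ho1 hjo
    refine ⟨fun z hz => ⟨hT.wkbSystem hc hz (hd2 z hz.1).1 (hd2 z hz.1).2,
      (hT.wkbSystem hc hz (ho2 z hz.1).1 (ho2 z hz.1).2).const_mul _⟩, ?_, ?_, ?_, ?_⟩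
    · convert r1 using 2
      field_simp
      linear_combination I_sq
    · convert r2 using 2
      field_simp
      linear_combination I_sq
    · have := s2.const_mul e⁻¹
      refine (this.congr fun x => by ring).trans (le_of_eq ?_)
      congr 1
      field_simp
      linear_combination -he2
    · have := s1.const_mul e⁻¹
      refine (this.congr fun x => by ring).trans (le_of_eq ?_)
      congr 1
      field_simp
      linear_combination -he2
  · obtain ⟨hd1, hd2⟩ := hd h h0 h1
    obtain ⟨ho1, ho2⟩ := ho h h0 h1
    have hW := wronskian_eq hd2 ho2 hx₀.1 (ofReal_mem_strip hT.eta_pos 0)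
    rw [(hd1 0).1, (hd1 0).2, (ho1 0).1, (ho1 0).2, ← wkbP_mul_wkbQ_sub t₁ f₁ f₂] at hW
    rw [Wron, ← hW, heinv, ← hΘ x₀]
    have : exp (-(ζL x₀ - ζR x₀) / h) = exp (ζR x₀ / h) * exp (-ζL x₀ / h) := by
      rw [← Complex.exp_add]; ring_nf
    rw [this, mul_div_cancel_left₀ _ (by simp)]
    ring

end TurningPoint

theorem exists_zero_mem_uIcc {g : ℝ → ℝ} (hg : Continuous g) {a b : ℝ} (ha : g a ≤ 0)
    (hb : 0 ≤ g b) : ∃ y ∈ uIcc a b, g y = 0 := by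
  have h : (0 : ℝ) ∈ uIcc (g a) (g b) := by rw [uIcc_of_le (ha.trans hb)]; exact ⟨ha, hb⟩
  exact intermediate_value_uIcc hg.continuousOn h

theorem HasDerivAt.nonneg_of_eventually_pos {g : ℝ → ℝ} {d t : ℝ} (hg : HasDerivAt g d t)
    (h0 : g t = 0) (hpos : ∀ x, t < x → 0 < g x) : 0 ≤ d := by
  have h := (hasDerivWithinAt_iff_tendsto_slope' self_notMem_Ioi).1
    (hg.hasDerivWithinAt (s := Ioi t))
  refine ge_of_tendsto h ?_
  filter_upwards [self_mem_nhdsWithin] with x hx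
  rw [slope_def_field, h0, sub_zero]
  exact div_nonneg (hpos x hx).le (sub_nonneg.2 (le_of_lt hx))

theorem integrableOn_sqrt_sub_sqrt {g : ℝ → ℝ} {a b C R δ : ℝ} (hg : Continuous g) (hb : 0 < b)
    (hδ : 1 < δ) (hR : 0 < R) (h : ∀ x, R ≤ x → |g x - b| ≤ C * x ^ (-δ)) :
    IntegrableOn (fun x => √(g x) - √b) (Ici a) := by
  have hcont : Continuous fun x => √(g x) - √b := by fun_prop
  rw [integrableOn_Ici_iff_integrableAtFilter_atTop]
  refine ⟨⟨Ioi R, Ioi_mem_atTop R, ?_⟩, hcont.locallyIntegrable.locallyIntegrableOn _⟩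
  have hint : IntegrableOn (fun x : ℝ => C / √b * x ^ (-δ)) (Ioi R) :=
    (integrableOn_Ioi_rpow_of_lt (by linarith) hR).const_mul _
  refine hint.mono' hcont.aestronglyMeasurable ?_
  filter_upwards [ae_restrict_mem measurableSet_Ioi] with x hx
  have hb' : 0 < √b := Real.sqrt_pos.2 hb
  have h1 : |√(g x) - √b| ≤ |g x - b| / √b := by
    rw [le_div_iff₀ hb']
    rcases le_total 0 (g x) with h0 | h0
    · have e : g x - b = (√(g x) - √b) * (√(g x) + √b) := by
        linear_combination -(Real.sq_sqrt h0) + Real.sq_sqrt hb.le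
      rw [e, abs_mul]
      gcongr
      exact (le_add_of_nonneg_left (Real.sqrt_nonneg _)).trans (le_abs_self _)
    · rw [Real.sqrt_eq_zero_of_nonpos h0, zero_sub, abs_neg, abs_of_pos hb',
        Real.mul_self_sqrt hb.le, abs_of_nonpos (by linarith)]
      linarith
  rw [Real.norm_eq_abs]
  refine h1.trans ?_
  rw [div_mul_eq_mul_div]
  gcongr
  exact h x (le_of_lt hx)

/-- The coefficient `mc² - E + V` of the Dirac system. -/
noncomputable def diracLower (m c E : ℝ) (V : ℂ → ℂ) (z : ℂ) : ℂ := ((m * c ^ 2 - E : ℝ) : ℂ) + V z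

/-- The coefficient `mc² + E - V` of the Dirac system. -/
noncomputable def diracUpper (m c E : ℝ) (V : ℂ → ℂ) (z : ℂ) : ℂ := ((m * c ^ 2 + E : ℝ) : ℂ) - V z

section

variable {m c E Vm Vp t₁ : ℝ} {V : ℂ → ℂ}

@[simp]
theorem diracLower_re (z : ℂ) : (diracLower m c E V z).re = m * c ^ 2 - E + (V z).re := by
  rw [diracLower, add_re, ofReal_re]

@[simp]
theorem diracUpper_re (z : ℂ) : (diracUpper m c E V z).re = m * c ^ 2 + E - (V z).re := by
  rw [diracUpper, sub_re, ofReal_re]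

theorem isDiracSolution_iff {h : ℝ} (hh : 0 < h) (hc : 0 < c) {u : ℝ → ℂ × ℂ} :
    IsDiracSolution h m c V E u ↔
      IsSystemSolution h c (diracLower m c E V) (diracUpper m c E V) u := by
  have h0 : (h : ℂ) ≠ 0 := ofReal_ne_zero.2 hh.ne'
  have c0 : (c : ℂ) ≠ 0 := ofReal_ne_zero.2 hc.ne'
  constructor
  · intro hu x
    have e1 := hu.eq1 x
    have e2 := hu.eq2 x
    refine ⟨(hu.diff1 x).hasDerivAt.congr_deriv ?_, (hu.diff2 x).hasDerivAt.congr_deriv ?_⟩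
    · rw [diracUpper]
      push_cast
      field_simp
      linear_combination I * e2 + (h * c * deriv (fun y : ℝ => (u y).1) x) * I_sq
    · rw [diracLower]
      push_cast
      field_simp
      linear_combination I * e1 + (h * c * deriv (fun y : ℝ => (u y).2) x) * I_sq
  · intro hu
    refine ⟨fun x => (hu x).1.differentiableAt, fun x => (hu x).2.differentiableAt,
      fun x => ?_, fun x => ?_⟩
    · rw [(hu x).2.deriv, diracLower]
      push_cast
      field_simp
      linear_combination (m * c ^ 2 - E + V x) * (u x).1 * I_sq
    · rw [(hu x).1.deriv, diracUpper]
      push_cast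
      field_simp
      linear_combination -(m * c ^ 2 + E - V x) * (u x).2 * I_sq

theorem diracLower_mul_diracUpper_re (x : ℝ) :
    (diracLower m c E V x).re * (diracUpper m c E V x).re
      = m ^ 2 * c ^ 4 - ((V x).re - E) ^ 2 := by
  rw [diracLower_re, diracUpper_re]
  ring

namespace AssumptionA

theorem continuous_re (hA : AssumptionA V Vm Vp) : Continuous fun x : ℝ => (V x).re := by
  obtain ⟨η, hη, -, -, hV, -⟩ := hA.exists_strip_bounds
  exact Complex.continuous_re.comp (hV.continuousOn.comp_continuous continuous_ofReal
    (ofReal_mem_strip hη))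

theorem tendsto_atBot (hA : AssumptionA V Vm Vp) :
    Tendsto (fun x : ℝ => (V x).re) atBot (𝓝 Vm) :=
  (hA.tendsto_atTop.2.comp tendsto_neg_atBot_atTop).congr fun x => by simp

theorem exists_dirac_turningPoint (hA : AssumptionA V Vm Vp) (hm : 0 < m) (hc : 0 < c)
    (hE1 : m * c ^ 2 + Vm < E) (hE2 : Vp - m * c ^ 2 < E) (hE3 : E < Vp + m * c ^ 2)
    (hzero : ∀ x : ℝ, m ^ 2 * c ^ 4 - ((V x).re - E) ^ 2 = 0 ↔ x = t₁)
    (hsimple : deriv (fun x : ℝ => m ^ 2 * c ^ 4 - ((V x).re - E) ^ 2) t₁ ≠ 0) :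
    ∃ η, TurningPoint η t₁ (diracLower m c E V) (diracUpper m c E V) := by
  obtain ⟨η, hη, C, hC, hV, hb⟩ := hA.exists_strip_bounds
  have hmc : 0 < m * c ^ 2 := by positivity
  have hcont := hA.continuous_re
  obtain ⟨hp, hn⟩ := hA.tendsto_atTop
  have hg₁ : Continuous fun x : ℝ => (diracLower m c E V x).re := by
    simp only [diracLower_re]; fun_prop
  have hg₂ : Continuous fun x : ℝ => (diracUpper m c E V x).re := by
    simp only [diracUpper_re]; fun_prop
  have hz₁ : ∀ x : ℝ, (diracLower m c E V x).re = 0 → x = t₁ := fun x hx => by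
    rw [← hzero, ← diracLower_mul_diracUpper_re, hx, zero_mul]
  have hz₂ : ∀ x : ℝ, (diracUpper m c E V x).re = 0 → x = t₁ := fun x hx => by
    rw [← hzero, ← diracLower_mul_diracUpper_re, hx, mul_zero]
  have hr₁ : Tendsto (fun x : ℝ => (diracLower m c E V x).re) atTop (𝓝 (m * c ^ 2 - E + Vp)) := by
    simp only [diracLower_re]; exact hp.const_add _
  have hr₂ : Tendsto (fun x : ℝ => (diracUpper m c E V x).re) atTop (𝓝 (m * c ^ 2 + E - Vp)) := by
    simp only [diracUpper_re]; exact hp.const_sub _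
  have hl₁ : Tendsto (fun x : ℝ => (diracLower m c E V ((-x : ℝ) : ℂ)).re) atTop
      (𝓝 (m * c ^ 2 - E + Vm)) := by
    simp only [diracLower_re]; exact hn.const_add _
  have hl₂ : Tendsto (fun x : ℝ => (diracUpper m c E V ((-x : ℝ) : ℂ)).re) atTop
      (𝓝 (m * c ^ 2 + E - Vm)) := by
    simp only [diracUpper_re]; exact hn.const_sub _
  have hlarge : ∀ a : ℝ, ∃ b, a < b ∧ 0 < (diracLower m c E V (b : ℝ)).re := fun a =>
    ((eventually_gt_atTop a).and (hr₁.eventually_const_lt (u := 0) (by linarith))).exists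
  have hsmall : ∀ a : ℝ, ∃ b, b < a ∧ (diracLower m c E V (b : ℝ)).re < 0 := fun a => by
    obtain ⟨b, hb, hb'⟩ := ((eventually_gt_atTop (-a)).and
      (hl₁.eventually_lt_const (u := 0) (by linarith))).exists
    exact ⟨-b, by linarith, hb'⟩
  have ht : (diracLower m c E V t₁).re = 0 := by
    obtain ⟨a, -, ha⟩ := hsmall 0
    obtain ⟨b, -, hb⟩ := hlarge 0
    obtain ⟨y, -, hy⟩ := exists_zero_mem_uIcc hg₁ ha.le hb.le
    rwa [← hz₁ y hy]
  have ht₂ : 0 < (diracUpper m c E V t₁).re := by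
    rw [diracLower_re] at ht
    rw [diracUpper_re]
    linarith
  have pos₁ : ∀ x : ℝ, t₁ < x → 0 < (diracLower m c E V x).re := fun x hx => by
    by_contra! hneg
    obtain ⟨b, hb, hb'⟩ := hlarge x
    obtain ⟨y, hy, hy'⟩ := exists_zero_mem_uIcc hg₁ hneg hb'.le
    rw [uIcc_of_le hb.le] at hy
    linarith [hz₁ y hy', hy.1]
  have neg₁ : ∀ x : ℝ, x < t₁ → (diracLower m c E V x).re < 0 := fun x hx => by
    by_contra! hpos
    obtain ⟨b, hb, hb'⟩ := hsmall x
    obtain ⟨y, hy, hy'⟩ := exists_zero_mem_uIcc hg₁ hb'.le hpos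
    rw [uIcc_of_le hb.le] at hy
    linarith [hz₁ y hy', hy.2]
  have pos₂ : ∀ x : ℝ, 0 < (diracUpper m c E V x).re := fun x => by
    by_contra! hneg
    obtain ⟨y, -, hy'⟩ := exists_zero_mem_uIcc hg₂ hneg ht₂.le
    rw [hz₂ y hy'] at hy'
    exact ht₂.ne' hy'
  have im₁ : ∀ x : ℝ, (diracLower m c E V x).im = 0 := fun x => by
    rw [diracLower, add_im, ofReal_im, hA.real_on_real, add_zero]
  have im₂ : ∀ x : ℝ, (diracUpper m c E V x).im = 0 := fun x => by
    rw [diracUpper, sub_im, ofReal_im, hA.real_on_real, sub_zero]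
  have hVd : ∀ z ∈ strip η, HasDerivAt V (deriv V z) z := fun z hz =>
    (hV.differentiableAt ((isOpen_strip η).mem_nhds hz)).hasDerivAt
  have hd₁ : ∀ z ∈ strip η, HasDerivAt (diracLower m c E V) (deriv V z) z := fun z hz =>
    (hVd z hz).const_add _
  have hd₂ : ∀ z ∈ strip η, HasDerivAt (diracUpper m c E V) (-deriv V z) z := fun z hz =>
    (hVd z hz).const_sub _
  have hderiv : 0 < (deriv (diracLower m c E V) t₁).re := by
    have ht' := ofReal_mem_strip hη t₁
    rw [(hd₁ _ ht').deriv]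
    have h1 : HasDerivAt (fun x : ℝ => (diracLower m c E V x).re) (deriv V t₁).re t₁ :=
      reCLM.hasFDerivAt.comp_hasDerivAt t₁ (hd₁ _ ht').comp_ofReal
    have h2 : HasDerivAt (fun x : ℝ => (diracUpper m c E V x).re) (-deriv V t₁).re t₁ :=
      reCLM.hasFDerivAt.comp_hasDerivAt t₁ (hd₂ _ ht').comp_ofReal
    refine lt_of_le_of_ne (h1.nonneg_of_eventually_pos ht pos₁) fun h0 => hsimple ?_
    have h3 := h1.fun_mul h2
    simp only [diracLower_mul_diracUpper_re, ht, ← h0, zero_mul, add_zero] at h3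
    exact h3.deriv
  obtain ⟨η', -, -, hT⟩ := exists_turningPoint (C := |m * c ^ 2 - E| + |m * c ^ 2 + E| + C + 1) hη
    (by positivity) (fun z hz => (hd₁ z hz).differentiableAt.differentiableWithinAt)
    (fun z hz => (hd₂ z hz).differentiableAt.differentiableWithinAt) im₁ im₂
    (Complex.ext ht (im₁ t₁)) hderiv
    (fun z hz => by
      obtain ⟨hb1, hb2⟩ := hb z hz
      have hle : C / (1 + |z.re|) ^ 2
          ≤ (|m * c ^ 2 - E| + |m * c ^ 2 + E| + C + 1) / (1 + |z.re|) ^ 2 := by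
        gcongr
        linarith [abs_nonneg (m * c ^ 2 - E), abs_nonneg (m * c ^ 2 + E)]
      refine ⟨?_, ?_, ?_, ?_⟩
      · refine (norm_add_le _ _).trans ?_
        rw [norm_real, Real.norm_eq_abs]
        linarith [abs_nonneg (m * c ^ 2 + E)]
      · refine (norm_sub_le _ _).trans ?_
        rw [norm_real, Real.norm_eq_abs]
        linarith [abs_nonneg (m * c ^ 2 - E)]
      · rw [(hd₁ z hz).deriv]
        exact hb2.trans hle
      · rw [(hd₂ z hz).deriv, norm_neg]
        exact hb2.trans hle)
    pos₂ pos₁ neg₁ hr₁ (by linarith) hr₂ (by linarith) hl₁ (by linarith) hl₂ (by linarith)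
  exact ⟨η', hT⟩

end AssumptionA

end

namespace AssumptionA

variable {m c E Vm Vp t₁ : ℝ} {V : ℂ → ℂ}

theorem exists_tail_bound_sq (hA : AssumptionA V Vm Vp) (E : ℝ) :
    ∃ δ > (1 : ℝ), ∃ C R : ℝ, 0 < R ∧ ∀ x : ℝ, R ≤ x →
      |((V x).re - E) ^ 2 - (Vp - E) ^ 2| ≤ C * x ^ (-δ) ∧
      |((V ((-x : ℝ) : ℂ)).re - E) ^ 2 - (Vm - E) ^ 2| ≤ C * x ^ (-δ) := by
  obtain ⟨δ, hδ, C, R, hR, h⟩ := hA.exists_tail_bound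
  obtain ⟨η, hη, M, hM, -, hb⟩ := hA.exists_strip_bounds
  have key : ∀ (x y W : ℝ), ‖V y - W‖ ≤ C * x ^ (-δ) →
      |((V y).re - E) ^ 2 - (W - E) ^ 2| ≤ (M + |Vm| + |Vp| + 2 * |E| + |W|) * (C * x ^ (-δ)) := by
    intro x y W hy
    have h1 : |(V y).re - W| ≤ C * x ^ (-δ) := by
      have h2 := abs_re_le_norm (V y - W)
      rw [sub_re, ofReal_re] at h2
      exact h2.trans hy
    have h2 : |(V y).re| ≤ M :=
      (abs_re_le_norm _).trans (hb y (ofReal_mem_strip hη y)).1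
    have e : ((V y).re - E) ^ 2 - (W - E) ^ 2 = ((V y).re + W - 2 * E) * ((V y).re - W) := by ring
    rw [e, abs_mul]
    refine mul_le_mul ?_ h1 (abs_nonneg _) (by positivity)
    have h3 := abs_sub ((V y).re + W) (2 * E)
    have h4 := abs_add_le (V y).re W
    rw [abs_mul, abs_two] at h3
    linarith [abs_nonneg Vm, abs_nonneg Vp]
  refine ⟨δ, hδ, (M + |Vm| + |Vp| + 2 * |E| + (|Vm| + |Vp|)) * C, R, hR, fun x hx => ?_⟩
  obtain ⟨hp, hn⟩ := h x hx
  have h0 : 0 ≤ C * x ^ (-δ) := (norm_nonneg _).trans hp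
  rw [mul_assoc]
  constructor
  · refine (key x x Vp hp).trans (mul_le_mul_of_nonneg_right ?_ h0)
    linarith [abs_nonneg Vm]
  · refine (key x (-x) Vm hn).trans (mul_le_mul_of_nonneg_right ?_ h0)
    linarith [abs_nonneg Vp]

theorem integrableOn_Qminus (hA : AssumptionA V Vm Vp) (hc : 0 < c)
    (hE : 0 < -Esym m c E Vp) (a : ℝ) : IntegrableOn (Qminus m c E Vp V) (Ici a) := by
  obtain ⟨δ, hδ, C, R, hR, h⟩ := hA.exists_tail_bound_sq E
  have hcont := hA.continuous_re
  refine integrableOn_sqrt_sub_sqrt (g := fun t => (m ^ 2 * c ^ 4 - ((V t).re - E) ^ 2) / c ^ 2)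
    (C := C / c ^ 2) (by fun_prop) hE hδ hR fun x hx => ?_
  have e : (m ^ 2 * c ^ 4 - ((V x).re - E) ^ 2) / c ^ 2 - -Esym m c E Vp
      = -(((V x).re - E) ^ 2 - (Vp - E) ^ 2) / c ^ 2 := by rw [Esym]; ring
  rw [e, abs_div, abs_neg, abs_of_nonneg (sq_nonneg c), div_mul_eq_mul_div]
  gcongr
  exact (h x hx).1

theorem integrableOn_Qsym (hA : AssumptionA V Vm Vp) (hc : 0 < c)
    (hE : 0 < Esym m c E Vm) (a : ℝ) : IntegrableOn (Qsym m c E Vm V) (Iic a) := by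
  obtain ⟨δ, hδ, C, R, hR, h⟩ := hA.exists_tail_bound_sq E
  have hcont : Continuous fun x : ℝ => (V ((-x : ℝ) : ℂ)).re := hA.continuous_re.comp continuous_neg
  have := integrableOn_sqrt_sub_sqrt (a := -a)
    (g := fun t => (-(m ^ 2 * c ^ 4) + ((V ((-t : ℝ) : ℂ)).re - E) ^ 2) / c ^ 2)
    (C := C / c ^ 2) (by fun_prop) hE hδ hR fun x hx => by
      have e : (-(m ^ 2 * c ^ 4) + ((V ((-x : ℝ) : ℂ)).re - E) ^ 2) / c ^ 2 - Esym m c E Vm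
          = (((V ((-x : ℝ) : ℂ)).re - E) ^ 2 - (Vm - E) ^ 2) / c ^ 2 := by rw [Esym]; ring
      rw [e, abs_div, abs_of_nonneg (sq_nonneg c), div_mul_eq_mul_div]
      gcongr
      exact (h x hx).2
  rw [← (Measure.measurePreserving_neg volume).integrableOn_comp_preimage
    (Homeomorph.neg ℝ).measurableEmbedding, neg_preimage, neg_Iic]
  exact this

theorem exists_gevrey_connection (hA : AssumptionA V Vm Vp) (hm : 0 < m) (hc : 0 < c)
    (hE1 : m * c ^ 2 + Vm < E) (hE2 : Vp - m * c ^ 2 < E) (hE3 : E < Vp + m * c ^ 2)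
    (hzero : ∀ x : ℝ, m ^ 2 * c ^ 4 - ((V x).re - E) ^ 2 = 0 ↔ x = t₁)
    (hsimple : deriv (fun x : ℝ => m ^ 2 * c ^ 4 - ((V x).re - E) ^ 2) t₁ ≠ 0) :
    ∃ a : ℕ → ℂ, a 0 = 1 ∧ ∀ ωd ωo : ℝ → ℝ → ℂ × ℂ,
      (∀ h : ℝ, 0 < h → h < 1 →
        IsDiracSolution h m c V E (ωd h) ∧ IsDiracSolution h m c V E (ωo h) ∧
        DecayCond h m c E Vp 1 atTop (ωd h) ∧ JostCond h m c E Vm (-1) (-1) atBot (ωo h)) →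
      HasGevreyExpansion 1 (fun h => exp (-(I * Real.pi / 4)) *
        exp (1 / h * (((-∫ t in Ici t₁, Qminus m c E Vp V t) + √(-Esym m c E Vp) * t₁ : ℝ)
          + I * ((∫ t in Iic t₁, Qsym m c E Vm V t) + √(Esym m c E Vm) * t₁ : ℝ))) *
        (Wron (ωd h 0) (ωo h 0) / (2 * I))) a := by
  obtain ⟨η, hT⟩ := hA.exists_dirac_turningPoint hm hc hE1 hE2 hE3 hzero hsimple
  have hmc : 0 < m * c ^ 2 := by positivity
  have hp := hA.tendsto_atTop.1
  have hn := hA.tendsto_atBot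
  have hEp : 0 < -Esym m c E Vp := by
    have : -Esym m c E Vp = (m * c ^ 2 - E + Vp) * (m * c ^ 2 + E - Vp) / c ^ 2 := by
      rw [Esym]; ring
    rw [this]
    exact div_pos (mul_pos (by linarith) (by linarith)) (by positivity)
  have hEm : 0 < Esym m c E Vm := by
    have : Esym m c E Vm = (E - Vm - m * c ^ 2) * (m * c ^ 2 + E - Vm) / c ^ 2 := by
      rw [Esym]; ring
    rw [this]
    exact div_pos (mul_pos (by linarith) (by linarith)) (by positivity)
  have hsqrt : ∀ y : ℝ, √(y / c ^ 2) = √y / c := fun y => by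
    rw [Real.sqrt_div' _ (sq_nonneg c), Real.sqrt_sq hc.le]
  obtain ⟨a, ha, H⟩ := hT.exists_gevrey_connection hc
    (qp := Qminus m c E Vp V) (qm := Qsym m c E Vm V) (kp := √(-Esym m c E Vp))
    (km := √(Esym m c E Vm)) (r₁ := m * c ^ 2 - E + Vp) (r₂ := m * c ^ 2 + E - Vp)
    (l₁ := m * c ^ 2 - E + Vm) (l₂ := m * c ^ 2 + E - Vm)
    (fun x hx => by
      rw [hT.wkbK_of_gt hx, diracLower_mul_diracUpper_re, Qminus, sub_add_cancel, hsqrt])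
    (fun x hx => by
      rw [hT.wkbK_of_lt hx, neg_mul (diracLower m c E V x).re, diracLower_mul_diracUpper_re,
        Qsym, sub_add_cancel, hsqrt, neg_sub, sub_eq_neg_add])
    ((hA.integrableOn_Qminus hc hEp t₁).mono_set Ioi_subset_Ici_self)
    (hA.integrableOn_Qsym hc hEm t₁)
    (by simp only [diracLower_re]; exact hp.const_add _) (by linarith)
    (by simp only [diracUpper_re]; exact hp.const_sub _) (by linarith)
    (by simp only [diracLower_re]; exact hn.const_add _) (by linarith)
    (by simp only [diracUpper_re]; exact hn.const_sub _) (by linarith)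
  refine ⟨a, ha, fun ωd ωo hω => (H ωd ωo fun h h0 h1 => ?_).congr fun h h0 h1 => ?_⟩
  · obtain ⟨s1, s2, j1, j2⟩ := hω h h0 h1
    have hh : (h : ℂ) ≠ 0 := ofReal_ne_zero.2 h0.ne'
    have hc' : (c : ℂ) ≠ 0 := ofReal_ne_zero.2 hc.ne'
    refine ⟨(isDiracSolution_iff h0 hc).1 s1, (isDiracSolution_iff h0 hc).1 s2, ?_, ?_⟩
    · have e : -Esym m c E Vp = (m ^ 2 * c ^ 4 - (Vp - E) ^ 2) / c ^ 2 := by rw [Esym]; ring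
      have e' : Bsym m c E Vp = ((m * c ^ 2 + E - Vp) / (m * c ^ 2 - E + Vp)) ^ (1 / 4 : ℝ) := rfl
      rw [← e', e, hsqrt]
      rw [DecayCond] at j1
      convert j1 using 1
      · push_cast; field_simp
      · simp
    · have e : PhiF m c (E - Vm) = c * √(Esym m c E Vm) := by
        rw [PhiF, Real.sign_of_pos (by linarith), one_mul, Esym, hsqrt]
        field_simp
        ring_nf
      have e' : AmpF m c (E - Vm)
          = ((m * c ^ 2 + E - Vm) / -(m * c ^ 2 - E + Vm)) ^ (1 / 4 : ℝ) := by
        rw [AmpF]; ring_nf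
      rw [← e']
      rw [JostCond, e] at j2
      convert j2 using 1
      · push_cast; field_simp
      · simp
  · rw [integral_Ici_eq_integral_Ioi]
    congr 3
    push_cast
    ring

end AssumptionA

theorem Wron.smul_eq (u v w : ℂ × ℂ) : Wron v w • u = Wron u w • v - Wron u v • w := by
  ext <;> simp [Wron] <;> ring

theorem eq_zero_of_wron_eq_zero {u v w : ℂ × ℂ} (h : Wron v w ≠ 0) (hv : Wron u v = 0)
    (hw : Wron u w = 0) : u = 0 := by
  have := Wron.smul_eq u v w
  rw [hv, hw, zero_smul, zero_smul, sub_zero] at this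
  exact (smul_eq_zero.1 this).resolve_left h

theorem exists_eq_smul_of_wron_eq_zero {u v : ℂ × ℂ} (h : Wron u v = 0) (hv : v ≠ 0) :
    ∃ b : ℂ, u = b • v := by
  rw [Wron, sub_eq_zero] at h
  by_cases h1 : v.1 = 0
  · have h2 : v.2 ≠ 0 := fun h2 => hv (Prod.ext h1 h2)
    refine ⟨u.2 / v.2, Prod.ext ?_ ?_⟩
    · rw [h1, mul_zero] at h
      simpa [h1] using (mul_eq_zero.1 h).resolve_right h2
    · simp [h2]
  · refine ⟨u.1 / v.1, Prod.ext (by simp [h1]) ?_⟩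
    simp only [Prod.smul_snd, smul_eq_mul]
    field_simp
    linear_combination -h

namespace JostAsymp

variable {u v : ℝ → ℂ × ℂ} {θ θ' : ℂ} {a b : ℂ × ℂ} {l : Filter ℝ}

theorem tendsto_wron (hu : JostAsymp u θ a l) (hv : JostAsymp v θ' b l) :
    Tendsto (fun x : ℝ => Wron (u x) (v x) * exp (-((θ + θ') * x))) l (𝓝 (Wron a b)) := by
  refine ((hu.1.mul hv.2).sub (hu.2.mul hv.1)).congr fun x => ?_
  rw [add_mul, neg_add, Complex.exp_add, Wron]
  ring

theorem eq_exp_smul (x : ℝ) : u x = exp (θ * x) • ((u x).1 * exp (-(θ * x)),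
    (u x).2 * exp (-(θ * x))) := by
  have := Complex.exp_ne_zero (θ * x)
  ext <;> simp [Complex.exp_neg] <;> field_simp

theorem exists_ne_zero [l.NeBot] (hu : JostAsymp u θ a l) (ha : a ≠ 0) : ∃ x, u x ≠ 0 := by
  by_contra! h
  refine ha (Prod.ext (tendsto_nhds_unique hu.1 ?_) (tendsto_nhds_unique hu.2 ?_)) <;> simp [h]

theorem tendsto_prod (hu : JostAsymp u θ a l) : Tendsto
    (fun x : ℝ => ((u x).1 * exp (-(θ * x)), (u x).2 * exp (-(θ * x)))) l (𝓝 a) :=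
  hu.1.prodMk_nhds hu.2

theorem tendsto_zero (hu : JostAsymp u θ a l)
    (hθ : Tendsto (fun x : ℝ => exp (θ * x)) l (𝓝 0)) : Tendsto u l (𝓝 0) := by
  have := hθ.smul hu.tendsto_prod
  rw [zero_smul] at this
  exact this.congr fun x => (eq_exp_smul x).symm

theorem eventually_bounded (hu : JostAsymp u θ a l) (hθ : ∀ x : ℝ, ‖exp (θ * x)‖ = 1) :
    ∀ᶠ x in l, ‖u x‖ ≤ ‖a‖ + 1 := by
  filter_upwards [hu.tendsto_prod.norm.eventually_le_const (lt_add_one ‖a‖)] with x hx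
  rw [eq_exp_smul (u := u) (θ := θ) x, norm_smul, hθ, one_mul]
  exact hx

end JostAsymp

namespace IsSystemSolution

variable {h c : ℝ} {f₁ f₂ : ℂ → ℂ} {u v p q : ℝ → ℂ × ℂ}

theorem wron_eq (hu : IsSystemSolution h c f₁ f₂ u) (hv : IsSystemSolution h c f₁ f₂ v) (x y : ℝ) :
    Wron (u x) (v x) = Wron (u y) (v y) := by
  have hD : ∀ x : ℝ, HasDerivAt (fun x => Wron (u x) (v x)) 0 x := fun x => by
    refine (((hu x).1.fun_mul (hv x).2).fun_sub ((hu x).2.fun_mul (hv x).1)).congr_deriv ?_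
    ring
  exact is_const_of_deriv_eq_zero (fun x => (hD x).differentiableAt) (fun x => (hD x).deriv) x y

theorem wron_eq_of_tendsto {l : Filter ℝ} [l.NeBot] (hu : IsSystemSolution h c f₁ f₂ u)
    (hv : IsSystemSolution h c f₁ f₂ v) {w : ℂ}
    (hw : Tendsto (fun x => Wron (u x) (v x)) l (𝓝 w)) (x : ℝ) : Wron (u x) (v x) = w :=
  tendsto_nhds_unique (tendsto_const_nhds.congr fun y => hu.wron_eq hv x y) hw

theorem wron_eq_of_asymp {l : Filter ℝ} [l.NeBot] {θ θ' : ℂ} {a b : ℂ × ℂ}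
    (hu : IsSystemSolution h c f₁ f₂ u) (hv : IsSystemSolution h c f₁ f₂ v)
    (hua : JostAsymp u θ a l) (hvb : JostAsymp v θ' b l) (hθ : θ + θ' = 0) (x : ℝ) :
    Wron (u x) (v x) = Wron a b := by
  refine hu.wron_eq_of_tendsto hv ((hua.tendsto_wron hvb).congr fun x => ?_) x
  rw [hθ, zero_mul, neg_zero, Complex.exp_zero, mul_one]

theorem lincomb (hu : IsSystemSolution h c f₁ f₂ u) (hv : IsSystemSolution h c f₁ f₂ v)
    (a b : ℂ) : IsSystemSolution h c f₁ f₂ (fun x => a • u x + b • v x) := fun x => by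
  refine ⟨?_, ?_⟩
  · refine (((hu x).1.const_mul a).fun_add ((hv x).1.const_mul b)).congr_deriv ?_
    simp only [Prod.snd_add, Prod.smul_snd, smul_eq_mul]
    ring
  · refine (((hu x).2.const_mul a).fun_add ((hv x).2.const_mul b)).congr_deriv ?_
    simp only [Prod.fst_add, Prod.smul_fst, smul_eq_mul]
    ring

theorem continuous (hu : IsSystemSolution h c f₁ f₂ u) : Continuous u :=
  (continuous_iff_continuousAt.2 fun x => (hu x).1.continuousAt).prodMk
    (continuous_iff_continuousAt.2 fun x => (hu x).2.continuousAt)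

/-- The antiunitary symmetry of the system. -/
theorem conj (hu : IsSystemSolution h c f₁ f₂ u) (h₁ : ∀ x : ℝ, (f₁ x).im = 0)
    (h₂ : ∀ x : ℝ, (f₂ x).im = 0) : IsSystemSolution h c f₁ f₂
      (fun x => (starRingEnd ℂ (u x).1, -starRingEnd ℂ (u x).2)) := fun x => by
  have e₁ : starRingEnd ℂ (f₁ x) = f₁ x := conj_eq_iff_im.2 (h₁ x)
  have e₂ : starRingEnd ℂ (f₂ x) = f₂ x := conj_eq_iff_im.2 (h₂ x)
  have d₁ : HasDerivAt (fun x => starRingEnd ℂ (u x).1) _ x :=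
    conjCLE.toContinuousLinearMap.hasFDerivAt.comp_hasDerivAt x (hu x).1
  have d₂ : HasDerivAt (fun x => starRingEnd ℂ (u x).2) _ x :=
    conjCLE.toContinuousLinearMap.hasFDerivAt.comp_hasDerivAt x (hu x).2
  refine ⟨d₁.congr_deriv ?_, d₂.fun_neg.congr_deriv ?_⟩
  · simp [e₂]
    ring
  · simp [e₁]
    ring

theorem eq_zero_of_apply_eq_zero (hu : IsSystemSolution h c f₁ f₂ u)
    (hp : IsSystemSolution h c f₁ f₂ p) (hq : IsSystemSolution h c f₁ f₂ q)
    (hpq : Wron (p 0) (q 0) ≠ 0) {y : ℝ} (hy : u y = 0) (x : ℝ) : u x = 0 := by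
  have h0 : ∀ w : ℂ × ℂ, Wron 0 w = 0 := fun w => by simp [Wron]
  refine eq_zero_of_wron_eq_zero (v := p x) (w := q x) ?_ ?_ ?_
  · rwa [hp.wron_eq hq x 0]
  · rw [hu.wron_eq hp x y, hy, h0]
  · rw [hu.wron_eq hq x y, hy, h0]

theorem exists_eq_smul (hu : IsSystemSolution h c f₁ f₂ u) (hv : IsSystemSolution h c f₁ f₂ v)
    (hp : IsSystemSolution h c f₁ f₂ p) (hq : IsSystemSolution h c f₁ f₂ q)
    (hpq : Wron (p 0) (q 0) ≠ 0) {y : ℝ} (hy : v y ≠ 0) (hW : Wron (u y) (v y) = 0) :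
    ∃ b : ℂ, ∀ x, u x = b • v x := by
  obtain ⟨b, hb⟩ := exists_eq_smul_of_wron_eq_zero hW hy
  refine ⟨b, fun x => ?_⟩
  have := (hu.lincomb hv 1 (-b)).eq_zero_of_apply_eq_zero hp hq hpq (y := y)
    (by rw [hb, one_smul, neg_smul, add_neg_cancel]) x
  rwa [one_smul, neg_smul, add_neg_eq_zero] at this

theorem eq_of_asymp {l : Filter ℝ} [l.NeBot] {θ : ℂ} {a : ℂ × ℂ}
    (hu : IsSystemSolution h c f₁ f₂ u) (hv : IsSystemSolution h c f₁ f₂ v)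
    (hp : IsSystemSolution h c f₁ f₂ p) (hq : IsSystemSolution h c f₁ f₂ q)
    (hpq : Wron (p 0) (q 0) ≠ 0) (hua : JostAsymp u θ a l) (hva : JostAsymp v θ a l) (ha : a ≠ 0)
    (hθ : ∀ᶠ x : ℝ in l, ‖exp (θ * x)‖ ≤ 1) (x : ℝ) : u x = v x := by
  obtain ⟨y, hy⟩ := hva.exists_ne_zero ha
  have hW : Wron (u y) (v y) = 0 := by
    refine hu.wron_eq_of_tendsto hv ?_ y (l := l)
    have h1 := hua.tendsto_wron hva
    have h2 : Wron a a = 0 := by rw [Wron]; ring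
    rw [h2] at h1
    refine squeeze_zero_norm' ?_ (tendsto_zero_iff_norm_tendsto_zero.1 h1)
    filter_upwards [hθ] with x hx
    have h3 : Wron (u x) (v x) = exp (θ * x) ^ 2 *
        (Wron (u x) (v x) * exp (-((θ + θ) * x))) := by
      rw [add_mul, neg_add, Complex.exp_add, Complex.exp_neg]
      have := Complex.exp_ne_zero (θ * x)
      field_simp
    rw [h3, norm_mul, norm_pow, ← h3]
    exact mul_le_of_le_one_left (norm_nonneg _) (pow_le_one₀ (norm_nonneg _) hx)
  obtain ⟨b, hb⟩ := hu.exists_eq_smul hv hp hq hpq hy hW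
  have h1 : Tendsto (fun x : ℝ => ((u x).1 * exp (-(θ * x)), (u x).2 * exp (-(θ * x)))) l
      (𝓝 (b • a)) := (hva.tendsto_prod.const_smul b).congr fun x => by
    rw [hb x]; ext <;> simp <;> ring
  have h2 := tendsto_nhds_unique h1 hua.tendsto_prod
  have hb1 : b = 1 := by
    by_contra hne
    refine ha ((smul_eq_zero.1 (?_ : (b - 1) • a = 0)).resolve_left (sub_ne_zero.2 hne))
    rw [sub_smul, h2, one_smul, sub_self]
  rw [hb x, hb1, one_smul]

end IsSystemSolution

theorem Continuous.exists_norm_le_of_eventually {E : Type*} [NormedAddCommGroup E] {u : ℝ → E}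
    (hu : Continuous u) {A B : ℝ} (hA : ∀ᶠ x in atBot, ‖u x‖ ≤ A) (hB : ∀ᶠ x in atTop, ‖u x‖ ≤ B) :
    ∃ M, ∀ x, ‖u x‖ ≤ M := by
  obtain ⟨a, ha⟩ := eventually_atBot.1 hA
  obtain ⟨b, hb⟩ := eventually_atTop.1 hB
  obtain ⟨C, hC⟩ := (isCompact_Icc (a := a) (b := b)).exists_bound_of_continuousOn hu.continuousOn
  refine ⟨max (max A B) C, fun x => ?_⟩
  rcases le_total x a with h | h
  · exact (ha x h).trans (le_max_of_le_left (le_max_left _ _))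
  rcases le_total b x with h' | h'
  · exact (hb x h').trans (le_max_of_le_left (le_max_right _ _))
  · exact (hC x ⟨h, h'⟩).trans (le_max_right _ _)

theorem JostAsymp.conj {u : ℝ → ℂ × ℂ} {θ : ℂ} {a : ℂ × ℂ} {l : Filter ℝ} (hu : JostAsymp u θ a l) :
    JostAsymp (fun x => (starRingEnd ℂ (u x).1, -starRingEnd ℂ (u x).2)) (starRingEnd ℂ θ)
      (starRingEnd ℂ a.1, -starRingEnd ℂ a.2) l := by
  refine ⟨((continuous_conj.tendsto _).comp hu.1).congr fun x => ?_,
    ((continuous_conj.tendsto _).comp hu.2).neg.congr fun x => ?_⟩ <;>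
  simp [← exp_conj]

theorem JostAsymp.const_smul {u : ℝ → ℂ × ℂ} {θ : ℂ} {a : ℂ × ℂ} {l : Filter ℝ}
    (hu : JostAsymp u θ a l) (b : ℂ) : JostAsymp (fun x => b • u x) θ (b • a) l :=
  ⟨(hu.1.const_mul b).congr fun x => by simp [mul_assoc],
    (hu.2.const_mul b).congr fun x => by simp [mul_assoc]⟩

theorem norm_exp_I_mul_mul (k x : ℝ) : ‖exp (I * k * x)‖ = 1 := by
  rw [mul_assoc, ← ofReal_mul, norm_exp_I_mul_ofReal]

theorem tendsto_exp_neg_mul {κ : ℝ} (hκ : 0 < κ) :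
    Tendsto (fun x : ℝ => exp (-(κ : ℂ) * x)) atTop (𝓝 0) := by
  rw [tendsto_zero_iff_norm_tendsto_zero]
  simp only [norm_exp]
  have : Tendsto (fun x : ℝ => κ * x) atTop atTop := tendsto_id.const_mul_atTop hκ
  refine (Real.tendsto_exp_neg_atTop_nhds_zero.comp this).congr fun x => ?_
  simp

namespace IsSystemSolution

variable {h c k κ A B : ℝ} {f₁ f₂ : ℂ → ℂ} {u p q d : ℝ → ℂ × ℂ}

theorem const_smul (hu : IsSystemSolution h c f₁ f₂ u) (b : ℂ) :
    IsSystemSolution h c f₁ f₂ (fun x => b • u x) := by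
  simpa using hu.lincomb hu b 0

theorem wron_incoming_outgoing (hp : IsSystemSolution h c f₁ f₂ p)
    (hq : IsSystemSolution h c f₁ f₂ q) (hA : 0 < A)
    (hpA : JostAsymp p (I * k) ((A : ℂ), (A : ℂ)⁻¹) atBot)
    (hqA : JostAsymp q (I * (-k : ℝ)) ((A : ℂ), -(A : ℂ)⁻¹) atBot) (x : ℝ) :
    Wron (p x) (q x) = -2 := by
  rw [hp.wron_eq_of_asymp hq hpA hqA (by push_cast; ring), Wron]
  have : (A : ℂ) ≠ 0 := ofReal_ne_zero.2 hA.ne'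
  field_simp
  norm_num

/-- The solution decaying at `+∞` is a combination of the incoming and outgoing ones whose
coefficients are complex conjugate to each other. -/
theorem wron_decaying_incoming (h₁ : ∀ x : ℝ, (f₁ x).im = 0) (h₂ : ∀ x : ℝ, (f₂ x).im = 0)
    (hp : IsSystemSolution h c f₁ f₂ p)
    (hq : IsSystemSolution h c f₁ f₂ q) (hd : IsSystemSolution h c f₁ f₂ d)
    (hA : 0 < A) (hB : 0 < B) (hκ : 0 < κ)
    (hpA : JostAsymp p (I * k) ((A : ℂ), (A : ℂ)⁻¹) atBot)
    (hqA : JostAsymp q (I * (-k : ℝ)) ((A : ℂ), -(A : ℂ)⁻¹) atBot)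
    (hdB : JostAsymp d (-(κ : ℂ)) (-(I * B), (B : ℂ)⁻¹) atTop) (x : ℝ) :
    Wron (d x) (p x) = starRingEnd ℂ (Wron (d x) (q x)) := by
  have hA0 : (A : ℂ) ≠ 0 := ofReal_ne_zero.2 hA.ne'
  have hB0 : (B : ℂ) ≠ 0 := ofReal_ne_zero.2 hB.ne'
  have hpq : Wron (p 0) (q 0) ≠ 0 := by
    rw [hp.wron_incoming_outgoing hq hA hpA hqA]; norm_num
  have eq1 := (hq.conj h₁ h₂).eq_of_asymp hp hp hq hpq (l := atBot) (θ := I * k)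
    (a := ((A : ℂ), (A : ℂ)⁻¹)) (by simpa using hqA.conj) hpA (by simp [hA0])
    (Eventually.of_forall fun x => (norm_exp_I_mul_mul k x).le) x
  have eq2 := (hd.conj h₁ h₂).eq_of_asymp (hd.const_smul (-1)) hp hq hpq (l := atTop)
    (θ := -(κ : ℂ)) (a := (-1 : ℂ) • (-(I * B), (B : ℂ)⁻¹)) (by simpa using hdB.conj)
    (hdB.const_smul (-1)) (by simp [hB0])
    ((tendsto_exp_neg_mul hκ).norm.eventually_le_const (by simp)) x
  rw [Prod.ext_iff] at eq1 eq2
  simp only [Prod.smul_fst, Prod.smul_snd, smul_eq_mul] at eq1 eq2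
  rw [Wron, Wron, ← eq1.1, ← eq1.2, map_sub, map_mul, map_mul]
  linear_combination -starRingEnd ℂ (q x).2 * eq2.1 - starRingEnd ℂ (q x).1 * eq2.2

theorem incoming_add_smul_outgoing (h₁ : ∀ x : ℝ, (f₁ x).im = 0) (h₂ : ∀ x : ℝ, (f₂ x).im = 0)
    (hp : IsSystemSolution h c f₁ f₂ p)
    (hq : IsSystemSolution h c f₁ f₂ q) (hd : IsSystemSolution h c f₁ f₂ d)
    (hA : 0 < A) (hB : 0 < B) (hκ : 0 < κ)
    (hpA : JostAsymp p (I * k) ((A : ℂ), (A : ℂ)⁻¹) atBot)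
    (hqA : JostAsymp q (I * (-k : ℝ)) ((A : ℂ), -(A : ℂ)⁻¹) atBot)
    (hdB : JostAsymp d (-(κ : ℂ)) (-(I * B), (B : ℂ)⁻¹) atTop)
    (hw : Wron (d 0) (q 0) ≠ 0) (x : ℝ) :
    p x + (-(starRingEnd ℂ (Wron (d 0) (q 0))) / Wron (d 0) (q 0)) • q x
      = (-2 / Wron (d 0) (q 0)) • d x := by
  have e := Wron.smul_eq (d x) (p x) (q x)
  rw [hp.wron_incoming_outgoing hq hA hpA hqA,
    wron_decaying_incoming h₁ h₂ hp hq hd hA hB hκ hpA hqA hdB, hd.wron_eq hq x 0] at e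
  rw [div_eq_inv_mul, div_eq_inv_mul, mul_smul, mul_smul, e, ← smul_right_injective _ hw |>.eq_iff]
  simp only [smul_add, smul_inv_smul₀ hw, neg_smul, sub_eq_add_neg]

theorem bounded_iff (hp : IsSystemSolution h c f₁ f₂ p)
    (hq : IsSystemSolution h c f₁ f₂ q) (hd : IsSystemSolution h c f₁ f₂ d)
    (hA : 0 < A) (hB : 0 < B) (hκ : 0 < κ)
    (hpA : JostAsymp p (I * k) ((A : ℂ), (A : ℂ)⁻¹) atBot)
    (hqA : JostAsymp q (I * (-k : ℝ)) ((A : ℂ), -(A : ℂ)⁻¹) atBot)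
    (hdB : JostAsymp d (-(κ : ℂ)) (-(I * B), (B : ℂ)⁻¹) atTop) {α β : ℂ} (hβ : β ≠ 0)
    (hαβ : ∀ x, p x + α • q x = β • d x) :
    (IsSystemSolution h c f₁ f₂ u ∧ ∃ M : ℝ, ∀ x, ‖u x‖ ≤ M) ↔
      ∃ γ : ℂ, ∀ x, u x = γ • (p x + α • q x) := by
  have hd0 : Tendsto d atTop (𝓝 0) := hdB.tendsto_zero (tendsto_exp_neg_mul hκ)
  constructor
  · rintro ⟨hu, M, hM⟩
    have hpq : Wron (p 0) (q 0) ≠ 0 := by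
      rw [hp.wron_incoming_outgoing hq hA hpA hqA]; norm_num
    obtain ⟨y, hy⟩ := hdB.exists_ne_zero (by simp [hB.ne'])
    have hW : Wron (u y) (d y) = 0 := by
      refine hu.wron_eq_of_tendsto hd (l := atTop) ?_ y
      have h1 := (continuous_fst.tendsto _).comp hd0
      have h2 := (continuous_snd.tendsto _).comp hd0
      have b1 : IsBoundedUnder (· ≤ ·) atTop ((‖·‖) ∘ fun x => (u x).1) :=
        isBoundedUnder_of ⟨M, fun x => (norm_fst_le _).trans (hM x)⟩
      have b2 : IsBoundedUnder (· ≤ ·) atTop ((‖·‖) ∘ fun x => (u x).2) :=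
        isBoundedUnder_of ⟨M, fun x => (norm_snd_le _).trans (hM x)⟩
      have := (isBoundedUnder_le_mul_tendsto_zero b1 h2).sub
        (isBoundedUnder_le_mul_tendsto_zero b2 h1)
      rw [sub_zero] at this
      exact this
    obtain ⟨b, hb⟩ := hu.exists_eq_smul hd hp hq hpq hy hW
    exact ⟨b / β, fun x => by rw [hαβ, smul_smul, div_mul_cancel₀ _ hβ, hb]⟩
  · rintro ⟨γ, hγ⟩
    have hs : IsSystemSolution h c f₁ f₂ u := by
      rw [funext hγ]
      simpa using (hp.lincomb hq 1 α).const_smul γ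
    refine ⟨hs, hs.continuous.exists_norm_le_of_eventually (A := ‖γ‖ * ((‖((A : ℂ), (A : ℂ)⁻¹)‖ + 1)
      + ‖α‖ * (‖((A : ℂ), -(A : ℂ)⁻¹)‖ + 1))) (B := 1) ?_ ?_⟩
    · filter_upwards [hpA.eventually_bounded (norm_exp_I_mul_mul k),
        hqA.eventually_bounded (norm_exp_I_mul_mul (-k))] with x hx hx'
      rw [hγ, norm_smul]
      gcongr
      refine (norm_add_le _ _).trans ?_
      rw [norm_smul]
      gcongr
    · have : Tendsto u atTop (𝓝 0) := by
        have := hd0.const_smul (γ * β)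
        rw [smul_zero] at this
        exact this.congr fun x => by rw [hγ, hαβ, smul_smul]
      have := this.norm
      rw [norm_zero] at this
      exact this.eventually_le_const one_pos

end IsSystemSolution

theorem HasGevreyExpansion.exists_symbols {h₀ : ℝ} {F : ℝ → ℂ} {a : ℕ → ℂ} (h0 : 0 < h₀)
    (hF : HasGevreyExpansion h₀ F a) (ha : a 0 = 1) :
    ∃ φ₁ φ₂ : ℝ → ℂ, IsCAS φ₁ ∧ IsCAS φ₂ ∧ ∃ h₁, 0 < h₁ ∧ h₁ ≤ h₀ ∧ ∀ h, 0 < h → h < h₁ →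
      F h ≠ 0 ∧ 1 + h * φ₁ h = starRingEnd ℂ (F h) * (F h)⁻¹ ∧ 1 + h * φ₂ h = (F h)⁻¹ := by
  obtain ⟨h₁, h₁0, hle, hne, hinv⟩ := hF.inv h0 ha
  have hi : invCoeff a 0 = 1 := by rw [invCoeff]
  have hmul := ((hF.mono hle).star).mul h₁0 hinv
  refine ⟨_, _, hmul.tail.isCAS h₁0, hinv.tail.isCAS h₁0, h₁, h₁0, hle, fun h hh hh₁ =>
    ⟨hne h hh hh₁, ?_, ?_⟩⟩ <;>
  · have : (h : ℂ) ≠ 0 := ofReal_ne_zero.2 hh.ne'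
    rw [if_pos hh₁, mul_div_cancel₀ _ this]
    simp [hi, ha]

theorem AmpF_pos {m c lam : ℝ} (h : m * c ^ 2 < lam) (hm : 0 < m * c ^ 2) : 0 < AmpF m c lam :=
  Real.rpow_pos_of_pos (div_pos (by linarith) (by linarith)) _

theorem Bsym_pos {m c E W : ℝ} (h1 : W - m * c ^ 2 < E) (h2 : E < W + m * c ^ 2) :
    0 < Bsym m c E W :=
  Real.rpow_pos_of_pos (div_pos (by linarith) (by linarith)) _

/-- Total reflection at a fixed value of the semiclassical parameter. -/
theorem AssumptionA.dirac_total_reflection {h m c E Vm Vp : ℝ} {V : ℂ → ℂ}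
    (hA : AssumptionA V Vm Vp) (hh : 0 < h) (hm : 0 < m) (hc : 0 < c) (hE1 : m * c ^ 2 + Vm < E)
    (hE2 : Vp - m * c ^ 2 < E) (hE3 : E < Vp + m * c ^ 2) {p q d : ℝ → ℂ × ℂ}
    (hp : IsDiracSolution h m c V E p) (hq : IsDiracSolution h m c V E q)
    (hd : IsDiracSolution h m c V E d) (hpJ : JostCond h m c E Vm 1 1 atBot p)
    (hqJ : JostCond h m c E Vm (-1) (-1) atBot q) (hdJ : DecayCond h m c E Vp 1 atTop d)
    (hw : Wron (d 0) (q 0) ≠ 0) {α β : ℂ}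
    (hα : α = -starRingEnd ℂ (Wron (d 0) (q 0)) / Wron (d 0) (q 0))
    (hβ : β = -2 / Wron (d 0) (q 0)) :
    (∀ u : ℝ → ℂ × ℂ, (IsDiracSolution h m c V E u ∧ ∃ M : ℝ, ∀ x : ℝ, ‖u x‖ ≤ M) ↔
      ∃ γ : ℂ, ∀ x : ℝ, u x = γ • (p x + α • q x)) ∧ ∀ x : ℝ, p x + α • q x = β • d x := by
  have hmc : 0 < m * c ^ 2 := by positivity
  have hAmp : 0 < AmpF m c (E - Vm) := AmpF_pos (by linarith) hmc
  have hB : 0 < Bsym m c E Vp := Bsym_pos hE2 hE3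
  have hκ : 0 < √(m ^ 2 * c ^ 4 - (Vp - E) ^ 2) / (h * c) := by
    refine div_pos (Real.sqrt_pos.2 ?_) (by positivity)
    nlinarith
  rw [isDiracSolution_iff hh hc] at hp hq hd
  simp only [isDiracSolution_iff hh hc]
  have h₁ : ∀ x : ℝ, (diracLower m c E V x).im = 0 := fun x => by
    rw [diracLower, add_im, ofReal_im, hA.real_on_real, add_zero]
  have h₂ : ∀ x : ℝ, (diracUpper m c E V x).im = 0 := fun x => by
    rw [diracUpper, sub_im, ofReal_im, hA.real_on_real, sub_zero]
  have hpA : JostAsymp p (I * (PhiF m c (E - Vm) / (h * c) : ℝ))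
      ((AmpF m c (E - Vm) : ℂ), (AmpF m c (E - Vm) : ℂ)⁻¹) atBot := by
    rw [JostCond] at hpJ
    convert hpJ using 1
    · push_cast; ring
    · simp
  have hqA : JostAsymp q (I * (-(PhiF m c (E - Vm) / (h * c)) : ℝ))
      ((AmpF m c (E - Vm) : ℂ), -(AmpF m c (E - Vm) : ℂ)⁻¹) atBot := by
    rw [JostCond] at hqJ
    convert hqJ using 1
    · push_cast; ring
    · simp
  have hdB : JostAsymp d (-((√(m ^ 2 * c ^ 4 - (Vp - E) ^ 2) / (h * c) : ℝ) : ℂ))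
      (-(I * (Bsym m c E Vp : ℂ)), (Bsym m c E Vp : ℂ)⁻¹) atTop := by
    rw [DecayCond] at hdJ
    convert hdJ using 1
    · push_cast; ring
    · simp
  have hαβ : ∀ x, p x + α • q x = β • d x := fun x => by
    rw [hα, hβ]
    exact IsSystemSolution.incoming_add_smul_outgoing h₁ h₂ hp hq hd hAmp hB hκ hpA hqA hdB hw x
  have hβ0 : β ≠ 0 := by rw [hβ]; exact div_ne_zero (by norm_num) hw
  exact ⟨fun u => hp.bounded_iff hq hd hAmp hB hκ hpA hqA hdB hβ0 hαβ, hαβ⟩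

theorem exp_I_mul_pi_div_four_sq : exp (I * Real.pi / 4) ^ 2 = I := by
  have e : ((2 : ℕ) : ℂ) * (I * Real.pi / 4) = Real.pi / 2 * I := by push_cast; ring
  rw [← Complex.exp_nat_mul, e, exp_pi_div_two_mul_I]

/-- The reflection coefficient in terms of the normalized connection Wronskian. -/
theorem reflection_coefficient_eq {h J S : ℝ} (hh : 0 < h) {w F : ℂ} (hw : w ≠ 0)
    (hF : F = exp (-(I * Real.pi / 4)) * exp (1 / h * (J + I * S)) * (w / (2 * I))) :
    -I * (starRingEnd ℂ F * F⁻¹) * exp (2 * I / h * S) = -starRingEnd ℂ w / w := by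
  have hh0 : (h : ℂ) ≠ 0 := ofReal_ne_zero.2 hh.ne'
  have hFc : starRingEnd ℂ F = exp (I * Real.pi / 4) * exp (1 / h * (J - I * S))
      * (starRingEnd ℂ w / (-(2 * I))) := by
    rw [hF]
    simp only [map_mul, map_div₀, ← exp_conj, map_add, map_neg, conj_I, conj_ofReal, map_ofNat,
      map_one]
    ring_nf
  have h1 : exp (2 * I / h * S) = exp (1 / h * (J + I * S)) * (exp (1 / h * (J - I * S)))⁻¹ := by
    rw [← Complex.exp_neg, ← Complex.exp_add]
    congr 1
    ring
  have hr := exp_I_mul_pi_div_four_sq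
  rw [hFc, hF, h1, Complex.exp_neg]
  have e1 := Complex.exp_ne_zero (I * Real.pi / 4)
  have e2 := Complex.exp_ne_zero (1 / h * (J + I * S))
  have e3 := Complex.exp_ne_zero (1 / h * (J - I * S))
  have hI := I_ne_zero
  generalize exp (I * Real.pi / 4) = r at *
  generalize exp (1 / h * (J + I * S)) = Y at *
  generalize exp (1 / h * (J - I * S)) = Z at *
  field_simp
  rw [hr]
  linear_combination starRingEnd ℂ w * I_sq

/-- The matching constant in terms of the normalized connection Wronskian. -/
theorem matching_constant_eq {h : ℝ} {X w F : ℂ} (hw : w ≠ 0)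
    (hF : F = exp (-(I * Real.pi / 4)) * exp (1 / h * X) * (w / (2 * I))) :
    exp (I * Real.pi / 4) * F⁻¹ * exp (1 / h * X) = -2 / w := by
  have hr := exp_I_mul_pi_div_four_sq
  rw [hF, Complex.exp_neg]
  have e1 := Complex.exp_ne_zero (I * Real.pi / 4)
  have e2 := Complex.exp_ne_zero (1 / h * X)
  have hI := I_ne_zero
  generalize exp (I * Real.pi / 4) = r at *
  generalize exp (1 / h * X) = Y at *
  field_simp
  rw [hr, I_mul_I]

/-- **Total reflection** (Theorem 2.5).  Under assumption (A), `m > 0`, `E` in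
region II, and a unique simple real zero `t₁` of `m²c⁴ − (V(x)−E)²`, the space
of bounded solutions of `(H−E)u = 0` is one-dimensional, generated by
`u = ω_in^− + α_out^− ω_out^−` with
`α_out^− = −i(1+hφ₁(h)) exp{(2i/h)(∫_{−∞}^{t₁} Q⁻ + √E⁻ t₁)}`; moreover
`u = β_d^+ ω_d^+` with
`β_d^+ = e^{iπ/4}(1+hφ₂(h)) exp{(1/h)(∫_{+∞}^{t₁} Q₋⁺ + √(−E⁺) t₁ + i∫_{−∞}^{t₁} Q⁻ + i√E⁻ t₁)}`. -/
theorem total_reflection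
    (m c Vm Vp E : ℝ) (V : ℂ → ℂ)
    (hA : AssumptionA V Vm Vp) (hm : 0 < m) (hc : 0 < c)
    (hE1 : max (m * c ^ 2 + Vm) (Vp - m * c ^ 2) < E) (hE2 : E < Vp + m * c ^ 2)
    (t₁ : ℝ)
    (hzero : ∀ x : ℝ, m ^ 2 * c ^ 4 - ((V x).re - E) ^ 2 = 0 ↔ x = t₁)
    (hsimple : deriv (fun x : ℝ => m ^ 2 * c ^ 4 - ((V x).re - E) ^ 2) t₁ ≠ 0)
    (ωinm ωoutm ωd : ℝ → ℝ → ℂ × ℂ)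
    (hsol : ∀ h : ℝ, 0 < h →
      IsDiracSolution h m c V E (ωinm h) ∧ IsDiracSolution h m c V E (ωoutm h) ∧
      IsDiracSolution h m c V E (ωd h))
    (hjost : ∀ h : ℝ, 0 < h →
      JostCond h m c E Vm 1 1 atBot (ωinm h) ∧
      JostCond h m c E Vm (-1) (-1) atBot (ωoutm h) ∧
      DecayCond h m c E Vp 1 atTop (ωd h)) :
    ∃ φ₁ φ₂ : ℝ → ℂ, IsCAS φ₁ ∧ IsCAS φ₂ ∧
      ∃ h₀ > (0 : ℝ), ∀ h : ℝ, 0 < h → h < h₀ →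
        -- the reflection coefficient `α_out^−` and the matching constant `β_d^+`
        (∀ α β : ℂ,
          α = -Complex.I * (1 + (h : ℂ) * φ₁ h)
            * Complex.exp (2 * Complex.I / (h : ℂ)
              * ((((∫ t in Set.Iic t₁, Qsym m c E Vm V t)
                   + Real.sqrt (Esym m c E Vm) * t₁ : ℝ)) : ℂ)) →
          β = Complex.exp (Complex.I * (Real.pi : ℂ) / 4) * (1 + (h : ℂ) * φ₂ h)
            * Complex.exp ((1 / (h : ℂ))
              * (((((-∫ t in Set.Ici t₁, Qminus m c E Vp V t)
                    + Real.sqrt (-(Esym m c E Vp)) * t₁ : ℝ)) : ℂ)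
                + Complex.I * ((((∫ t in Set.Iic t₁, Qsym m c E Vm V t)
                    + Real.sqrt (Esym m c E Vm) * t₁ : ℝ)) : ℂ))) →
          -- the bounded solutions are exactly the multiples of `ω_in^− + α ω_out^−`
          (∀ u : ℝ → ℂ × ℂ,
            (IsDiracSolution h m c V E u ∧ ∃ M : ℝ, ∀ x : ℝ, ‖u x‖ ≤ M) ↔
            ∃ γ : ℂ, ∀ x : ℝ, u x = γ • (ωinm h x + α • ωoutm h x)) ∧
          -- and `ω_in^− + α ω_out^− = β ω_d^+`
          (∀ x : ℝ, ωinm h x + α • ωoutm h x = β • ωd h x)) := by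
  obtain ⟨hE1a, hE1b⟩ := max_lt_iff.1 hE1
  obtain ⟨a, ha, H⟩ :=
    hA.exists_gevrey_connection hm hc hE1a hE1b hE2 hzero hsimple
  have hF := H ωd ωoutm fun h h0 _ =>
    ⟨(hsol h h0).2.2, (hsol h h0).2.1, (hjost h h0).2.2, (hjost h h0).2.1⟩
  obtain ⟨φ₁, φ₂, hφ₁, hφ₂, h₁, h₁0, -, hφ⟩ := hF.exists_symbols one_pos ha
  refine ⟨φ₁, φ₂, hφ₁, hφ₂, h₁, h₁0, fun h h0 hh₁ α β hα hβ => ?_⟩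
  obtain ⟨hne, e₁, e₂⟩ := hφ h h0 hh₁
  have hw : Wron (ωd h 0) (ωoutm h 0) ≠ 0 := fun h' => hne (by rw [h', zero_div, mul_zero])
  rw [e₁, reflection_coefficient_eq h0 hw rfl] at hα
  rw [e₂, matching_constant_eq hw rfl] at hβ
  exact hA.dirac_total_reflection h0 hm hc hE1a hE1b hE2 (hsol h h0).1 (hsol h h0).2.1
    (hsol h h0).2.2 (hjost h h0).1 (hjost h h0).2.1 (hjost h h0).2.2 hw hα hβ
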